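/- Assume N ≥ 4 and p = 1 + 4/(N−3). Let n₀ be a non-negative integer and C₀ > 0. Then there exist ρ₀ > 1 and an analytic positive function u on [0, ρ₀) which solves the equation (PDE) on (0, ρ₀), satisfies u(0) > C₀ and u(1) = b₀, and is such that u − u_∞ has at least n₀ zeros on (0,1). -/

import Mathlib

open Set Filter

noncomputable def alphaP (p : ℝ) : ℝ := 2 / (p - 1)

noncomputable def b0 (p : ℝ) : ℝ := (2 * (p + 1) / (p - 1) ^ 2) ^ ((1 : ℝ) / (p - 1))

noncomputable def bInf (N : ℕ) (p : ℝ) : ℝ :=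
  (alphaP p * ((N : ℝ) - 2 - alphaP p)) ^ (alphaP p / 2)

noncomputable def uInf (N : ℕ) (p : ℝ) (ρ : ℝ) : ℝ := bInf N p * ρ ^ (-(alphaP p))

/-- `u` solves `(1-ρ²)u'' + ((N-1)/ρ - 2(α+1)ρ)u' - α(α+1)u + |u|^{p-1}u = 0` on `s`. -/
def IsSolOn (N : ℕ) (p : ℝ) (u : ℝ → ℝ) (s : Set ℝ) : Prop :=
  ∀ ρ ∈ s,
    (1 - ρ ^ 2) * deriv (deriv u) ρ
      + (((N : ℝ) - 1) / ρ - 2 * (alphaP p + 1) * ρ) * deriv u ρ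
      - alphaP p * (alphaP p + 1) * u ρ + |u ρ| ^ (p - 1) * u ρ = 0

open scoped Topology

/-- The constants of the profile equation, with `m = N - 2`. -/
structure Params (m : ℕ) (α p β b : ℝ) : Prop where
  α_pos : 0 < α
  m_eq : (m : ℝ) = 2 * α + 1
  p_eq : p = 1 + 2 / α
  β_eq : β = α * (α + 1)
  b_pos : 0 < b
  b_pow : b ^ (p - 1) = β

namespace Params

variable {m : ℕ} {α p β b : ℝ}

lemma two_le_m (h : Params m α p β b) : 2 ≤ m := by
  have h1 := h.m_eq
  have h2 := h.α_pos
  have : (1 : ℝ) < m := by linarith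
  exact_mod_cast this

lemma one_lt_p (h : Params m α p β b) : 1 < p := by
  rw [h.p_eq]
  have := h.α_pos
  have : 0 < 2 / α := by positivity
  linarith

lemma β_pos (h : Params m α p β b) : 0 < β := by
  rw [h.β_eq]
  have := h.α_pos
  positivity

lemma α_mul (h : Params m α p β b) : α * (p - 1) = 2 := by
  rw [h.p_eq]
  have := h.α_pos
  field_simp
  ring

end Params

/-- The reaction term `β u - |u|^{p-1} u`. -/
noncomputable def nonlin (p β u : ℝ) : ℝ := β * u - |u| ^ (p - 1) * u

lemma hasDerivAt_abs_rpow_mul_self {q : ℝ} (hq : 0 < q) (x : ℝ) :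
    HasDerivAt (fun x : ℝ => |x| ^ q * x) ((q + 1) * |x| ^ q) x := by
  rcases lt_trichotomy x 0 with hx | rfl | hx
  · have h1 : HasDerivAt (fun y : ℝ => (-y) ^ q * y) ((q + 1) * |x| ^ q) x := by
      have h2 := ((hasDerivAt_neg x).rpow_const (p := q) (Or.inl (by linarith))).mul
        (hasDerivAt_id x)
      convert! h2 using 1
      rw [abs_of_neg hx]
      have : (-x) ^ q = (-x) ^ (q - 1) * (-x) := by
        rw [← Real.rpow_add_one (by linarith)]; ring_nf
      simp only [id]
      rw [this]; ring
    refine h1.congr_of_eventuallyEq ?_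
    filter_upwards [Iio_mem_nhds hx] with y hy
    rw [abs_of_neg hy]
  · rw [hasDerivAt_iff_tendsto_slope]
    have h0 : ((q + 1) * |(0 : ℝ)| ^ q) = 0 := by simp [Real.zero_rpow hq.ne']
    rw [h0]
    have h1 : Tendsto (fun y : ℝ => |y| ^ q) (𝓝[≠] 0) (𝓝 0) := by
      have : Continuous (fun y : ℝ => |y| ^ q) :=
        continuous_abs.rpow_const (fun _ => Or.inr hq.le)
      have h2 := this.tendsto 0
      simp only [abs_zero, Real.zero_rpow hq.ne'] at h2
      exact h2.mono_left nhdsWithin_le_nhds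
    refine h1.congr' ?_
    filter_upwards [self_mem_nhdsWithin] with y hy
    have hy : y ≠ 0 := hy
    simp [slope_def_field, hy]
  · have h1 : HasDerivAt (fun y : ℝ => y ^ q * y) ((q + 1) * |x| ^ q) x := by
      have h2 := ((hasDerivAt_id x).rpow_const (p := q) (Or.inl hx.ne')).mul (hasDerivAt_id x)
      convert! h2 using 1
      rw [abs_of_pos hx]
      have : x ^ q = x ^ (q - 1) * x := by
        rw [← Real.rpow_add_one hx.ne']; ring_nf
      simp only [id]
      rw [this]; ring
    refine h1.congr_of_eventuallyEq ?_
    filter_upwards [Ioi_mem_nhds hx] with y hy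
    rw [abs_of_pos hy]

lemma hasDerivAt_nonlin {p β : ℝ} (hp : 1 < p) (x : ℝ) :
    HasDerivAt (nonlin p β) (β - p * |x| ^ (p - 1)) x := by
  have h1 := hasDerivAt_abs_rpow_mul_self (q := p - 1) (by linarith) x
  have h2 := ((hasDerivAt_id x).const_mul β).sub h1
  convert! h2 using 1
  simp

lemma continuous_nonlin {p β : ℝ} (hp : 1 < p) : Continuous (nonlin p β) :=
  continuous_iff_continuousAt.2 fun x => (hasDerivAt_nonlin hp x).continuousAt

lemma nonlin_neg {p β : ℝ} (x : ℝ) : nonlin p β (-x) = -nonlin p β x := by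
  simp [nonlin]; ring

lemma exists_lipschitz_nonlin {p β : ℝ} (hp : 1 < p) (M : ℝ) :
    ∃ L : ℝ, 0 < L ∧ ∀ x y : ℝ, |x| ≤ M → |y| ≤ M →
      |nonlin p β x - nonlin p β y| ≤ L * |x - y| := by
  refine ⟨|β| + p * |M| ^ (p - 1) + 1, by positivity, fun x y hx hy => ?_⟩
  have key := Convex.norm_image_sub_le_of_norm_hasDerivWithin_le (f := nonlin p β)
    (f' := fun x => β - p * |x| ^ (p - 1)) (s := Icc (-M) M)
    (C := |β| + p * |M| ^ (p - 1) + 1) (x := y) (y := x)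
    (fun z _ => (hasDerivAt_nonlin hp z).hasDerivWithinAt) (fun z hz => ?_)
    (convex_Icc _ _) (abs_le.1 hy) (abs_le.1 hx)
  · simpa [Real.norm_eq_abs] using key
  · have h1 : |z| ^ (p - 1) ≤ |M| ^ (p - 1) := by
      apply Real.rpow_le_rpow (abs_nonneg _) _ (by linarith)
      exact (abs_le.2 hz).trans (le_abs_self M)
    have h2 : 0 ≤ |z| ^ (p - 1) := by positivity
    rw [Real.norm_eq_abs]
    calc |β - p * |z| ^ (p - 1)| ≤ |β| + |p * |z| ^ (p - 1)| := abs_sub _ _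
      _ = |β| + p * |z| ^ (p - 1) := by rw [abs_of_nonneg (a := p * _) (by positivity)]
      _ ≤ _ := by nlinarith

/-- The Volterra kernel of the linear part of the profile equation. -/
noncomputable def volKer (m : ℕ) (ρ σ : ℝ) : ℝ :=
  σ * (1 - (σ / max ρ σ) ^ m) / (m * (1 - σ ^ 2))

lemma volKer_nonneg {m : ℕ} {ρ σ : ℝ} (h0 : 0 < σ) (h1 : σ < 1) : 0 ≤ volKer m ρ σ := by
  have h2 : σ / max ρ σ ≤ 1 := by
    rw [div_le_one (lt_max_of_lt_right h0)]; exact le_max_right _ _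
  have h3 : 0 ≤ σ / max ρ σ := by
    have := lt_max_of_lt_right (b := ρ) h0
    positivity
  have h4 := pow_le_one₀ (n := m) h3 h2
  unfold volKer
  apply div_nonneg
  · exact mul_nonneg h0.le (by linarith)
  · exact mul_nonneg (by positivity) (by nlinarith)

lemma one_sub_pow_le_mul {x : ℝ} (h0 : 0 ≤ x) (m : ℕ) : 1 - x ^ m ≤ m * (1 - x) := by
  have := one_add_mul_le_pow (a := x - 1) (by linarith) m
  simp only [add_sub_cancel] at this
  linarith

lemma volKer_le_one {m : ℕ} (hm : 0 < m) {ρ σ : ℝ} (h0 : 0 < σ) (h1 : σ < 1) (hρ : ρ ≤ 1) :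
    volKer m ρ σ ≤ 1 := by
  have hmax := lt_max_of_lt_right (b := ρ) h0
  have hmax1 : max ρ σ ≤ 1 := max_le hρ h1.le
  have h3 : 0 ≤ σ / max ρ σ := by positivity
  have h4 := one_sub_pow_le_mul h3 m
  have hm' : (0 : ℝ) < m := by exact_mod_cast hm
  have h5 : σ ≤ σ / max ρ σ := by
    rw [le_div_iff₀ hmax]; nlinarith
  have h6 : σ / max ρ σ ≤ 1 := by
    rw [div_le_one hmax]; exact le_max_right _ _
  unfold volKer
  rw [div_le_one (mul_pos hm' (by nlinarith))]
  calc σ * (1 - (σ / max ρ σ) ^ m) ≤ σ * (m * (1 - σ / max ρ σ)) := by gcongr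
    _ = m * (σ * (1 - σ / max ρ σ)) := by ring
    _ ≤ m * (1 * (1 - σ ^ 2)) := by
      apply mul_le_mul_of_nonneg_left _ hm'.le
      apply mul_le_mul h1.le _ (by linarith) (by norm_num)
      nlinarith
    _ = _ := by ring

lemma abs_volKer_le_one {m : ℕ} (hm : 0 < m) {ρ σ : ℝ} (h0 : 0 < σ) (h1 : σ ≤ 1) (hρ : ρ ≤ 1) :
    |volKer m ρ σ| ≤ 1 := by
  rcases h1.eq_or_lt with rfl | h1
  · simp [volKer]
  rw [abs_of_nonneg (volKer_nonneg h0 h1)]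
  exact volKer_le_one hm h0 h1 hρ

lemma volKer_of_le {m : ℕ} {ρ σ : ℝ} (h0 : 0 < σ) (h : ρ ≤ σ) : volKer m ρ σ = 0 := by
  simp [volKer, max_eq_right h, h0.ne']

lemma volKer_of_ge {m : ℕ} {ρ σ : ℝ} (h : σ ≤ ρ) :
    volKer m ρ σ = σ * (1 - (σ / ρ) ^ m) / (m * (1 - σ ^ 2)) := by
  simp [volKer, max_eq_left h]

lemma continuous_volKer_left {m : ℕ} {σ : ℝ} (h0 : 0 < σ) : Continuous fun ρ => volKer m ρ σ := by
  unfold volKer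
  have : ∀ ρ, max ρ σ ≠ 0 := fun ρ => (lt_max_of_lt_right h0).ne'
  fun_prop (disch := assumption)

lemma measurable_volKer {m : ℕ} {ρ : ℝ} : Measurable fun σ => volKer m ρ σ := by
  unfold volKer
  fun_prop

lemma continuous_integral_volKer {m : ℕ} (hm : 0 < m) {h : ℝ → ℝ} (hh : Continuous h) :
    Continuous fun ρ => ∫ σ in (0 : ℝ)..1, volKer m (min ρ 1) σ * h σ := by
  apply intervalIntegral.continuous_of_dominated_interval (bound := fun σ => |h σ|)
  · intro ρ
    exact (measurable_volKer.mul hh.measurable).aestronglyMeasurable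
  · intro ρ
    refine Eventually.of_forall fun σ hσ => ?_
    rw [uIoc_of_le zero_le_one] at hσ
    rw [norm_mul, Real.norm_eq_abs, Real.norm_eq_abs]
    have := abs_volKer_le_one hm hσ.1 hσ.2 (min_le_right ρ 1)
    exact mul_le_of_le_one_left (abs_nonneg _) this
  · exact hh.abs.intervalIntegrable _ _
  · refine Eventually.of_forall fun σ hσ => ?_
    rw [uIoc_of_le zero_le_one] at hσ
    exact ((continuous_volKer_left hσ.1).comp (continuous_id.min continuous_const)).mul_const _

lemma intervalIntegrable_volKer {m : ℕ} (hm : 0 < m) {h : ℝ → ℝ} (hh : Continuous h) {ρ : ℝ}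
    (hρ : ρ ≤ 1) :
    IntervalIntegrable (fun σ => volKer m ρ σ * h σ) MeasureTheory.volume 0 1 := by
  have h1 : IntervalIntegrable (fun σ => |h σ|) MeasureTheory.volume 0 1 :=
    hh.abs.intervalIntegrable _ _
  refine h1.mono_fun (measurable_volKer.mul hh.measurable).aestronglyMeasurable ?_
  refine (MeasureTheory.ae_restrict_iff' measurableSet_uIoc).2 (Eventually.of_forall fun σ hσ => ?_)
  rw [uIoc_of_le zero_le_one] at hσ
  simp only [norm_mul, Real.norm_eq_abs, abs_abs]
  exact mul_le_of_le_one_left (abs_nonneg _) (abs_volKer_le_one hm hσ.1 hσ.2 hρ)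

lemma integral_volKer_eq {m : ℕ} {ρ : ℝ} (h0 : 0 ≤ ρ) (h1 : ρ ≤ 1) (d : ℝ → ℝ) :
    ∫ σ in (0 : ℝ)..1, volKer m ρ σ * d σ = ∫ σ in (0 : ℝ)..ρ, volKer m ρ σ * d σ := by
  rw [intervalIntegral.integral_of_le zero_le_one, intervalIntegral.integral_of_le h0]
  apply MeasureTheory.setIntegral_eq_of_subset_of_forall_sdiff_eq_zero measurableSet_Ioc
    (Ioc_subset_Ioc_right h1)
  rintro σ ⟨hσ, hσ'⟩
  have : ρ ≤ σ := by
    by_contra hlt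
    exact hσ' ⟨hσ.1, (not_le.1 hlt).le⟩
  rw [volKer_of_le hσ.1 this, zero_mul]

lemma abs_integral_volKer_le {m : ℕ} (hm : 0 < m) {ρ l D : ℝ} (h0 : 0 ≤ ρ) (h1 : ρ ≤ 1)
    (hl : 0 < l) (hD : 0 ≤ D) {d : ℝ → ℝ} (hd : ∀ σ ∈ Ioc (0 : ℝ) 1, |d σ| ≤ D * Real.exp (l * σ)) :
    |∫ σ in (0 : ℝ)..1, volKer m ρ σ * d σ| ≤ D * Real.exp (l * ρ) / l := by
  rw [integral_volKer_eq h0 h1]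
  have key := intervalIntegral.norm_integral_le_of_norm_le (μ := MeasureTheory.volume) h0
    (f := fun σ => volKer m ρ σ * d σ) (g := fun σ => D * Real.exp (l * σ))
    (Eventually.of_forall fun σ hσ => ?_) (Continuous.intervalIntegrable (by fun_prop) _ _)
  · rw [Real.norm_eq_abs] at key
    refine key.trans ?_
    have : ∫ σ in (0 : ℝ)..ρ, D * Real.exp (l * σ)
        = D * Real.exp (l * ρ) / l - D * Real.exp (l * 0) / l := by
      apply intervalIntegral.integral_eq_sub_of_hasDerivAt (f := fun σ => D * Real.exp (l * σ) / l)
      · intro x _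
        have h2 := ((((hasDerivAt_id x).const_mul l).exp).const_mul D).div_const l
        convert! h2 using 1
        simp only [id]
        field_simp
      · exact Continuous.intervalIntegrable (by fun_prop) _ _
    rw [this]
    have : 0 ≤ D * Real.exp (l * 0) / l := by positivity
    linarith
  · rw [norm_mul, Real.norm_eq_abs, Real.norm_eq_abs]
    have h2 := abs_volKer_le_one hm hσ.1 (hσ.2.trans h1) h1
    exact (mul_le_of_le_one_left (abs_nonneg _) h2).trans (hd σ ⟨hσ.1, hσ.2.trans h1⟩)

lemma exists_volterra {m : ℕ} (hm : 0 < m) {G : ℝ → ℝ} {K : ℝ} (hK : 0 < K)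
    (hG : ∀ x y, |G x - G y| ≤ K * |x - y|) (A : ℝ) :
    ∃ u : ℝ → ℝ, Continuous u ∧
      ∀ ρ ∈ Icc (0 : ℝ) 1, u ρ = A + ∫ σ in (0 : ℝ)..1, volKer m ρ σ * G (u σ) := by
  have hGc : Continuous G := by
    have : LipschitzWith K.toNNReal G := LipschitzWith.of_dist_le_mul fun x y => by
      rw [Real.dist_eq, Real.dist_eq, Real.coe_toNNReal _ hK.le]; exact hG x y
    exact this.continuous
  set l := 2 * K with hl
  have hl0 : 0 < l := by positivity
  let unweight : C(Icc (0 : ℝ) 1, ℝ) → ℝ → ℝ := fun U σ =>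
    Real.exp (l * σ) * U (projIcc 0 1 zero_le_one σ)
  have hunweight : ∀ U, Continuous (unweight U) := fun U => by
    have : Continuous fun σ : ℝ => U (projIcc 0 1 zero_le_one σ) :=
      U.continuous.comp continuous_projIcc
    exact Continuous.mul (by fun_prop) this
  let T : C(Icc (0 : ℝ) 1, ℝ) → C(Icc (0 : ℝ) 1, ℝ) := fun U =>
    ⟨fun ρ => Real.exp (-(l * ρ)) *
        (A + ∫ σ in (0 : ℝ)..1, volKer m (min (ρ : ℝ) 1) σ * G (unweight U σ)), by
      have := (continuous_integral_volKer hm (hGc.comp (hunweight U))).comp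
        (continuous_subtype_val (p := fun x => x ∈ Icc (0 : ℝ) 1))
      exact Continuous.mul (by fun_prop) (continuous_const.add this)⟩
  have hT : ContractingWith (1 / 2) T := by
    refine ⟨by rw [← NNReal.coe_lt_coe]; norm_num, LipschitzWith.of_dist_le_mul fun U V => ?_⟩
    rw [ContinuousMap.dist_le (by positivity)]
    intro ρ
    have hρ := ρ.2
    have hmin : min (ρ : ℝ) 1 = ρ := min_eq_left hρ.2
    simp only [T, ContinuousMap.coe_mk, hmin, Real.dist_eq]
    rw [← mul_sub, abs_mul, add_sub_add_left_eq_sub, ← intervalIntegral.integral_sub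
      (intervalIntegrable_volKer hm (h := fun σ => G (unweight U σ)) (hGc.comp (hunweight U)) hρ.2)
      (intervalIntegrable_volKer hm (h := fun σ => G (unweight V σ)) (hGc.comp (hunweight V)) hρ.2)]
    simp only [← mul_sub]
    have h1 := abs_integral_volKer_le hm hρ.1 hρ.2 hl0 (D := K * dist U V) (by positivity)
      (d := fun σ => G (unweight U σ) - G (unweight V σ)) (fun σ hσ => by
        refine (hG _ _).trans ?_
        simp only [unweight]
        rw [← mul_sub, abs_mul, abs_of_pos (Real.exp_pos _)]
        have h2 : |U (projIcc 0 1 zero_le_one σ) - V (projIcc 0 1 zero_le_one σ)| ≤ dist U V := by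
          rw [← Real.dist_eq]; exact ContinuousMap.dist_apply_le_dist _
        calc K * (Real.exp (l * σ) * |_|) ≤ K * (Real.exp (l * σ) * dist U V) := by gcongr
          _ = _ := by ring)
    rw [abs_of_pos (Real.exp_pos _)]
    refine (mul_le_mul_of_nonneg_left h1 (Real.exp_pos _).le).trans ?_
    have h3 : Real.exp (-(l * ρ)) * Real.exp (l * ρ) = 1 := by
      rw [← Real.exp_add]; simp
    have h4 : Real.exp (-(l * ρ)) * (K * dist U V * Real.exp (l * ρ) / l)
        = (Real.exp (-(l * ρ)) * Real.exp (l * ρ)) * (K * dist U V / l) := by ring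
    rw [h4, h3, hl]
    apply le_of_eq
    push_cast
    field_simp
  have hfix := hT.fixedPoint_isFixedPt
  set U := ContractingWith.fixedPoint T hT
  refine ⟨unweight U, hunweight U, fun ρ hρ => ?_⟩
  have h1 : U ⟨ρ, hρ⟩ = T U ⟨ρ, hρ⟩ := by rw [hfix.eq]
  have h2 : unweight U ρ = Real.exp (l * ρ) * U ⟨ρ, hρ⟩ := by
    simp only [unweight, projIcc_of_mem zero_le_one hρ]
  rw [h2, h1]
  simp only [T, ContinuousMap.coe_mk, min_eq_left hρ.2]
  rw [← mul_assoc, ← Real.exp_add]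
  simp

/-- The flux `∫₀^ρ σ^(m+1) f(σ) dσ`. -/
noncomputable def flux (m : ℕ) (h : ℝ → ℝ) (ρ : ℝ) : ℝ :=
  ∫ σ in (0 : ℝ)..ρ, σ ^ (m + 1) * (h σ / (1 - σ ^ 2))

lemma one_sub_sq_pos {σ : ℝ} (h : σ ∈ Ioo (-1 : ℝ) 1) : 0 < 1 - σ ^ 2 := by
  nlinarith [h.1, h.2]

lemma continuousOn_div_one_sub_sq {h : ℝ → ℝ} (hh : Continuous h) :
    ContinuousOn (fun σ => h σ / (1 - σ ^ 2)) (Ioo (-1) 1) :=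
  hh.continuousOn.div (by fun_prop) fun _ hσ => (one_sub_sq_pos hσ).ne'

lemma hasDerivAt_integral_zero {f : ℝ → ℝ} (hf : ContinuousOn f (Ioo (-1) 1)) {ρ : ℝ}
    (hρ : ρ ∈ Ioo (-1 : ℝ) 1) : HasDerivAt (fun x => ∫ σ in (0 : ℝ)..x, f σ) (f ρ) ρ := by
  apply intervalIntegral.integral_hasDerivAt_right
  · exact (hf.mono (Set.ordConnected_Ioo.uIcc_subset (by norm_num) hρ)).intervalIntegrable
  · exact hf.stronglyMeasurableAtFilter isOpen_Ioo _ hρ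
  · exact hf.continuousAt (Ioo_mem_nhds hρ.1 hρ.2)

lemma hasDerivAt_flux {m : ℕ} {h : ℝ → ℝ} (hh : Continuous h) {ρ : ℝ} (hρ : ρ ∈ Ioo (-1 : ℝ) 1) :
    HasDerivAt (flux m h) (ρ ^ (m + 1) * (h ρ / (1 - ρ ^ 2))) ρ :=
  hasDerivAt_integral_zero
    (f := fun σ => σ ^ (m + 1) * (h σ / (1 - σ ^ 2)))
    (ContinuousOn.mul (by fun_prop) (continuousOn_div_one_sub_sq hh)) hρ

lemma abs_flux_le {m : ℕ} {h : ℝ → ℝ} {ρ C : ℝ} (h0 : 0 ≤ ρ) (h1 : ρ ^ 2 ≤ 1 / 2)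
    (hC : ∀ σ ∈ Icc 0 ρ, |h σ| ≤ C) : |flux m h ρ| ≤ 2 * C * ρ * ρ ^ (m + 1) := by
  have key := intervalIntegral.norm_integral_le_of_norm_le_const (a := 0) (b := ρ)
    (f := fun σ => σ ^ (m + 1) * (h σ / (1 - σ ^ 2))) (C := ρ ^ (m + 1) * (2 * C)) (fun σ hσ => ?_)
  · rw [Real.norm_eq_abs, sub_zero, abs_of_nonneg h0] at key
    unfold flux
    linarith
  · rw [uIoc_of_le h0] at hσ
    have h2 : σ ^ 2 ≤ ρ ^ 2 := by nlinarith [hσ.1, hσ.2]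
    have h3 : 1 / 2 ≤ 1 - σ ^ 2 := by linarith
    have h4 := hC σ ⟨hσ.1.le, hσ.2⟩
    have h5 : |h σ| / (1 - σ ^ 2) ≤ 2 * C := by
      rw [div_le_iff₀ (by linarith)]
      nlinarith [abs_nonneg (h σ)]
    rw [norm_mul, Real.norm_eq_abs, Real.norm_eq_abs, abs_div, abs_of_pos (a := 1 - σ ^ 2)
      (by linarith), abs_of_nonneg (pow_nonneg hσ.1.le _)]
    have h6 := pow_le_pow_left₀ hσ.1.le hσ.2 (m + 1)
    have h7 : 0 ≤ |h σ| / (1 - σ ^ 2) := div_nonneg (abs_nonneg _) (by linarith)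
    exact mul_le_mul h6 h5 h7 (by positivity)

/-- A solution of the Volterra form of the profile equation is differentiable on `(0,1)`. -/
lemma hasDerivAt_of_volterra {m : ℕ} (hm : 0 < m) {h u : ℝ → ℝ} (hh : Continuous h) {A : ℝ}
    (hu : ∀ ρ ∈ Icc (0 : ℝ) 1, u ρ = A + ∫ σ in (0 : ℝ)..1, volKer m ρ σ * h σ) {ρ : ℝ}
    (hρ : ρ ∈ Ioo (0 : ℝ) 1) : HasDerivAt u (flux m h ρ / ρ ^ (m + 1)) ρ := by
  have hm' : (m : ℝ) ≠ 0 := by positivity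
  have hf := continuousOn_div_one_sub_sq hh
  have hσf : ContinuousOn (fun σ => σ * (h σ / (1 - σ ^ 2))) (Ioo (-1) 1) :=
    ContinuousOn.mul (by fun_prop) hf
  have hσm : ContinuousOn (fun σ => σ ^ (m + 1) * (h σ / (1 - σ ^ 2))) (Ioo (-1) 1) :=
    ContinuousOn.mul (by fun_prop) hf
  have hρ' : ρ ∈ Ioo (-1 : ℝ) 1 := ⟨by linarith [hρ.1], hρ.2⟩
  have h1 := hasDerivAt_integral_zero hσf hρ'
  have h2 := hasDerivAt_flux (m := m) hh hρ'
  have h3 : HasDerivAt (fun x : ℝ => (x ^ m)⁻¹) (-(m * ρ ^ (m - 1)) / (ρ ^ m) ^ 2) ρ :=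
    (hasDerivAt_pow m ρ).inv (pow_ne_zero _ hρ.1.ne')
  have h4 := ((h1.sub (h3.mul h2)).div_const (m : ℝ)).const_add A
  have h5 : HasDerivAt u _ ρ := h4.congr_of_eventuallyEq ?_
  · convert! h5 using 1
    obtain ⟨k, rfl⟩ : ∃ k, m = k + 1 := ⟨m - 1, by omega⟩
    have := hρ.1.ne'
    have h6 := (one_sub_sq_pos hρ').ne'
    simp only [add_tsub_cancel_right]
    field_simp
    ring
  · filter_upwards [Ioo_mem_nhds hρ.1 hρ.2] with x hx
    rw [hu x ⟨hx.1.le, hx.2.le⟩, integral_volKer_eq hx.1.le hx.2.le]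
    congr 1
    have hsub : uIcc 0 x ⊆ Ioo (-1 : ℝ) 1 :=
      Set.ordConnected_Ioo.uIcc_subset (by norm_num) ⟨by linarith [hx.1], hx.2⟩
    simp only [Pi.sub_apply, Pi.mul_apply, flux]
    rw [← intervalIntegral.integral_const_mul, ← intervalIntegral.integral_sub
      (hσf.mono hsub).intervalIntegrable ((hσm.mono hsub).intervalIntegrable.const_mul _),
      ← intervalIntegral.integral_div]
    apply intervalIntegral.integral_congr
    intro σ hσ
    rw [uIcc_of_le hx.1.le] at hσ
    have hx0 := hx.1.ne'
    have : 1 - σ ^ 2 ≠ 0 := (one_sub_sq_pos (hsub (by rwa [uIcc_of_le hx.1.le]))).ne'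
    simp only [volKer_of_ge hσ.2, div_pow]
    field_simp
    ring

/-- Variation of constants for the radial operator with weight `ρ ^ (m + 1)`. -/
lemma variation_of_constants {m : ℕ} (hm : 0 < m) {D H F : ℝ → ℝ} {a x : ℝ} (ha : 0 < a)
    (hx : 0 < x) (hDc : ContinuousOn D (uIcc a x)) (hHc : ContinuousOn H (uIcc a x))
    (hD : ∀ y ∈ Ioo (min a x) (max a x), HasDerivAt D (H y / y ^ (m + 1)) y)
    (hH : ∀ y ∈ Ioo (min a x) (max a x), HasDerivAt H (y ^ (m + 1) * F y) y)
    (hF : IntervalIntegrable (fun σ => σ * (1 - (σ / x) ^ m) / m * F σ) MeasureTheory.volume a x) :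
    D x = D a + H a * ((a ^ m)⁻¹ - (x ^ m)⁻¹) / m
      + ∫ σ in a..x, σ * (1 - (σ / x) ^ m) / m * F σ := by
  have hpos : ∀ y ∈ uIcc a x, y ≠ 0 := fun y hy =>
    ((lt_min ha hx).trans_le hy.1).ne'
  have hm' : (m : ℝ) ≠ 0 := by positivity
  have key := intervalIntegral.integral_eq_sub_of_hasDeriv_right
    (f := fun σ => D σ + H σ * ((σ ^ m)⁻¹ - (x ^ m)⁻¹) / m)
    (f' := fun σ => σ * (1 - (σ / x) ^ m) / m * F σ) (a := a) (b := x) ?_ (fun y hy => ?_) hF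
  · rw [key, sub_self, mul_zero, zero_div]
    ring
  · apply hDc.add
    apply ContinuousOn.div_const
    apply hHc.mul
    apply ContinuousOn.sub _ continuousOn_const
    exact ContinuousOn.inv₀ (by fun_prop) fun y hy => pow_ne_zero _ (hpos y hy)
  · have hy0 : y ≠ 0 := hpos y (Ioo_subset_Icc_self hy)
    have h3 : HasDerivAt (fun x : ℝ => (x ^ m)⁻¹) (-(m * y ^ (m - 1)) / (y ^ m) ^ 2) y :=
      (hasDerivAt_pow m y).inv (pow_ne_zero _ hy0)
    have h4 := (hD y hy).add (((hH y hy).mul (h3.sub_const ((x ^ m)⁻¹))).div_const (m : ℝ))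
    refine HasDerivAt.hasDerivWithinAt ?_
    convert! h4 using 1
    obtain ⟨k, rfl⟩ : ∃ k, m = k + 1 := ⟨m - 1, by omega⟩
    simp only [add_tsub_cancel_right, div_pow]
    have := hx.ne'
    field_simp
    ring

/-- Solutions on `[0,1]` of the Volterra form of the profile equation with `u 0 = A`. -/
structure ProfileSol (m : ℕ) (p β A : ℝ) (u : ℝ → ℝ) : Prop where
  cont : Continuous u
  zero : u 0 = A
  bound : ∀ ρ ∈ Icc (0 : ℝ) 1, |u ρ| ≤ A
  volterra : ∀ ρ ∈ Icc (0 : ℝ) 1,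
    u ρ = A + ∫ σ in (0 : ℝ)..1, volKer m ρ σ * nonlin p β (u σ)

lemma volterra_zero {m : ℕ} {A : ℝ} {h u : ℝ → ℝ}
    (hu : ∀ ρ ∈ Icc (0 : ℝ) 1, u ρ = A + ∫ σ in (0 : ℝ)..1, volKer m ρ σ * h σ) : u 0 = A := by
  rw [hu 0 (by norm_num), integral_volKer_eq le_rfl zero_le_one]
  simp

lemma hasDerivAt_div_pow {m : ℕ} {H : ℝ → ℝ} {F x : ℝ} (hx : x ≠ 0)
    (hH : HasDerivAt H (x ^ (m + 1) * F) x) :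
    HasDerivAt (fun x => H x / x ^ (m + 1)) (F - (m + 1) / x * (H x / x ^ (m + 1))) x := by
  have h := hH.fun_div (hasDerivAt_pow (m + 1) x) (pow_ne_zero _ hx)
  convert! h using 1
  have hxm := pow_ne_zero m hx
  simp only [Nat.add_sub_cancel, pow_succ]
  push_cast
  field_simp

/-- The energy `(1 - ρ²) u'²/2 + V(u)`, where `V' = -G`, never exceeds its value at the origin. -/
lemma potential_le_of_volterra {m : ℕ} (hm : 0 < m) {A : ℝ} {G V u : ℝ → ℝ} (hG : Continuous G)
    (hV : ∀ x, HasDerivAt V (-G x) x) (huc : Continuous u)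
    (hu : ∀ ρ ∈ Icc (0 : ℝ) 1, u ρ = A + ∫ σ in (0 : ℝ)..1, volKer m ρ σ * G (u σ))
    {ρ : ℝ} (hρ : ρ ∈ Icc (0 : ℝ) 1) : V (u ρ) ≤ V A := by
  have hh : Continuous fun σ => G (u σ) := hG.comp huc
  have hVc : Continuous V := continuous_iff_continuousAt.2 fun x => (hV x).continuousAt
  have hu0 := volterra_zero (h := fun σ => G (u σ)) hu
  set H := flux m (fun σ => G (u σ)) with hH
  let E : ℝ → ℝ := fun x => (H x / x ^ (m + 1)) ^ 2 * (1 - x ^ 2) / 2 + V (u x)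
  have hderiv : ∀ x ∈ Ioo (0 : ℝ) 1, HasDerivAt E
      (-((m + 1) / x * (1 - x ^ 2) + x) * (H x / x ^ (m + 1)) ^ 2) x := fun x hx => by
    have h1 := hasDerivAt_of_volterra hm hh hu hx
    have hx' : x ∈ Ioo (-1 : ℝ) 1 := ⟨by linarith [hx.1], hx.2⟩
    have h2 := hasDerivAt_flux (m := m) hh hx'
    have hx0 := hx.1.ne'
    have h3 := (hasDerivAt_div_pow hx0 h2).fun_pow 2
    have h4 := ((h3.fun_mul ((hasDerivAt_pow 2 x).const_sub 1)).div_const 2).fun_add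
      ((hV (u x)).comp x h1)
    have h5 := (one_sub_sq_pos hx').ne'
    convert! h4 using 1
    simp only [← hH]
    generalize H x / x ^ (m + 1) = v
    field_simp
    push_cast
    ring
  have hanti : AntitoneOn E (Ioo 0 1) := by
    apply antitoneOn_of_deriv_nonpos (convex_Ioo 0 1)
    · exact fun x hx => (hderiv x hx).continuousAt.continuousWithinAt
    · exact fun x hx => (hderiv x (interior_subset hx)).differentiableAt.differentiableWithinAt
    · intro x hx
      have hx := interior_subset hx
      rw [(hderiv x hx).deriv]
      have := one_sub_sq_pos (σ := x) ⟨by linarith [hx.1], hx.2⟩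
      have := hx.1
      have : 0 ≤ ((m + 1) / x * (1 - x ^ 2) + x) := by positivity
      nlinarith [sq_nonneg (H x / x ^ (m + 1))]
  have hlim : Tendsto E (𝓝[>] 0) (𝓝 (V A)) := by
    obtain ⟨C, hC⟩ := (isCompact_Icc (a := (0 : ℝ)) (b := 1)).exists_bound_of_continuousOn
      hh.continuousOn
    have h1 : Tendsto (fun x => H x / x ^ (m + 1)) (𝓝[>] 0) (𝓝 0) := by
      apply squeeze_zero_norm' (a := fun x => 2 * C * x)
      · filter_upwards [Ioo_mem_nhdsGT (show (0 : ℝ) < 1 / 2 by norm_num)] with x hx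
        have h2 := abs_flux_le (m := m) (h := fun σ => G (u σ)) (C := C) hx.1.le
          (by nlinarith [hx.1, hx.2]) (fun σ hσ => hC σ ⟨hσ.1, by linarith [hσ.2, hx.2]⟩)
        have := hx.1
        rw [Real.norm_eq_abs, abs_div, abs_of_pos (a := x ^ (m + 1)) (by positivity),
          div_le_iff₀ (by positivity)]
        exact h2
      · have : Continuous fun x : ℝ => 2 * C * x := by fun_prop
        simpa using (this.tendsto 0).mono_left nhdsWithin_le_nhds
    have h2 : Tendsto (fun x => V (u x)) (𝓝[>] 0) (𝓝 (V A)) := by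
      have := ((hVc.comp huc).tendsto 0).mono_left (nhdsWithin_le_nhds (s := Ioi 0))
      simpa [hu0, Function.comp_def] using this
    have h3 : Tendsto (fun x : ℝ => 1 - x ^ 2) (𝓝[>] 0) (𝓝 1) := by
      have : Continuous fun x : ℝ => 1 - x ^ 2 := by fun_prop
      simpa using (this.tendsto 0).mono_left nhdsWithin_le_nhds
    simpa using (((h1.pow 2).mul h3).div_const 2).add h2
  have hin : ∀ x ∈ Ioo (0 : ℝ) 1, V (u x) ≤ V A := fun x hx => by
    have h1 : E x ≤ V A := by
      apply ge_of_tendsto hlim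
      filter_upwards [Ioo_mem_nhdsGT hx.1] with y hy
      exact hanti ⟨hy.1, hy.2.trans hx.2⟩ hx hy.2.le
    have h2 := one_sub_sq_pos (σ := x) ⟨by linarith [hx.1], hx.2⟩
    have h3 : 0 ≤ (H x / x ^ (m + 1)) ^ 2 * (1 - x ^ 2) / 2 := by positivity
    simp only [E] at h1
    linarith
  have hcl : IsClosed {x | V (u x) ≤ V A} := isClosed_le (hVc.comp huc) continuous_const
  have : closure (Ioo (0 : ℝ) 1) ⊆ {x | V (u x) ≤ V A} := hcl.closure_subset_iff.2 hin
  rw [closure_Ioo (by norm_num)] at this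
  exact this hρ

lemma exists_profileSol {m : ℕ} {α p β b A : ℝ} (h : Params m α p β b) (hA : b < A) :
    ∃ u, ProfileSol m p β A u := by
  have hp := h.one_lt_p
  have hm : 0 < m := by have := h.two_le_m; omega
  have hA0 : 0 < A := h.b_pos.trans hA
  have hneg : nonlin p β A < 0 := by
    have h1 : β < A ^ (p - 1) := by
      rw [← h.b_pow]; exact Real.rpow_lt_rpow h.b_pos.le hA (by linarith)
    unfold nonlin
    rw [abs_of_pos hA0]
    nlinarith
  obtain ⟨L, hL, hlip⟩ := exists_lipschitz_nonlin (β := β) hp A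
  have hAA : -A ≤ A := by linarith
  let G : ℝ → ℝ := fun x => nonlin p β (projIcc (-A) A hAA x)
  have hGlip : ∀ x y, |G x - G y| ≤ L * |x - y| := fun x y => by
    refine (hlip _ _ (abs_le.2 (projIcc (-A) A hAA x).2)
      (abs_le.2 (projIcc (-A) A hAA y).2)).trans ?_
    apply mul_le_mul_of_nonneg_left _ hL.le
    exact abs_projIcc_sub_projIcc hAA
  have hGc : Continuous G :=
    (continuous_nonlin hp).comp (continuous_subtype_val.comp continuous_projIcc)
  obtain ⟨u, huc, hu⟩ := exists_volterra hm hL hGlip A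
  let V : ℝ → ℝ := fun x => -∫ s in (0 : ℝ)..x, G s
  have hV : ∀ x, HasDerivAt V (-G x) x := fun x =>
    (hGc.integral_hasStrictDerivAt 0 x).hasDerivAt.neg
  have hGint : ∀ a c, IntervalIntegrable G MeasureTheory.volume a c :=
    fun a c => hGc.intervalIntegrable _ _
  have hodd : ∀ x, G (-x) = -G x := fun x => by
    have h1 : ((projIcc (-A) A hAA (-x) : Icc (-A) A) : ℝ)
        = -(projIcc (-A) A hAA x : Icc (-A) A) := by
      simp only [coe_projIcc]
      rcases le_total x (-A) with h1 | h1
      · rw [min_eq_left (by linarith), min_eq_right (a := A) (b := x) (by linarith),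
          max_eq_right (by linarith), max_eq_left h1]; ring
      · rcases le_total x A with h2 | h2
        · rw [min_eq_right (by linarith), min_eq_right h2, max_eq_right (by linarith),
            max_eq_right h1]
        · rw [min_eq_right (by linarith), min_eq_left h2, max_eq_left (by linarith),
            max_eq_right (by linarith)]
    simp only [G, h1, nonlin_neg]
  have hodd_int : ∫ s in (-A)..A, G s = 0 := by
    have h1 := intervalIntegral.integral_comp_neg (f := G) (a := -A) (b := A)
    simp only [hodd, neg_neg, intervalIntegral.integral_neg] at h1
    linarith
  have hbound : ∀ ρ ∈ Icc (0 : ℝ) 1, |u ρ| ≤ A := fun ρ hρ => by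
    have h1 := potential_le_of_volterra hm hGc hV huc hu hρ
    have h2 : 0 ≤ ∫ s in A..(u ρ), G s := by
      have := intervalIntegral.integral_add_adjacent_intervals (hGint 0 A) (hGint A (u ρ))
      simp only [V] at h1
      linarith
    rw [abs_le]
    constructor
    · by_contra! hlt
      have h3 : ∫ s in (u ρ)..(-A), G s = ∫ s in (u ρ)..(-A), -nonlin p β A := by
        apply intervalIntegral.integral_congr
        intro s hs
        rw [uIcc_of_le hlt.le] at hs
        simp only [G, projIcc_of_le_left hAA hs.2, nonlin_neg]
      rw [intervalIntegral.integral_const, smul_eq_mul] at h3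
      have h4 := intervalIntegral.integral_add_adjacent_intervals (hGint (u ρ) (-A)) (hGint (-A) A)
      rw [intervalIntegral.integral_symm] at h2
      nlinarith
    · by_contra! hlt
      have h3 : ∫ s in A..(u ρ), G s = ∫ s in A..(u ρ), nonlin p β A := by
        apply intervalIntegral.integral_congr
        intro s hs
        rw [uIcc_of_le hlt.le] at hs
        simp only [G, projIcc_of_right_le hAA hs.1]
      rw [intervalIntegral.integral_const, smul_eq_mul] at h3
      nlinarith
  refine ⟨u, huc, volterra_zero (h := fun σ => G (u σ)) hu, hbound, fun ρ hρ => ?_⟩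
  rw [hu ρ hρ]
  congr 1
  apply intervalIntegral.integral_congr
  intro σ hσ
  rw [uIcc_of_le zero_le_one] at hσ
  simp only [G, projIcc_of_mem hAA (abs_le.1 (hbound σ hσ))]

lemma ProfileSol.exists_dist_le {m : ℕ} {p β : ℝ} (hm : 0 < m) (hp : 1 < p) (M : ℝ) :
    ∃ C : ℝ, 0 < C ∧ ∀ A A' u v, A ≤ M → A' ≤ M → ProfileSol m p β A u → ProfileSol m p β A' v →
      ∀ ρ ∈ Icc (0 : ℝ) 1, |u ρ - v ρ| ≤ C * |A - A'| := by
  obtain ⟨L, hL, hlip⟩ := exists_lipschitz_nonlin (β := β) hp M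
  refine ⟨2 * Real.exp (2 * L), by positivity, fun A A' u v hA hA' hu hv ρ hρ => ?_⟩
  have hc : Continuous fun σ => Real.exp (-(2 * L * σ)) * |u σ - v σ| := by
    have := hu.cont
    have := hv.cont
    fun_prop
  obtain ⟨x, hx, hmax⟩ := isCompact_Icc.exists_isMaxOn (nonempty_Icc.2 (zero_le_one (α := ℝ)))
    hc.continuousOn
  set D := Real.exp (-(2 * L * x)) * |u x - v x| with hD
  have hD0 : 0 ≤ D := by positivity
  have hle : ∀ σ ∈ Icc (0 : ℝ) 1, |u σ - v σ| ≤ D * Real.exp (2 * L * σ) := fun σ hσ => by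
    have h1 : Real.exp (-(2 * L * σ)) * |u σ - v σ| ≤ D := hmax hσ
    have h2 : Real.exp (2 * L * σ) * Real.exp (-(2 * L * σ)) = 1 := by rw [← Real.exp_add]; simp
    calc |u σ - v σ| = (Real.exp (2 * L * σ) * Real.exp (-(2 * L * σ))) * |u σ - v σ| := by
          rw [h2, one_mul]
      _ = Real.exp (2 * L * σ) * (Real.exp (-(2 * L * σ)) * |u σ - v σ|) := by ring
      _ ≤ Real.exp (2 * L * σ) * D := by gcongr
      _ = _ := by ring
  have h1 := abs_integral_volKer_le hm hx.1 hx.2 (l := 2 * L) (D := L * D) (by positivity)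
    (by positivity) (d := fun σ => nonlin p β (u σ) - nonlin p β (v σ)) (fun σ hσ => by
      have hσ' := Ioc_subset_Icc_self hσ
      refine (hlip _ _ ((hu.bound σ hσ').trans hA) ((hv.bound σ hσ').trans hA')).trans ?_
      rw [mul_assoc]
      exact mul_le_mul_of_nonneg_left (hle σ hσ') hL.le)
  have h2 : |u x - v x| ≤ |A - A'| + L * D * Real.exp (2 * L * x) / (2 * L) := by
    have h3 : u x - v x = (A - A') +
        ∫ σ in (0 : ℝ)..1, volKer m x σ * (nonlin p β (u σ) - nonlin p β (v σ)) := by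
      simp only [mul_sub]
      rw [intervalIntegral.integral_sub, hu.volterra x hx, hv.volterra x hx]
      · ring
      · exact intervalIntegrable_volKer hm ((continuous_nonlin hp).comp hu.cont) hx.2
      · exact intervalIntegrable_volKer hm ((continuous_nonlin hp).comp hv.cont) hx.2
    rw [h3]
    exact (abs_add_le _ _).trans (by linarith)
  have h4 : D ≤ 2 * |A - A'| := by
    have h5 : Real.exp (-(2 * L * x)) * Real.exp (2 * L * x) = 1 := by rw [← Real.exp_add]; simp
    have h6 : Real.exp (-(2 * L * x)) ≤ 1 := by
      rw [Real.exp_le_one_iff]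
      have := hx.1
      have : 0 ≤ 2 * L * x := by positivity
      linarith
    have h7 : D ≤ Real.exp (-(2 * L * x)) * |A - A'| + D / 2 := by
      calc D ≤ Real.exp (-(2 * L * x)) * (|A - A'| + L * D * Real.exp (2 * L * x) / (2 * L)) := by
            rw [hD]; gcongr
        _ = Real.exp (-(2 * L * x)) * |A - A'|
            + (Real.exp (-(2 * L * x)) * Real.exp (2 * L * x)) * (L * D / (2 * L)) := by ring
        _ = _ := by rw [h5]; field_simp
    nlinarith [abs_nonneg (A - A')]
  calc |u ρ - v ρ| ≤ D * Real.exp (2 * L * ρ) := hle ρ hρ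
    _ ≤ (2 * |A - A'|) * Real.exp (2 * L) := by
      exact mul_le_mul h4 (Real.exp_le_exp.2 (by nlinarith [hρ.2])) (Real.exp_pos _).le
        (by positivity)
    _ = _ := by ring

/-- The weighted derivative `ρ ^ (m + 1) * u'` of the singular solution `b * ρ ^ (-α)`. -/
noncomputable def singFlux (α b ρ : ℝ) : ℝ := -(α * b) * ρ ^ (α + 1)

lemma Params.pow_succ_eq {m : ℕ} {α p β b : ℝ} (h : Params m α p β b) {ρ : ℝ} (hρ : 0 < ρ) :
    ρ ^ (m + 1) = ρ ^ (α + 1) * ρ ^ (α + 1) := by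
  rw [← Real.rpow_natCast, ← Real.rpow_add hρ]
  congr 1
  push_cast
  rw [h.m_eq]
  ring

lemma Params.hasDerivAt_sing {m : ℕ} {α p β b : ℝ} (h : Params m α p β b) {ρ : ℝ} (hρ : 0 < ρ) :
    HasDerivAt (fun ρ : ℝ => b * ρ ^ (-α)) (singFlux α b ρ / ρ ^ (m + 1)) ρ := by
  have h1 := (Real.hasDerivAt_rpow_const (x := ρ) (p := -α) (Or.inl hρ.ne')).const_mul b
  convert! h1 using 1
  have h2 : ρ ^ (-α - 1) = (ρ ^ (α + 1))⁻¹ := by rw [← Real.rpow_neg hρ.le]; congr 1; ring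
  have h3 := (Real.rpow_pos_of_pos hρ (α + 1)).ne'
  rw [h2, h.pow_succ_eq hρ, singFlux]
  field_simp

lemma Params.sing_nonlin {m : ℕ} {α p β b : ℝ} (h : Params m α p β b) {ρ : ℝ} (hρ : 0 < ρ) :
    nonlin p β (b * ρ ^ (-α)) = β * (b * ρ ^ (-α)) * (1 - (ρ ^ 2)⁻¹) := by
  have h1 : 0 < b * ρ ^ (-α) := mul_pos h.b_pos (Real.rpow_pos_of_pos hρ _)
  have h2 : (b * ρ ^ (-α)) ^ (p - 1) = β * (ρ ^ 2)⁻¹ := by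
    rw [Real.mul_rpow h.b_pos.le (Real.rpow_pos_of_pos hρ _).le, h.b_pow, ← Real.rpow_mul hρ.le,
      neg_mul, h.α_mul, Real.rpow_neg hρ.le]
    norm_num
  rw [nonlin, abs_of_pos h1, h2]
  ring

lemma Params.hasDerivAt_singFlux {m : ℕ} {α p β b : ℝ} (h : Params m α p β b) {ρ : ℝ}
    (hρ : ρ ∈ Ioo (0 : ℝ) 1) :
    HasDerivAt (singFlux α b) (ρ ^ (m + 1) * (nonlin p β (b * ρ ^ (-α)) / (1 - ρ ^ 2))) ρ := by
  have h0 := hρ.1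
  have h1 := (Real.hasDerivAt_rpow_const (x := ρ) (p := α + 1) (Or.inl h0.ne')).const_mul
    (-(α * b))
  convert! h1 using 1
  have h5 := (one_sub_sq_pos (σ := ρ) ⟨by linarith [hρ.1], hρ.2⟩).ne'
  have h3 := (Real.rpow_pos_of_pos h0 α).ne'
  rw [h.sing_nonlin h0, h.pow_succ_eq h0, Real.rpow_add_one h0.ne', Real.rpow_neg h0.le, h.β_eq,
    add_sub_cancel_right]
  field_simp
  ring

namespace ProfileSol

variable {m : ℕ} {α p β b A : ℝ} {u : ℝ → ℝ}

lemma continuous_nonlin_comp (h : Params m α p β b) (hu : ProfileSol m p β A u) :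
    Continuous fun σ => nonlin p β (u σ) := (continuous_nonlin h.one_lt_p).comp hu.cont

lemma hasDerivAt (h : Params m α p β b) (hu : ProfileSol m p β A u) {ρ : ℝ}
    (hρ : ρ ∈ Ioo (0 : ℝ) 1) :
    HasDerivAt u (flux m (fun σ => nonlin p β (u σ)) ρ / ρ ^ (m + 1)) ρ :=
  hasDerivAt_of_volterra (by have := h.two_le_m; omega) (hu.continuous_nonlin_comp h) hu.volterra hρ

lemma hasDerivAt_flux (h : Params m α p β b) (hu : ProfileSol m p β A u) {ρ : ℝ}
    (hρ : ρ ∈ Ioo (0 : ℝ) 1) :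
    HasDerivAt (flux m (fun σ => nonlin p β (u σ)))
      (ρ ^ (m + 1) * (nonlin p β (u ρ) / (1 - ρ ^ 2))) ρ :=
  _root_.hasDerivAt_flux (hu.continuous_nonlin_comp h) ⟨by linarith [hρ.1], hρ.2⟩

end ProfileSol

/-- Difference of a profile and the singular solution. -/
noncomputable def gap (α b : ℝ) (u : ℝ → ℝ) (ρ : ℝ) : ℝ := u ρ - b * ρ ^ (-α)

/-- The weighted derivative `ρ ^ (m + 1) * D'` of the difference with the singular solution. -/
noncomputable def gapFlux (m : ℕ) (α p β b : ℝ) (u : ℝ → ℝ) (ρ : ℝ) : ℝ :=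
  flux m (fun σ => nonlin p β (u σ)) ρ - singFlux α b ρ

namespace ProfileSol

variable {m : ℕ} {α p β b A : ℝ} {u : ℝ → ℝ}

lemma hasDerivAt_gap (h : Params m α p β b) (hu : ProfileSol m p β A u) {ρ : ℝ}
    (hρ : ρ ∈ Ioo (0 : ℝ) 1) :
    HasDerivAt (gap α b u) (gapFlux m α p β b u ρ / ρ ^ (m + 1)) ρ := by
  rw [gapFlux, sub_div]
  exact (hu.hasDerivAt h hρ).sub (h.hasDerivAt_sing hρ.1)

lemma hasDerivAt_gapFlux (h : Params m α p β b) (hu : ProfileSol m p β A u) {ρ : ℝ}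
    (hρ : ρ ∈ Ioo (0 : ℝ) 1) :
    HasDerivAt (gapFlux m α p β b u) (ρ ^ (m + 1) *
      ((nonlin p β (u ρ) - nonlin p β (b * ρ ^ (-α))) / (1 - ρ ^ 2))) ρ := by
  rw [sub_div, mul_sub]
  exact (hu.hasDerivAt_flux h hρ).sub (h.hasDerivAt_singFlux hρ)

end ProfileSol

lemma Params.exists_forall_lt_sing {m : ℕ} {α p β b : ℝ} (h : Params m α p β b) (M : ℝ) :
    ∃ ε ∈ Ioo (0 : ℝ) 1, ∀ ρ ∈ Ioc (0 : ℝ) ε, M < b * ρ ^ (-α) := by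
  have h1 : Tendsto (fun ρ : ℝ => ρ ^ α * M) (𝓝 0) (𝓝 (0 ^ α * M)) :=
    ((Real.continuousAt_rpow_const _ _ (Or.inr h.α_pos.le)).mul continuousAt_const)
  rw [Real.zero_rpow h.α_pos.ne', zero_mul] at h1
  have h2 := h1.eventually (gt_mem_nhds h.b_pos)
  obtain ⟨δ, hδ, hd⟩ := Metric.eventually_nhds_iff.1 h2
  refine ⟨min (δ / 2) (1 / 2), ⟨by positivity, (min_le_right _ _).trans_lt (by norm_num)⟩,
    fun ρ hρ => ?_⟩
  have h3 := hd (y := ρ) (by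
    rw [Real.dist_eq, sub_zero, abs_of_pos hρ.1]
    linarith [hρ.2.trans (min_le_left _ _)])
  have h4 := Real.rpow_pos_of_pos hρ.1 α
  rw [Real.rpow_neg hρ.1.le, ← div_eq_mul_inv, lt_div_iff₀ h4]
  linarith

lemma Params.sing_le {m : ℕ} {α p β b : ℝ} (h : Params m α p β b) {ε ρ : ℝ} (h0 : 0 < ε)
    (hρ : ε ≤ ρ) : |b * ρ ^ (-α)| ≤ b * ε ^ (-α) := by
  have hb := h.b_pos
  rw [abs_of_pos (mul_pos hb (Real.rpow_pos_of_pos (h0.trans_le hρ) _))]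
  exact mul_le_mul_of_nonneg_left
    (Real.rpow_le_rpow_of_nonpos h0 hρ (by linarith [h.α_pos])) hb.le

/-- Uniform control of the difference with the singular solution for all profiles with `u 0 ≤ M`. -/
lemma ProfileSol.exists_uniform {m : ℕ} {α p β b : ℝ} (h : Params m α p β b) (M : ℝ) :
    ∃ ε ∈ Ioo (0 : ℝ) 1, ∃ L : ℝ, 0 < L ∧ ∀ A u, A ≤ M → ProfileSol m p β A u →
      (∀ ρ ∈ Ioc (0 : ℝ) ε, gap α b u ρ < 0) ∧ (∀ ρ ∈ Icc ε 1,
        |nonlin p β (u ρ) - nonlin p β (b * ρ ^ (-α))| ≤ L * |gap α b u ρ|) := by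
  obtain ⟨ε, hε, he⟩ := h.exists_forall_lt_sing M
  obtain ⟨L, hL, hlip⟩ := exists_lipschitz_nonlin (β := β) h.one_lt_p (max M (b * ε ^ (-α)))
  refine ⟨ε, hε, L, hL, fun A u hA hu => ⟨fun ρ hρ => ?_, fun ρ hρ => ?_⟩⟩
  · have h1 := hu.bound ρ ⟨hρ.1.le, hρ.2.trans hε.2.le⟩
    have := he ρ hρ
    unfold gap
    linarith [le_abs_self (u ρ)]
  · exact hlip _ _ (((hu.bound ρ ⟨hε.1.le.trans hρ.1, hρ.2⟩).trans hA).trans (le_max_left _ _))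
      ((h.sing_le hε.1 hρ.1).trans (le_max_right _ _))

lemma ProfileSol.gapFlux_ne_zero {m : ℕ} {α p β b A : ℝ} {u : ℝ → ℝ} (h : Params m α p β b)
    (hu : ProfileSol m p β A u) {x : ℝ} (hx : x ∈ Ioo (0 : ℝ) 1) (h0 : gap α b u x = 0) :
    gapFlux m α p β b u x ≠ 0 := by
  intro h0'
  obtain ⟨ε, hε, L, hL, hunif⟩ := exists_uniform h A
  obtain ⟨hneg, hlip⟩ := hunif A u le_rfl hu
  have hεx : ε < x := by
    by_contra! hle
    exact (hneg x ⟨hx.1, hle⟩).ne h0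
  set K := 1 / ε ^ (m + 1) + L / (1 - x ^ 2) with hK
  let W : ℝ → ℝ := fun y =>
    Real.exp (K * y) * ((gap α b u y) ^ 2 + (gapFlux m α p β b u y) ^ 2)
  have hsub : Icc ε x ⊆ Ioo (0 : ℝ) 1 := fun y hy => ⟨hε.1.trans_le hy.1, hy.2.trans_lt hx.2⟩
  have hW : ∀ y ∈ Icc ε x, HasDerivAt W _ y := fun y hy =>
    (((hasDerivAt_id' y).const_mul K).exp).fun_mul
      (((hu.hasDerivAt_gap h (hsub hy)).fun_pow 2).fun_add
        ((hu.hasDerivAt_gapFlux h (hsub hy)).fun_pow 2))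
  have hmono : MonotoneOn W (Icc ε x) := by
    apply monotoneOn_of_deriv_nonneg (convex_Icc _ _)
      (fun y hy => (hW y hy).continuousAt.continuousWithinAt)
      (fun y hy => (hW y (interior_subset hy)).differentiableAt.differentiableWithinAt)
    intro y hy
    have hy := interior_subset hy
    rw [(hW y hy).deriv]
    have hy' := hsub hy
    have hF := hlip y ⟨hy.1, hy'.2.le⟩
    set F := nonlin p β (u y) - nonlin p β (b * y ^ (-α))
    set D := gap α b u y
    set H := gapFlux m α p β b u y
    have h1 : 0 < 1 - y ^ 2 := one_sub_sq_pos ⟨by linarith [hy'.1], hy'.2⟩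
    have h2 : 0 < 1 - x ^ 2 := one_sub_sq_pos ⟨by linarith [hx.1], hx.2⟩
    have hyx : y ^ 2 ≤ x ^ 2 := pow_le_pow_left₀ hy'.1.le hy.2 2
    have h3 : |D * (H / y ^ (m + 1))| ≤ 1 / ε ^ (m + 1) * (|D| * |H|) := by
      have hpos := hy'.1
      have hε0 := hε.1
      rw [abs_mul, abs_div, abs_of_pos (a := y ^ (m + 1)) (by positivity)]
      rw [mul_div_assoc', one_div, inv_mul_eq_div]
      gcongr
      exact hy.1
    have h4 : |H * (y ^ (m + 1) * (F / (1 - y ^ 2)))| ≤ L / (1 - x ^ 2) * (|D| * |H|) := by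
      have hpos := hy'.1
      rw [abs_mul, abs_mul, abs_div, abs_of_pos h1, abs_of_pos (a := y ^ (m + 1)) (by positivity)]
      have h5 : y ^ (m + 1) ≤ 1 := pow_le_one₀ hpos.le hy'.2.le
      calc |H| * (y ^ (m + 1) * (|F| / (1 - y ^ 2))) ≤ |H| * (1 * (L * |D| / (1 - x ^ 2))) := by
            gcongr
        _ = _ := by ring
    have h6 : 2 * (|D| * |H|) ≤ D ^ 2 + H ^ 2 := by
      nlinarith [sq_nonneg (|D| - |H|), sq_abs D, sq_abs H]
    have hKp : 0 < K := by have := hε.1; positivity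
    have h7 := abs_le.1 h3
    have h8 := abs_le.1 h4
    have h9 : 0 ≤ K * (D ^ 2 + H ^ 2) + (2 * (D * (H / y ^ (m + 1)))
        + 2 * (H * (y ^ (m + 1) * (F / (1 - y ^ 2))))) := by
      have : K * (2 * (|D| * |H|)) ≤ K * (D ^ 2 + H ^ 2) := by gcongr
      rw [hK] at this ⊢
      nlinarith
    have h10 := mul_nonneg (Real.exp_pos (K * y)).le h9
    convert! h10 using 1
    norm_num
    ring
  have h1 := hmono (left_mem_Icc.2 hεx.le) (right_mem_Icc.2 hεx.le) hεx.le
  simp only [W, h0, h0'] at h1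
  have h2 := hneg ε ⟨hε.1, le_rfl⟩
  have h3 : 0 < Real.exp (K * ε) * (gap α b u ε ^ 2 + gapFlux m α p β b u ε ^ 2) := by
    have := sq_pos_of_neg h2
    positivity
  simp at h1
  linarith

lemma Params.continuousOn_sing {m : ℕ} {α p β b : ℝ} (h : Params m α p β b) :
    ContinuousOn (fun ρ : ℝ => b * ρ ^ (-α)) (Ioi 0) :=
  fun _ hρ => (h.hasDerivAt_sing hρ).continuousAt.continuousWithinAt

lemma ProfileSol.exists_zero_spacing {m : ℕ} {α p β b : ℝ} (h : Params m α p β b) (M : ℝ) :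
    ∃ δ > 0, ∀ A u, A ≤ M → ProfileSol m p β A u → ∀ s ∈ Ioo (0 : ℝ) 1, ∀ t ∈ Ioo (0 : ℝ) 1,
      s < t → gap α b u s = 0 → gap α b u t = 0 → δ ≤ t - s := by
  have hm : 0 < m := by have := h.two_le_m; omega
  obtain ⟨ε, hε, L, hL, hunif⟩ := exists_uniform h M
  refine ⟨1 / L, by positivity, fun A u hA hu s hs t ht hst hs0 ht0 => ?_⟩
  obtain ⟨hneg, hlip⟩ := hunif A u hA hu
  have hεs : ε ≤ s := by
    by_contra! hle
    exact (hneg s ⟨hs.1, hle.le⟩).ne hs0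
  have hsub : Icc s t ⊆ Ioo (0 : ℝ) 1 := fun y hy => ⟨hs.1.trans_le hy.1, hy.2.trans_lt ht.2⟩
  have hDc : ContinuousOn (gap α b u) (Icc s t) := fun y hy =>
    (hu.hasDerivAt_gap h (hsub hy)).continuousAt.continuousWithinAt
  have hHc : ContinuousOn (gapFlux m α p β b u) (Icc s t) := fun y hy =>
    (hu.hasDerivAt_gapFlux h (hsub hy)).continuousAt.continuousWithinAt
  obtain ⟨x, hx, hmax⟩ := isCompact_Icc.exists_isMaxOn (nonempty_Icc.2 hst.le) hDc.abs
  have hDx : gap α b u x ≠ 0 := by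
    intro hDx
    have hz : ∀ y ∈ Icc s t, gap α b u y = 0 := fun y hy => by
      have : |gap α b u y| ≤ |gap α b u x| := hmax hy
      rw [hDx, abs_zero] at this
      exact abs_nonpos_iff.1 this
    have hmid : (s + t) / 2 ∈ Ioo s t := ⟨by linarith, by linarith⟩
    have h1 := hu.hasDerivAt_gap h (hsub (Ioo_subset_Icc_self hmid))
    have h2 : gap α b u =ᶠ[𝓝 ((s + t) / 2)] fun _ => 0 := by
      filter_upwards [Ioo_mem_nhds hmid.1 hmid.2] with y hy using hz y (Ioo_subset_Icc_self hy)
    have h3 := h1.unique ((hasDerivAt_const _ (0 : ℝ)).congr_of_eventuallyEq h2)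
    have hpos := (hsub (Ioo_subset_Icc_self hmid)).1
    rcases div_eq_zero_iff.1 h3 with h4 | h4
    · exact hu.gapFlux_ne_zero h (hsub (Ioo_subset_Icc_self hmid))
        (hz _ (Ioo_subset_Icc_self hmid)) h4
    · exact pow_ne_zero _ hpos.ne' h4
  have hxI : x ∈ Ioo s t :=
    ⟨hx.1.lt_of_ne fun e => hDx (e ▸ hs0), hx.2.lt_of_ne fun e => hDx (e ▸ ht0)⟩
  have hHx : gapFlux m α p β b u x = 0 := by
    have h1 : IsLocalMax (fun y => gap α b u y ^ 2) x := by
      filter_upwards [Ioo_mem_nhds hxI.1 hxI.2] with y hy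
      exact sq_le_sq.2 (hmax (Ioo_subset_Icc_self hy))
    have h2 := h1.hasDerivAt_eq_zero ((hu.hasDerivAt_gap h (hsub hx)).fun_pow 2)
    have hpos := pow_pos (hsub hx).1 (m + 1)
    simpa [hDx, hpos.ne'] using h2
  have hxt : Icc x t ⊆ Icc s t := Icc_subset_Icc_left hx.1
  have hvar := variation_of_constants hm (D := gap α b u) (H := gapFlux m α p β b u)
    (F := fun y => (nonlin p β (u y) - nonlin p β (b * y ^ (-α))) / (1 - y ^ 2))
    (a := x) (x := t) (hsub hx).1 ht.1 (by rw [uIcc_of_le hx.2]; exact hDc.mono hxt)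
    (by rw [uIcc_of_le hx.2]; exact hHc.mono hxt)
    (fun y hy => hu.hasDerivAt_gap h (hsub (hxt (by
      rw [min_eq_left hx.2, max_eq_right hx.2] at hy; exact Ioo_subset_Icc_self hy))))
    (fun y hy => hu.hasDerivAt_gapFlux h (hsub (hxt (by
      rw [min_eq_left hx.2, max_eq_right hx.2] at hy; exact Ioo_subset_Icc_self hy))))
    (by
      apply ContinuousOn.intervalIntegrable
      rw [uIcc_of_le hx.2]
      apply ContinuousOn.mul (by fun_prop)
      refine ContinuousOn.div (ContinuousOn.sub (hu.continuous_nonlin_comp h).continuousOn ?_)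
        (by fun_prop) (fun y hy => ?_)
      · exact (continuous_nonlin h.one_lt_p).comp_continuousOn
          (h.continuousOn_sing.mono fun y hy => (hsub (hxt hy)).1)
      · have := hsub (hxt hy)
        exact (one_sub_sq_pos ⟨by linarith [this.1], this.2⟩).ne')
  rw [ht0, hHx, zero_mul, zero_div, add_zero] at hvar
  have hnorm := intervalIntegral.norm_integral_le_of_norm_le_const (a := x) (b := t)
    (C := L * |gap α b u x|)
    (f := fun σ => σ * (1 - (σ / t) ^ m) / m *
      ((nonlin p β (u σ) - nonlin p β (b * σ ^ (-α))) / (1 - σ ^ 2))) (fun σ hσ => by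
      rw [uIoc_of_le hx.2] at hσ
      have hσ' := Ioc_subset_Icc_self hσ
      have hσ1 := hsub (hxt hσ')
      have h1 := abs_volKer_le_one hm hσ1.1 hσ1.2.le ht.2.le
      rw [volKer_of_ge hσ.2] at h1
      have h2 := hlip σ ⟨hεs.trans (hxt hσ').1, hσ1.2.le⟩
      have h3 : |gap α b u σ| ≤ |gap α b u x| := hmax (hxt hσ')
      set F := nonlin p β (u σ) - nonlin p β (b * σ ^ (-α))
      have h4 : σ * (1 - (σ / t) ^ m) / m * (F / (1 - σ ^ 2))
          = σ * (1 - (σ / t) ^ m) / (m * (1 - σ ^ 2)) * F := by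
        rw [div_mul_div_comm, mul_div_right_comm]
      rw [h4, Real.norm_eq_abs, abs_mul]
      calc _ ≤ 1 * (L * |gap α b u x|) :=
            mul_le_mul h1 (h2.trans (by gcongr)) (abs_nonneg _) zero_le_one
        _ = _ := one_mul _)
  have h5 : |gap α b u x| ≤ L * |gap α b u x| * (t - x) := by
    rw [Real.norm_eq_abs, abs_of_nonneg (by linarith [hx.2] : (0 : ℝ) ≤ t - x)] at hnorm
    refine le_trans (le_of_eq ?_) hnorm
    rw [← abs_neg]
    congr 1
    linarith
  have h6 : 0 < |gap α b u x| := abs_pos.2 hDx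
  have h7 : 1 ≤ L * (t - x) := by
    by_contra! hlt
    nlinarith
  rw [div_le_iff₀ hL]
  nlinarith [hx.1]

/-- A transversal zero forces a sign change in every neighbourhood. -/
lemma exists_sign_change {D : ℝ → ℝ} {d x r : ℝ} (hD : HasDerivAt D d x) (hx : D x = 0)
    (hd : d ≠ 0) (hr : 0 < r) :
    ∃ y ∈ Ioo (x - r) x, ∃ z ∈ Ioo x (x + r), D y * D z < 0 := by
  have h1 := hasDerivAt_iff_tendsto_slope.1 (hD.mul_const d)
  have h2 := h1.eventually (lt_mem_nhds (mul_self_pos.2 hd))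
  have h3 : ∀ y, slope (fun y => D y * d) x y = (D y * d) / (y - x) := fun y => by
    rw [slope_def_field]; simp [hx]
  have h4 : ∀ᶠ y in 𝓝[<] x, 0 < (D y * d) / (y - x) := by
    filter_upwards [h2.filter_mono (nhdsWithin_mono x fun y (hy : y < x) => hy.ne)] with y hy
    rwa [← h3]
  have h5 : ∀ᶠ y in 𝓝[>] x, 0 < (D y * d) / (y - x) := by
    filter_upwards [h2.filter_mono (nhdsWithin_mono x fun y (hy : x < y) => hy.ne')] with y hy
    rwa [← h3]
  obtain ⟨y, hy, hy'⟩ := (h4.and (Ioo_mem_nhdsLT (show x - r < x by linarith))).exists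
  obtain ⟨z, hz, hz'⟩ := (h5.and (Ioo_mem_nhdsGT (show x < x + r by linarith))).exists
  refine ⟨y, hy', z, hz', ?_⟩
  have h6 : D y * d < 0 := by
    by_contra! h
    exact absurd hy (not_lt.2 (div_nonpos_of_nonneg_of_nonpos h (by linarith [hy'.2])))
  have h7 : 0 < D z * d := by
    by_contra! h
    exact absurd hz (not_lt.2 (div_nonpos_of_nonpos_of_nonneg h (by linarith [hz'.1])))
  have h8 : (D y * D z) * (d * d) < 0 := by
    have := mul_neg_of_neg_of_pos h6 h7
    linarith
  by_contra! h
  exact absurd h8 (not_lt.2 (mul_nonneg h (mul_self_nonneg d)))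

/-- The difference of `u` with the singular solution has at least `n` zeros in `(0,1)`. -/
def HasZeros (α b : ℝ) (u : ℝ → ℝ) (n : ℕ) : Prop :=
  ∃ s : Fin n → ℝ, Function.Injective s ∧ ∀ i, s i ∈ Ioo (0 : ℝ) 1 ∧ gap α b u (s i) = 0

lemma HasZeros.mono {α b : ℝ} {u : ℝ → ℝ} {k n : ℕ} (hu : HasZeros α b u n) (hkn : k ≤ n) :
    HasZeros α b u k := by
  obtain ⟨s, hs, hs'⟩ := hu
  exact ⟨fun i => s (Fin.castLE hkn i), hs.comp (Fin.castLE_injective hkn), fun i => hs' _⟩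

lemma ProfileSol.exists_not_hasZeros {m : ℕ} {α p β b A : ℝ} {u : ℝ → ℝ} (h : Params m α p β b)
    (hu : ProfileSol m p β A u) : ∃ n, ∀ k ≥ n, ¬ HasZeros α b u k := by
  obtain ⟨δ, hδ, hgap⟩ := exists_zero_spacing h A
  refine ⟨⌊1 / δ⌋₊ + 2, fun k hk hz => ?_⟩
  obtain ⟨s, hs, hs'⟩ := hz.mono hk
  have hf : ∀ i ∈ (Finset.univ : Finset (Fin (⌊1 / δ⌋₊ + 2))),
      ⌊s i / δ⌋₊ ∈ Finset.range (⌊1 / δ⌋₊ + 1) := fun i _ => by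
    rw [Finset.mem_range, Nat.lt_succ_iff]
    apply Nat.floor_mono
    gcongr
    exact (hs' i).1.2.le
  obtain ⟨i, -, j, -, hij, he⟩ := Finset.exists_ne_map_eq_of_card_lt_of_maps_to (by simp) hf
  have key : ∀ i j, s i < s j → ⌊s i / δ⌋₊ = ⌊s j / δ⌋₊ → False := fun i j hlt he => by
    have h1 := hgap A u le_rfl hu _ (hs' i).1 _ (hs' j).1 hlt (hs' i).2 (hs' j).2
    have h2 := Nat.floor_le (a := s i / δ) (div_nonneg (hs' i).1.1.le hδ.le)
    have h3 := Nat.lt_floor_add_one (s j / δ)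
    rw [← he] at h3
    rw [le_div_iff₀ hδ] at h2
    rw [div_lt_iff₀ hδ] at h3
    linarith
  rcases lt_or_gt_of_ne (hs.ne hij) with hlt | hlt
  · exact key i j hlt he
  · exact key j i hlt he.symm

lemma ProfileSol.eventually_hasZeros {m : ℕ} {α p β b A : ℝ} (h : Params m α p β b)
    {U : ℝ → ℝ → ℝ} (hU : ∀ A, b < A → ProfileSol m p β A (U A)) (hA : b < A) {n : ℕ}
    (hz : HasZeros α b (U A) n) : ∀ᶠ A' in 𝓝 A, HasZeros α b (U A') n := by
  have hm : 0 < m := by have := h.two_le_m; omega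
  obtain ⟨s, hs, hs'⟩ := hz
  obtain ⟨C, hC, hdist⟩ := exists_dist_le (β := β) hm h.one_lt_p (A + 1)
  obtain ⟨δ, hδ, hgap⟩ := exists_zero_spacing h A
  have hU0 := hU A hA
  have hr : ∀ i, ∃ r > 0, r ≤ δ / 2 ∧ 0 < s i - r ∧ s i + r < 1 := fun i => by
    have := (hs' i).1
    refine ⟨min (δ / 2) (min (s i / 2) ((1 - s i) / 2)), ?_, min_le_left _ _, ?_, ?_⟩
    · have h1 := this.1
      have h2 : 0 < 1 - s i := by linarith [this.2]
      positivity
    · have h1 := (min_le_right (δ / 2) _).trans (min_le_left (s i / 2) ((1 - s i) / 2))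
      linarith [this.1]
    · have h1 := (min_le_right (δ / 2) _).trans (min_le_right (s i / 2) ((1 - s i) / 2))
      linarith [this.2]
  choose r hr0 hrδ hr1 hr2 using hr
  have hsc : ∀ i, ∃ y ∈ Ioo (s i - r i) (s i), ∃ z ∈ Ioo (s i) (s i + r i),
      gap α b (U A) y * gap α b (U A) z < 0 := fun i =>
    exists_sign_change (hU0.hasDerivAt_gap h (hs' i).1) (hs' i).2
      (div_ne_zero (hU0.gapFlux_ne_zero h (hs' i).1 (hs' i).2)
        (pow_ne_zero _ (hs' i).1.1.ne')) (hr0 i)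
  choose y hy z hz hyz using hsc
  have hlim : ∀ x ∈ Ioo (0 : ℝ) 1,
      Tendsto (fun A' => gap α b (U A') x) (𝓝 A) (𝓝 (gap α b (U A) x)) := fun x hx => by
    apply Tendsto.sub_const
    rw [tendsto_iff_dist_tendsto_zero]
    apply squeeze_zero' (g := fun A' => C * |A' - A|) (Eventually.of_forall fun _ => dist_nonneg)
    · filter_upwards [Ioo_mem_nhds hA (lt_add_one A)] with A' hA'
      rw [Real.dist_eq]
      exact hdist A' A _ _ hA'.2.le (by linarith) (hU A' hA'.1) hU0 x (Ioo_subset_Icc_self hx)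
    · have : Continuous fun A' => C * |A' - A| := by fun_prop
      simpa using this.tendsto A
  have hyI : ∀ i, y i ∈ Ioo (0 : ℝ) 1 := fun i =>
    ⟨(hr1 i).trans (hy i).1, (hy i).2.trans (hs' i).1.2⟩
  have hzI : ∀ i, z i ∈ Ioo (0 : ℝ) 1 := fun i =>
    ⟨(hs' i).1.1.trans (hz i).1, (hz i).2.trans (hr2 i)⟩
  have hev : ∀ᶠ A' in 𝓝 A, ∀ i, gap α b (U A') (y i) * gap α b (U A') (z i) < 0 :=
    eventually_all.2 fun i =>
      ((hlim _ (hyI i)).mul (hlim _ (hzI i))).eventually (gt_mem_nhds (hyz i))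
  filter_upwards [hev, lt_mem_nhds hA] with A' hA' hbA'
  have hroot : ∀ i, ∃ t ∈ Ioo (y i) (z i), gap α b (U A') t = 0 := fun i => by
    have hlt : y i < z i := (hy i).2.trans (hz i).1
    have hc : ContinuousOn (gap α b (U A')) (Icc (y i) (z i)) := fun x hx =>
      ((hU A' hbA').hasDerivAt_gap h ⟨(hyI i).1.trans_le hx.1,
        hx.2.trans_lt (hzI i).2⟩).continuousAt.continuousWithinAt
    rcases mul_neg_iff.1 (hA' i) with ⟨h1, h2⟩ | ⟨h1, h2⟩
    · exact intermediate_value_Ioo' hlt.le hc ⟨h2, h1⟩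
    · exact intermediate_value_Ioo hlt.le hc ⟨h1, h2⟩
  choose t ht ht0 using hroot
  refine ⟨t, ?_, fun i => ⟨⟨(hyI i).1.trans (ht i).1, (ht i).2.trans (hzI i).2⟩, ht0 i⟩⟩
  have hlt : ∀ i j, s i < s j → t i ≠ t j := fun i j hij => by
    have h1 := hgap A _ le_rfl hU0 _ (hs' i).1 _ (hs' j).1 hij (hs' i).2 (hs' j).2
    have := (ht i).2.trans (hz i).2
    have := (hy j).1.trans (ht j).1
    linarith [hrδ i, hrδ j]
  intro i j hij
  by_contra hne
  rcases lt_or_gt_of_ne (hs.ne hne) with h1 | h1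
  · exact hlt i j h1 hij
  · exact hlt j i h1 hij.symm

/-- Shooting: as soon as arbitrarily large data produce arbitrarily many zeros, some datum makes a
zero cross `ρ = 1`. -/
lemma exists_profileSol_one_eq {m : ℕ} {α p β b : ℝ} (h : Params m α p β b)
    (hbig : ∀ (n : ℕ) (A₀ : ℝ), ∃ A > A₀, ∀ u, ProfileSol m p β A u → HasZeros α b u n)
    (n₀ : ℕ) {C : ℝ} (hC : b ≤ C) :
    ∃ A > C, ∃ u, ProfileSol m p β A u ∧ u 1 = b ∧ HasZeros α b u n₀ := by
  have hm : 0 < m := by have := h.two_le_m; omega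
  have hex : ∀ A, ∃ u, b < A → ProfileSol m p β A u := fun A => by
    by_cases hA : b < A
    · obtain ⟨u, hu⟩ := exists_profileSol h hA
      exact ⟨u, fun _ => hu⟩
    · exact ⟨0, fun hA' => absurd hA' hA⟩
  choose U hU using hex
  obtain ⟨n₁, hn₁⟩ := (hU (C + 1) (by linarith)).exists_not_hasZeros h
  set k := max n₀ n₁
  have hk : ¬ HasZeros α b (U (C + 1)) (k + 1) := hn₁ _ ((le_max_right _ _).trans (Nat.le_succ _))
  obtain ⟨A₁, hA₁, hz⟩ := hbig (k + 1) (C + 1)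
  have hz₁ := hz _ (hU A₁ (by linarith))
  set T := {A | A ∈ Icc (C + 1) A₁ ∧ ¬ HasZeros α b (U A) (k + 1)}
  have hTne : T.Nonempty := ⟨C + 1, ⟨le_rfl, hA₁.le⟩, hk⟩
  have hTbdd : BddAbove T := ⟨A₁, fun A hA => hA.1.2⟩
  set B := sSup T
  have hlub : IsLUB T B := isLUB_csSup hTne hTbdd
  have hCB : C + 1 ≤ B := hlub.1 ⟨⟨le_rfl, hA₁.le⟩, hk⟩
  have hBA : B ≤ A₁ := hlub.2 fun A hA => hA.1.2
  have hB : ¬ HasZeros α b (U B) (k + 1) := fun hzB => by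
    have hev := ProfileSol.eventually_hasZeros h hU (by linarith : b < B) hzB
    have hfr := hlub.frequently_mem hTne
    obtain ⟨A, hA, hA'⟩ := (hfr.and_eventually (hev.filter_mono nhdsWithin_le_nhds)).exists
    exact hA.2 hA'
  have hBlt : B < A₁ := hBA.lt_of_ne fun e => hB (e ▸ hz₁)
  have hUB := hU B (by linarith)
  obtain ⟨c, hc, hdist⟩ := ProfileSol.exists_dist_le (β := β) hm h.one_lt_p A₁
  obtain ⟨δ, hδ, hgap⟩ := ProfileSol.exists_zero_spacing h A₁
  obtain ⟨ε, hε, L, hL, hunif⟩ := ProfileSol.exists_uniform h A₁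
  let a : ℕ → ℝ := fun j => B + (A₁ - B) * (1 / ((j : ℝ) + 1))
  have ha : Tendsto a atTop (𝓝 B) := by
    simpa [a] using (tendsto_one_div_add_atTop_nhds_zero_nat.const_mul (A₁ - B)).const_add B
  have haI : ∀ j, a j ∈ Ioc B A₁ := fun j => by
    have h1 : (0 : ℝ) < 1 / ((j : ℝ) + 1) := by positivity
    have h2 : 1 / ((j : ℝ) + 1) ≤ 1 := by
      rw [div_le_one (by positivity)]
      linarith [(Nat.cast_nonneg j : (0 : ℝ) ≤ j)]
    have h3 : 0 < A₁ - B := by linarith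
    constructor
    · simp only [a]
      nlinarith [mul_pos h3 h1]
    · simp only [a]
      nlinarith [mul_le_mul_of_nonneg_left h2 h3.le]
  have haz : ∀ j, HasZeros α b (U (a j)) (k + 1) := fun j => by
    by_contra hn
    exact absurd (hlub.1 ⟨⟨by linarith [(haI j).1], (haI j).2⟩, hn⟩) (not_le.2 (haI j).1)
  have haU : ∀ j, ProfileSol m p β (a j) (U (a j)) := fun j => hU _ (by linarith [(haI j).1])
  choose s hs hs' using haz
  have hcpt : IsCompact (univ.pi fun _ : Fin (k + 1) => Icc ε 1) := isCompact_univ_pi fun _ =>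
    isCompact_Icc
  obtain ⟨t, ht, φ, hφ, hlim⟩ := hcpt.tendsto_subseq (x := s) (fun j => by
    intro i _
    refine ⟨?_, (hs' j i).1.2.le⟩
    by_contra! hle
    exact ((hunif _ _ (haI j).2 (haU j)).1 _ ⟨(hs' j i).1.1, hle.le⟩).ne (hs' j i).2)
  rw [tendsto_pi_nhds] at hlim
  have htI : ∀ i, t i ∈ Icc ε 1 := fun i => ht i (mem_univ i)
  have htne : Function.Injective t := by
    have hsp : ∀ j i i', i ≠ i' → δ ≤ |s j i - s j i'| := fun j i i' hne => by
      rcases lt_or_gt_of_ne ((hs j).ne hne) with hlt | hlt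
      · rw [abs_sub_comm]
        exact (hgap _ _ (haI j).2 (haU j) _ (hs' j i).1 _ (hs' j i').1 hlt (hs' j i).2
          (hs' j i').2).trans (le_abs_self _)
      · exact (hgap _ _ (haI j).2 (haU j) _ (hs' j i').1 _ (hs' j i).1 hlt (hs' j i').2
          (hs' j i).2).trans (le_abs_self _)
    intro i i' hii
    by_contra hne
    have h1 := ge_of_tendsto ((hlim i).sub (hlim i')).abs
      (Eventually.of_forall fun j => hsp (φ j) i i' hne)
    rw [hii, sub_self, abs_zero] at h1
    linarith
  have htz : ∀ i, gap α b (U B) (t i) = 0 := fun i => by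
    have h1 : Tendsto (fun j => gap α b (U B) (s (φ j) i)) atTop (𝓝 (gap α b (U B) (t i))) := by
      have hcont : ContinuousAt (gap α b (U B)) (t i) := hUB.cont.continuousAt.sub
        (h.hasDerivAt_sing (hε.1.trans_le (htI i).1)).continuousAt
      exact hcont.tendsto.comp (hlim i)
    have h2 : Tendsto (fun j => gap α b (U B) (s (φ j) i)) atTop (𝓝 0) := by
      apply squeeze_zero_norm (a := fun j => c * |B - a (φ j)|)
      · intro j
        have h3 := hdist B (a (φ j)) _ _ hBA (haI _).2 hUB (haU _) _
          (Ioo_subset_Icc_self (hs' (φ j) i).1)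
        have h4 := (hs' (φ j) i).2
        rw [Real.norm_eq_abs]
        convert! h3 using 2
        unfold gap at h4 ⊢
        linarith
      · have := (((ha.comp hφ.tendsto_atTop).const_sub B).abs).const_mul c
        simpa using this
    exact tendsto_nhds_unique h1 h2
  have hone : ∃ i, t i = 1 := by
    by_contra! hne
    exact hB ⟨t, htne, fun i =>
      ⟨⟨hε.1.trans_le (htI i).1, (htI i).2.lt_of_ne (hne i)⟩, htz i⟩⟩
  obtain ⟨i, hi⟩ := hone
  refine ⟨B, by linarith, U B, hUB, ?_, ?_⟩
  · have := htz i
    rw [hi, gap, Real.one_rpow] at this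
    linarith
  · apply HasZeros.mono (n := k) _ (le_max_left _ _)
    refine ⟨fun j => t (i.succAbove j), htne.comp Fin.succAbove_right_injective, fun j =>
      ⟨⟨hε.1.trans_le (htI _).1, (htI _).2.lt_of_ne fun e => ?_⟩, htz _⟩⟩
    exact Fin.succAbove_ne i j (htne (e.trans hi.symm))

/-- Sturm comparison with the harmonic oscillator for an equation with damping. -/
lemma sturm_comparison {z z' z'' : ℝ → ℝ} {a : ℝ}
    (hz : ∀ t ∈ Icc a (a + Real.pi), HasDerivAt z (z' t) t)
    (hz' : ∀ t ∈ Icc a (a + Real.pi), HasDerivAt z' (z'' t) t)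
    (hpos : ∀ t ∈ Icc a (a + Real.pi), 0 < z t)
    (hle : ∀ t ∈ Icc a (a + Real.pi), z'' t + z' t ≤ -(5 / 4 * z t)) : False := by
  let W : ℝ → ℝ := fun t => Real.exp (t / 2) *
    ((z' t + z t / 2) * Real.sin (t - a) - z t * Real.cos (t - a))
  have hW : ∀ t ∈ Icc a (a + Real.pi), HasDerivAt W
      (Real.exp (t / 2) * ((z'' t + z' t + 5 / 4 * z t) * Real.sin (t - a))) t := fun t ht => by
    have h1 := ((hasDerivAt_id' t).div_const 2).exp
    have h2 := ((hasDerivAt_id' t).sub_const a).sin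
    have h3 := ((hasDerivAt_id' t).sub_const a).cos
    have h4 := h1.fun_mul ((((hz' t ht).fun_add ((hz t ht).div_const 2)).fun_mul h2).fun_sub
      ((hz t ht).fun_mul h3))
    convert! h4 using 1
    ring
  have hpi := Real.pi_pos
  have hanti : AntitoneOn W (Icc a (a + Real.pi)) := by
    apply antitoneOn_of_deriv_nonpos (convex_Icc _ _)
      (fun t ht => (hW t ht).continuousAt.continuousWithinAt)
      (fun t ht => (hW t (interior_subset ht)).differentiableAt.differentiableWithinAt)
    intro t ht
    have ht := interior_subset ht
    rw [(hW t ht).deriv]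
    have h1 : 0 ≤ Real.sin (t - a) :=
      Real.sin_nonneg_of_nonneg_of_le_pi (by linarith [ht.1]) (by linarith [ht.2])
    have h2 : z'' t + z' t + 5 / 4 * z t ≤ 0 := by linarith [hle t ht]
    exact mul_nonpos_of_nonneg_of_nonpos (Real.exp_pos _).le
      (mul_nonpos_of_nonpos_of_nonneg h2 h1)
  have ha : a ∈ Icc a (a + Real.pi) := ⟨le_rfl, by linarith⟩
  have hb : a + Real.pi ∈ Icc a (a + Real.pi) := ⟨by linarith, le_rfl⟩
  have h1 := hanti ha hb (by linarith)
  simp only [W, sub_self, add_sub_cancel_left, Real.sin_pi, Real.cos_pi, Real.sin_zero,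
    Real.cos_zero] at h1
  have h2 := mul_pos (Real.exp_pos (a / 2)) (hpos a ha)
  have h3 := mul_pos (Real.exp_pos ((a + Real.pi) / 2)) (hpos _ hb)
  linarith

lemma Params.β_mul {m : ℕ} {α p β b : ℝ} (h : Params m α p β b) : β * (p - 1) = m + 1 := by
  rw [h.β_eq, h.m_eq]
  linear_combination (α + 1) * h.α_mul

lemma nonlin_one_of_pos {p w : ℝ} (hw : 0 < w) : nonlin p 1 w = w - w ^ p := by
  rw [nonlin, abs_of_pos hw, one_mul, ← Real.rpow_add_one hw.ne', sub_add_cancel]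

lemma Params.exists_threshold {m : ℕ} {α p β b : ℝ} (h : Params m α p β b) :
    ∃ θ ∈ Ioo (0 : ℝ) 1, ∀ w ∈ Ico θ 1, 5 / 4 * (1 - w) ≤ β * nonlin p 1 w := by
  have hd := (hasDerivAt_nonlin (β := 1) h.one_lt_p 1).const_mul β
  have h1 := (hasDerivAt_iff_tendsto_slope.1 hd).mono_left
    (nhdsWithin_mono _ (fun y (hy : y < 1) => hy.ne))
  have hval : β * (1 - p * |1| ^ (p - 1)) < -(5 / 4) := by
    have h2 := h.β_mul
    have h3 : (2 : ℝ) ≤ m := by exact_mod_cast h.two_le_m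
    simp only [abs_one, Real.one_rpow]
    linarith
  have h2 := h1.eventually (gt_mem_nhds hval)
  obtain ⟨l, hl, hl'⟩ := mem_nhdsLT_iff_exists_Ioo_subset.1 h2
  refine ⟨max ((l + 1) / 2) (1 / 2), ⟨by positivity, max_lt (by linarith [mem_Iio.1 hl])
    (by norm_num)⟩, fun w hw => ?_⟩
  have h3 := hl' (⟨by linarith [(le_max_left _ _).trans hw.1, mem_Iio.1 hl], hw.2⟩ : w ∈ Ioo l 1)
  have h4 : slope (fun x => β * nonlin p 1 x) 1 w < -(5 / 4) := h3
  have h5 : nonlin p 1 1 = 0 := by simp [nonlin]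
  rw [slope_def_field, h5, mul_zero, sub_zero, div_lt_iff_of_neg (by linarith [hw.2])] at h4
  linarith

lemma Params.exists_lower {m : ℕ} {α p β b : ℝ} (h : Params m α p β b) {η θ : ℝ} (hη : 0 < η)
    (hθ : θ ∈ Ioo (0 : ℝ) 1) : ∃ c > 0, ∀ w ∈ Icc η θ, c ≤ β * nonlin p 1 w := by
  have hp := h.one_lt_p
  have h1 : θ ^ (p - 1) < 1 := Real.rpow_lt_one hθ.1.le hθ.2 (by linarith)
  have hβ := h.β_pos
  have h3 : 0 < 1 - θ ^ (p - 1) := by linarith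
  refine ⟨β * (η * (1 - θ ^ (p - 1))), by positivity, fun w hw => ?_⟩
  have hw0 := hη.trans_le hw.1
  have h2 : w ^ (p - 1) ≤ θ ^ (p - 1) := Real.rpow_le_rpow hw0.le hw.2 (by linarith)
  have h4 : nonlin p 1 w = w * (1 - w ^ (p - 1)) := by
    rw [nonlin, abs_of_pos hw0]; ring
  rw [h4]
  gcongr
  exact hw.1

lemma Params.nonlin_pos {m : ℕ} {α p β b : ℝ} (h : Params m α p β b) {w : ℝ} (h0 : 0 < w)
    (h1 : w < 1) : 0 < nonlin p 1 w := by
  have h2 : w ^ (p - 1) < 1 := Real.rpow_lt_one h0.le h1 (by linarith [h.one_lt_p])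
  rw [nonlin, abs_of_pos h0]
  nlinarith

lemma Params.nonlin_le {m : ℕ} {α p β b : ℝ} (h : Params m α p β b) {w : ℝ} (h1 : 1 < w) :
    β * nonlin p 1 w ≤ -(5 / 4 * (w - 1)) ∧ nonlin p 1 w ≤ 0 := by
  have h2 := one_add_mul_self_le_rpow_one_add (s := w - 1) (by linarith) (p := p) h.one_lt_p.le
  rw [add_sub_cancel] at h2
  have hp := h.one_lt_p
  have h3 : nonlin p 1 w ≤ -((p - 1) * (w - 1)) := by
    rw [nonlin_one_of_pos (by linarith)]; linarith
  have h4 := h.β_mul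
  have h5 : (2 : ℝ) ≤ m := by exact_mod_cast h.two_le_m
  constructor
  · have h6 := mul_le_mul_of_nonneg_left h3 h.β_pos.le
    have h7 : β * -((p - 1) * (w - 1)) = -((m + 1) * (w - 1)) := by rw [← h4]; ring
    nlinarith
  · nlinarith

/-- Every sufficiently long window contains a point where `w = 1`. -/
lemma Params.exists_window {m : ℕ} {α p β b : ℝ} (h : Params m α p β b) {η V : ℝ} (hη : 0 < η)
    (hV : 0 < V) : ∃ L > 0, ∀ (w v q : ℝ → ℝ) (a : ℝ),
      (∀ t ∈ Icc a (a + L), HasDerivAt w (v t) t) →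
      (∀ t ∈ Icc a (a + L), HasDerivAt v (-v t + q t * nonlin p 1 (w t)) t) →
      (∀ t ∈ Icc a (a + L), β ≤ q t) → (∀ t ∈ Icc a (a + L), η ≤ w t) →
      (∀ t ∈ Icc a (a + L), w t < 1 → -V ≤ v t) → ∃ t ∈ Icc a (a + L), w t = 1 := by
  obtain ⟨θ, hθ, hthr⟩ := h.exists_threshold
  obtain ⟨c, hc, hlow⟩ := h.exists_lower hη hθ
  have hpi := Real.pi_pos
  have hβ := h.β_pos
  set T := Real.log (2 * (V + c) / c) with hT
  have hT0 : 0 < T := Real.log_pos (by rw [lt_div_iff₀ hc]; linarith)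
  have hTe : (V + c) * Real.exp (-T) = c / 2 := by
    rw [Real.exp_neg, hT, Real.exp_log (by positivity)]
    field_simp
  set l := T + 2 / c with hl
  have hl0 : 0 < l := by positivity
  refine ⟨2 * l + 2 * Real.pi, by positivity, fun w v q a hw hv hq hηw hVv => ?_⟩
  by_contra! hne
  have hwc : ContinuousOn w (Icc a (a + (2 * l + 2 * Real.pi))) := fun t ht =>
    (hw t ht).continuousAt.continuousWithinAt
  have hside : (∀ t ∈ Icc a (a + (2 * l + 2 * Real.pi)), 1 < w t) ∨
      ∀ t ∈ Icc a (a + (2 * l + 2 * Real.pi)), w t < 1 := by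
    by_contra! hcon
    obtain ⟨⟨t, ht, ht'⟩, s, hs, hs'⟩ := hcon
    obtain ⟨r, hr, hr'⟩ := isPreconnected_Icc.intermediate_value ht hs hwc ⟨ht', hs'⟩
    exact hne r hr hr'
  rcases hside with hgt | hlt
  · refine sturm_comparison (z := fun t => w t - 1) (z' := v)
      (z'' := fun t => -v t + q t * nonlin p 1 (w t)) (a := a) ?_ ?_ ?_ ?_ <;> intro t ht <;>
      have ht' : t ∈ Icc a (a + (2 * l + 2 * Real.pi)) := ⟨ht.1, by linarith [ht.2]⟩
    · exact (hw t ht').sub_const 1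
    · exact hv t ht'
    · linarith [hgt t ht']
    · have h1 := h.nonlin_le (hgt t ht')
      have h2 := mul_le_mul_of_nonpos_right (hq t ht') h1.2
      linarith [h1.1]
  have hpos : ∀ t ∈ Icc a (a + (2 * l + 2 * Real.pi)), 0 < nonlin p 1 (w t) := fun t ht =>
    h.nonlin_pos (hη.trans_le (hηw t ht)) (hlt t ht)
  have hexp : ∀ t ∈ Icc a (a + (2 * l + 2 * Real.pi)), HasDerivAt (fun t => Real.exp t * v t)
      (Real.exp t * (q t * nonlin p 1 (w t))) t := fun t ht => by
    have := (Real.hasDerivAt_exp t).fun_mul (hv t ht)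
    convert! this using 1
    ring
  have hmono : MonotoneOn (fun t => Real.exp t * v t) (Icc a (a + (2 * l + 2 * Real.pi))) := by
    apply monotoneOn_of_deriv_nonneg (convex_Icc _ _)
      (fun t ht => (hexp t ht).continuousAt.continuousWithinAt)
      (fun t ht => (hexp t (interior_subset ht)).differentiableAt.differentiableWithinAt)
    intro t ht
    have ht := interior_subset ht
    rw [(hexp t ht).deriv]
    have := hpos t ht
    have := hβ.trans_le (hq t ht)
    positivity
  have hvisit : ∀ r, a ≤ r → r + l ≤ a + (2 * l + 2 * Real.pi) → ∃ t ∈ Icc r (r + l), θ < w t := by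
    intro r har hr
    by_contra! hcon
    have hsub : Icc r (r + l) ⊆ Icc a (a + (2 * l + 2 * Real.pi)) := Icc_subset_Icc har hr
    have hmono2 : MonotoneOn (fun t => Real.exp t * v t - c * Real.exp t) (Icc r (r + l)) := by
      have hd : ∀ t ∈ Icc r (r + l), HasDerivAt (fun t => Real.exp t * v t - c * Real.exp t)
          (Real.exp t * (q t * nonlin p 1 (w t)) - c * Real.exp t) t := fun t ht =>
        (hexp t (hsub ht)).fun_sub ((Real.hasDerivAt_exp t).const_mul c)
      apply monotoneOn_of_deriv_nonneg (convex_Icc _ _)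
        (fun t ht => (hd t ht).continuousAt.continuousWithinAt)
        (fun t ht => (hd t (interior_subset ht)).differentiableAt.differentiableWithinAt)
      intro t ht
      have ht := interior_subset ht
      rw [(hd t ht).deriv]
      have h1 := hlow (w t) ⟨hηw t (hsub ht), hcon t ht⟩
      have h2 := mul_le_mul_of_nonneg_right (hq t (hsub ht)) (hpos t (hsub ht)).le
      have h3 := mul_le_mul_of_nonneg_left (h1.trans h2) (Real.exp_pos t).le
      linarith
    have hr0 : r ∈ Icc r (r + l) := ⟨le_rfl, by linarith⟩
    have hvlow : ∀ t ∈ Icc (r + T) (r + l), c / 2 ≤ v t := fun t ht => by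
      have ht' : t ∈ Icc r (r + l) := ⟨by linarith [ht.1], ht.2⟩
      have h1 := hmono2 hr0 ht' ht'.1
      have h2 := hVv r (hsub hr0) (hlt r (hsub hr0))
      simp only at h1
      have h3 : Real.exp r * (V + c) ≤ Real.exp t * (c / 2) := by
        rw [← hTe, mul_left_comm, mul_comm (Real.exp r), ← Real.exp_add]
        exact mul_le_mul_of_nonneg_left (Real.exp_le_exp.2 (by linarith [ht.1])) (by positivity)
      have h4 := mul_le_mul_of_nonneg_left h2 (Real.exp_pos r).le
      have h5 : Real.exp t * (c / 2) ≤ Real.exp t * v t := by linarith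
      exact le_of_mul_le_mul_left h5 (Real.exp_pos t)
    have hmono3 : MonotoneOn (fun t => w t - c / 2 * t) (Icc (r + T) (r + l)) := by
      have hs : Icc (r + T) (r + l) ⊆ Icc r (r + l) := Icc_subset_Icc_left (by linarith)
      have hd : ∀ t ∈ Icc (r + T) (r + l), HasDerivAt (fun t => w t - c / 2 * t)
          (v t - c / 2 * 1) t := fun t ht =>
        (hw t (hsub (hs ht))).fun_sub ((hasDerivAt_id' t).const_mul (c / 2))
      apply monotoneOn_of_deriv_nonneg (convex_Icc _ _)
        (fun t ht => (hd t ht).continuousAt.continuousWithinAt)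
        (fun t ht => (hd t (interior_subset ht)).differentiableAt.differentiableWithinAt)
      intro t ht
      have ht := interior_subset ht
      rw [(hd t ht).deriv]
      linarith [hvlow t ht]
    have h2c : 0 < 2 / c := by positivity
    have h1 : r + T ∈ Icc (r + T) (r + l) := ⟨le_rfl, by linarith⟩
    have h2 : r + l ∈ Icc (r + T) (r + l) := ⟨by linarith, le_rfl⟩
    have h3 := hmono3 h1 h2 h1.2
    simp only at h3
    have h4 := hηw (r + T) (hsub ⟨by linarith, h1.2⟩)
    have h5 := hlt (r + l) (hsub ⟨by linarith, le_rfl⟩)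
    have h6 : c / 2 * (r + l) = c / 2 * (r + T) + 1 := by rw [hl]; field_simp; ring
    linarith
  have hsturm : ∀ r, a ≤ r → r + Real.pi ≤ a + (2 * l + 2 * Real.pi) →
      (∀ t ∈ Icc r (r + Real.pi), θ ≤ w t) → False := by
    intro r har hr hθw
    have hsub : Icc r (r + Real.pi) ⊆ Icc a (a + (2 * l + 2 * Real.pi)) := Icc_subset_Icc har hr
    refine sturm_comparison (z := fun t => 1 - w t) (z' := fun t => -v t)
      (z'' := fun t => -(-v t + q t * nonlin p 1 (w t))) (a := r) ?_ ?_ ?_ ?_ <;> intro t ht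
    · exact (hw t (hsub ht)).const_sub 1
    · exact (hv t (hsub ht)).neg
    · linarith [hlt t (hsub ht)]
    · have h1 := hthr (w t) ⟨hθw t ht, hlt t (hsub ht)⟩
      have h2 := mul_le_mul_of_nonneg_right (hq t (hsub ht)) (hpos t (hsub ht)).le
      linarith
  obtain ⟨t₁, ht₁, hw₁⟩ := hvisit a le_rfl (by linarith)
  obtain ⟨t₂, ht₂, hw₂⟩ := hvisit (a + l + Real.pi) (by linarith) (by linarith)
  have h12 : t₁ + Real.pi ≤ t₂ := by linarith [ht₁.2, ht₂.1]
  have hsub : Icc t₁ t₂ ⊆ Icc a (a + (2 * l + 2 * Real.pi)) :=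
    Icc_subset_Icc ht₁.1 (by linarith [ht₂.2])
  obtain ⟨x, hx, hmin⟩ := isCompact_Icc.exists_isMinOn (nonempty_Icc.2 (by linarith : t₁ ≤ t₂))
    (hwc.mono hsub)
  rcases le_or_gt θ (w x) with hxθ | hxθ
  · exact hsturm t₁ ht₁.1 (by linarith [ht₂.2]) fun t ht =>
      hxθ.trans (hmin ⟨ht.1, ht.2.trans h12⟩)
  · have hxI : x ∈ Ioo t₁ t₂ := by
      refine ⟨hx.1.lt_of_ne ?_, hx.2.lt_of_ne ?_⟩
      · rintro rfl; linarith
      · rintro rfl; linarith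
    have hvx : v x = 0 :=
      (hmin.isLocalMin (Icc_mem_nhds hxI.1 hxI.2)).hasDerivAt_eq_zero (hw x (hsub hx))
    have hsub2 : Icc x (a + (2 * l + 2 * Real.pi)) ⊆ Icc a (a + (2 * l + 2 * Real.pi)) :=
      Icc_subset_Icc_left (hsub hx).1
    have hmonow : MonotoneOn w (Icc x (a + (2 * l + 2 * Real.pi))) := by
      apply monotoneOn_of_deriv_nonneg (convex_Icc _ _) (hwc.mono hsub2)
        (fun t ht => (hw t (hsub2 (interior_subset ht))).differentiableAt.differentiableWithinAt)
      intro t ht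
      have ht := interior_subset ht
      rw [(hw t (hsub2 ht)).deriv]
      have h1 := hmono (hsub hx) (hsub2 ht) ht.1
      simp only [hvx, mul_zero] at h1
      exact nonneg_of_mul_nonneg_right h1 (Real.exp_pos t)
    refine hsturm t₂ (by linarith [ht₂.1]) (by linarith [ht₂.2]) fun t ht => ?_
    exact hw₂.le.trans (hmonow ⟨hx.2, by linarith [ht₂.2]⟩
      ⟨hx.2.trans ht.1, by linarith [ht₂.2, ht.2]⟩ ht.1)

lemma Params.nonlin_nonpos {m : ℕ} {α p β b : ℝ} (h : Params m α p β b) {x : ℝ} (hx : b ≤ x) :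
    nonlin p β x ≤ 0 := by
  have hb := h.b_pos
  have h1 : β ≤ x ^ (p - 1) := by
    rw [← h.b_pow]; exact Real.rpow_le_rpow hb.le hx (by linarith [h.one_lt_p])
  rw [nonlin, abs_of_pos (hb.trans_le hx)]
  nlinarith

/-- Control of a profile on an initial interval `[0, r]` with `A ^ (p - 1) * r ^ 2` small. -/
lemma ProfileSol.initial_bounds {m : ℕ} {α p β b A : ℝ} {u : ℝ → ℝ} (h : Params m α p β b)
    (hu : ProfileSol m p β A u) (hA : 2 * b ≤ A) {r κ : ℝ} (hr : r ^ 2 ≤ 1 / 2)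
    (hκ : A ^ (p - 1) * r ^ 2 ≤ β * κ) (hκ1 : 8 * (β * κ) ≤ 1) (hκ2 : 4 * (α + 1) * κ ≤ 1)
    {ρ : ℝ} (hρ : ρ ∈ Ioc 0 r) :
    A / 2 ≤ u ρ ∧ flux m (fun σ => nonlin p β (u σ)) ρ / ρ ^ (m + 1) ≤ 0 ∧
      -(2 * α * u ρ) ≤ ρ * (flux m (fun σ => nonlin p β (u σ)) ρ / ρ ^ (m + 1)) := by
  have hb := h.b_pos
  have hα := h.α_pos
  have hA0 : 0 < A := by linarith
  have hr0 : 0 < r := hρ.1.trans_le hρ.2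
  have hr1 : r < 1 := by nlinarith
  set P := A ^ (p - 1) with hP
  have hP0 : 0 < P := Real.rpow_pos_of_pos hA0 _
  have hβP : β ≤ P := by
    rw [← h.b_pow]; exact Real.rpow_le_rpow hb.le (by linarith) (by linarith [h.one_lt_p])
  have hg : ∀ σ ∈ Icc (0 : ℝ) 1, |nonlin p β (u σ)| ≤ 2 * P * A := fun σ hσ => by
    have h1 := hu.bound σ hσ
    have h2 : |u σ| ^ (p - 1) ≤ P :=
      Real.rpow_le_rpow (abs_nonneg _) h1 (by linarith [h.one_lt_p])
    have h3 : 0 ≤ |u σ| ^ (p - 1) := Real.rpow_nonneg (abs_nonneg _) _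
    calc |nonlin p β (u σ)| ≤ |β * u σ| + |(|u σ| ^ (p - 1) * u σ)| := abs_sub _ _
      _ = β * |u σ| + |u σ| ^ (p - 1) * |u σ| := by
        rw [abs_mul, abs_mul, abs_of_pos h.β_pos, abs_of_nonneg h3]
      _ ≤ P * A + P * A := by gcongr
      _ = _ := by ring
  have hH : ∀ y ∈ Ioc 0 r,
      |flux m (fun σ => nonlin p β (u σ)) y / y ^ (m + 1)| ≤ 4 * P * A * y := fun y hy => by
    have h1 := abs_flux_le (m := m) (h := fun σ => nonlin p β (u σ)) (C := 2 * P * A) hy.1.le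
      ((pow_le_pow_left₀ hy.1.le hy.2 2).trans hr)
      (fun σ hσ => hg σ ⟨hσ.1, by linarith [hσ.2, hy.2]⟩)
    have hpos := pow_pos hy.1 (m + 1)
    rw [abs_div, abs_of_pos hpos, div_le_iff₀ hpos]
    linarith
  have hPr : 4 * P * A * r * r ≤ 4 * (β * κ) * A := by nlinarith
  have hlow : ∀ y ∈ Ioc 0 r, A / 2 ≤ u y := fun y hy => by
    obtain ⟨c, hc, hc'⟩ := exists_hasDerivAt_eq_slope u _ hy.1 hu.cont.continuousOn
      (fun x hx => hu.hasDerivAt h ⟨hx.1, by linarith [hx.2, hy.2]⟩)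
    rw [hu.zero, sub_zero, eq_div_iff hy.1.ne'] at hc'
    have h1 := abs_le.1 (hH c ⟨hc.1, hc.2.le.trans hy.2⟩)
    have h2 : 4 * P * A * c * y ≤ 4 * P * A * r * r := by
      have := hc.2.le.trans hy.2
      have := hy.2
      have := hy.1.le
      gcongr
    have h3 := mul_le_mul_of_nonneg_right h1.1 hy.1.le
    nlinarith
  have hneg : flux m (fun σ => nonlin p β (u σ)) ρ / ρ ^ (m + 1) ≤ 0 := by
    apply div_nonpos_of_nonpos_of_nonneg _ (pow_pos hρ.1 _).le
    rw [flux, ← neg_nonneg, ← intervalIntegral.integral_neg]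
    apply intervalIntegral.integral_nonneg hρ.1.le
    intro σ hσ
    have h1 : b ≤ u σ := by
      rcases hσ.1.eq_or_lt with rfl | h0
      · rw [hu.zero]; linarith
      · linarith [hlow σ ⟨h0, hσ.2.trans hρ.2⟩]
    have h2 : 0 < 1 - σ ^ 2 := one_sub_sq_pos ⟨by linarith [hσ.1], by linarith [hσ.2, hρ.2]⟩
    have h3 := div_nonpos_of_nonpos_of_nonneg (h.nonlin_nonpos h1) h2.le
    have h4 := pow_nonneg hσ.1 (m + 1)
    nlinarith
  refine ⟨hlow ρ hρ, hneg, ?_⟩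
  have h1 := abs_le.1 (hH ρ hρ)
  have h2 : 4 * P * A * ρ * ρ ≤ 4 * P * A * r * r := by
    have := hρ.2
    have := hρ.1.le
    gcongr
  have h3 := mul_le_mul_of_nonneg_left h1.1 hρ.1.le
  have h4 : 4 * (β * κ) * A ≤ α * A := by
    rw [h.β_eq]
    have := mul_le_mul_of_nonneg_left hκ2 hα.le
    nlinarith
  have h5 := mul_le_mul_of_nonneg_left (hlow ρ hρ) hα.le
  linarith

/-- Emden–Fowler variable `ρ ^ α * u / b` as a function of `t = log ρ`. -/
noncomputable def efW (α b : ℝ) (u : ℝ → ℝ) (t : ℝ) : ℝ :=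
  Real.exp (α * t) * u (Real.exp t) / b

/-- Derivative of the Emden–Fowler variable. -/
noncomputable def efV (m : ℕ) (α p β b : ℝ) (u : ℝ → ℝ) (t : ℝ) : ℝ :=
  Real.exp (α * t) * (α * u (Real.exp t) + Real.exp t *
    (flux m (fun σ => nonlin p β (u σ)) (Real.exp t) / Real.exp t ^ (m + 1))) / b

lemma exp_mem_Ioo {t : ℝ} (ht : t < 0) : Real.exp t ∈ Ioo (0 : ℝ) 1 :=
  ⟨Real.exp_pos t, Real.exp_lt_one_iff.2 ht⟩

namespace ProfileSol

variable {m : ℕ} {α p β b A : ℝ} {u : ℝ → ℝ}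

lemma hasDerivAt_efW (h : Params m α p β b) (hu : ProfileSol m p β A u) {t : ℝ} (ht : t < 0) :
    HasDerivAt (efW α b u) (efV m α p β b u t) t := by
  have h1 := ((hasDerivAt_id' t).const_mul α).exp
  have h2 := (hu.hasDerivAt h (exp_mem_Ioo ht)).comp t (Real.hasDerivAt_exp t)
  convert! (h1.fun_mul h2).div_const b using 1
  simp only [efV, Function.comp]
  ring

lemma hasDerivAt_efV (h : Params m α p β b) (hu : ProfileSol m p β A u) {t : ℝ} (ht : t < 0) :
    HasDerivAt (efV m α p β b u) (-efV m α p β b u t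
      + β / (1 - Real.exp t ^ 2) * nonlin p 1 (efW α b u t)) t := by
  have h0 := exp_mem_Ioo ht
  have h1 := ((hasDerivAt_id' t).const_mul α).exp
  have h2 := (hu.hasDerivAt h h0).comp t (Real.hasDerivAt_exp t)
  have h3 := (hasDerivAt_div_pow h0.1.ne' (hu.hasDerivAt_flux h h0)).comp t (Real.hasDerivAt_exp t)
  have h4 := (h1.fun_mul ((h2.const_mul α).fun_add
    ((Real.hasDerivAt_exp t).fun_mul h3))).div_const b
  convert! h4 using 1
  have hb := h.b_pos
  have h5 : (1 : ℝ) - Real.exp t ^ 2 ≠ 0 :=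
    (one_sub_sq_pos ⟨by linarith [h0.1], h0.2⟩).ne'
  have h6 : |efW α b u t| ^ (p - 1) * β = Real.exp t ^ 2 * |u (Real.exp t)| ^ (p - 1) := by
    rw [efW, abs_div, abs_of_pos hb, abs_mul, abs_of_pos (Real.exp_pos _),
      Real.div_rpow (by positivity) hb.le, h.b_pow,
      Real.mul_rpow (Real.exp_pos _).le (abs_nonneg _), div_mul_cancel₀ _ h.β_pos.ne',
      ← Real.exp_mul, mul_right_comm, h.α_mul, ← Real.exp_nat_mul]
    norm_num
  have h7 : β * nonlin p 1 (efW α b u t) = Real.exp (α * t) * u (Real.exp t) / b *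
      (β - Real.exp t ^ 2 * |u (Real.exp t)| ^ (p - 1)) := by
    rw [← h6, nonlin, ← show efW α b u t = Real.exp (α * t) * u (Real.exp t) / b from rfl]
    ring
  rw [div_mul_eq_mul_div, h7]
  simp only [Function.comp, efV, nonlin]
  generalize flux m (fun σ => β * u σ - |u σ| ^ (p - 1) * u σ) (Real.exp t)
    / Real.exp t ^ (m + 1) = Q
  generalize |u (Real.exp t)| ^ (p - 1) = w
  have hm := h.m_eq
  rw [h.m_eq, h.β_eq]
  field_simp
  ring

lemma antitoneOn_energy (h : Params m α p β b) (hu : ProfileSol m p β A u) :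
    AntitoneOn (fun t => efV m α p β b u t ^ 2 * (1 - Real.exp t ^ 2) / (2 * β)
      + |efW α b u t| ^ (p + 1) / (p + 1) - efW α b u t ^ 2 / 2) (Iio 0) := by
  have hp := h.one_lt_p
  have hβ := h.β_pos
  have hd : ∀ t ∈ Iio (0 : ℝ), HasDerivAt (fun t =>
      efV m α p β b u t ^ 2 * (1 - Real.exp t ^ 2) / (2 * β)
      + |efW α b u t| ^ (p + 1) / (p + 1) - efW α b u t ^ 2 / 2)
      (-(efV m α p β b u t ^ 2 / β)) t := fun t ht => by
    have h1 := hu.hasDerivAt_efW h ht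
    have h2 := hu.hasDerivAt_efV h ht
    have h3 := (hasDerivAt_abs_rpow (efW α b u t) (p := p + 1) (by linarith)).comp t h1
    have h4 := ((((h2.fun_pow 2).fun_mul (((Real.hasDerivAt_exp t).fun_pow 2).const_sub
      1)).div_const
      (2 * β)).fun_add (h3.div_const (p + 1))).fun_sub ((h1.fun_pow 2).div_const 2)
    convert! h4 using 1
    have h0 := exp_mem_Ioo ht
    have h5 : (1 : ℝ) - Real.exp t ^ 2 ≠ 0 :=
      (one_sub_sq_pos ⟨by linarith [h0.1], h0.2⟩).ne'
    have h6 : p + 1 - 2 = p - 1 := by ring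
    have h7 : p + 1 ≠ 0 := by linarith
    rw [h6, nonlin]
    generalize |efW α b u t| ^ (p - 1) = w
    field_simp
    push_cast
    ring
  apply antitoneOn_of_deriv_nonpos (convex_Iio _)
    (fun t ht => (hd t ht).continuousAt.continuousWithinAt)
    (fun t ht => (hd t (interior_subset ht)).differentiableAt.differentiableWithinAt)
  intro t ht
  rw [(hd t (interior_subset ht)).deriv]
  have : 0 ≤ efV m α p β b u t ^ 2 / β := by positivity
  linarith

/-- If the Emden–Fowler variable starts close to zero with small slope, then it stays away
from zero afterwards. -/
lemma efW_lower (h : Params m α p β b) (hu : ProfileSol m p β A u) {x τ : ℝ} (hx : 0 < x)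
    (hτ : τ < 0) (hxκ : 4 * (α + 1) * x ^ (p - 1) ≤ 1) (hw : efW α b u τ ∈ Icc (x / 2) x)
    (hv : |efV m α p β b u τ| ≤ α * efW α b u τ) {t : ℝ} (ht : t ∈ Ico τ 0) :
    x / (8 * (α + 1)) ≤ efW α b u t ∧
      (efW α b u t ≤ 1 → efV m α p β b u t ^ 2 * (1 - Real.exp t ^ 2) ≤ β) := by
  have hp := h.one_lt_p
  have hβ := h.β_pos
  have hα := h.α_pos
  have hneg : ∀ s ∈ Ico τ 0, efV m α p β b u s ^ 2 * (1 - Real.exp s ^ 2) / (2 * β)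
      + |efW α b u s| ^ (p + 1) / (p + 1) - efW α b u s ^ 2 / 2 ≤ -(x ^ 2 / (16 * (α + 1))) := by
    intro s hs
    refine (hu.antitoneOn_energy h hτ hs.2 hs.1).trans ?_
    set w := efW α b u τ
    set v := efV m α p β b u τ
    have hw0 : 0 < w := by linarith [hw.1]
    have h1 : v ^ 2 ≤ α ^ 2 * w ^ 2 := by
      rw [← mul_pow]
      exact sq_le_sq' (by linarith [(abs_le.1 hv).1]) (abs_le.1 hv).2
    have h0 := exp_mem_Ioo hτ
    have h2 : v ^ 2 * (1 - Real.exp τ ^ 2) / (2 * β) ≤ α ^ 2 * w ^ 2 / (2 * β) := by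
      refine div_le_div_of_nonneg_right (le_trans ?_ h1) (by positivity)
      nlinarith [sq_nonneg v, sq_nonneg (v * Real.exp τ)]
    have h3 : |w| ^ (p + 1) = w ^ 2 * w ^ (p - 1) := by
      rw [abs_of_pos hw0, show p + 1 = 2 + (p - 1) by ring, Real.rpow_add hw0]
      norm_num
    have h4 : w ^ (p - 1) ≤ x ^ (p - 1) := Real.rpow_le_rpow hw0.le hw.2 (by linarith)
    have h5 : |w| ^ (p + 1) / (p + 1) ≤ w ^ 2 * (1 / (4 * (α + 1))) := by
      have h6 : w ^ (p - 1) ≤ 1 / (4 * (α + 1)) := by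
        rw [le_div_iff₀ (by positivity)]
        nlinarith
      rw [h3, mul_div_assoc]
      exact mul_le_mul_of_nonneg_left
        ((div_le_self (Real.rpow_nonneg hw0.le _) (by linarith)).trans h6) (sq_nonneg w)
    have h7 : α ^ 2 * w ^ 2 / (2 * β) = w ^ 2 / 2 - w ^ 2 * (1 / (2 * (α + 1))) := by
      rw [h.β_eq]; field_simp; ring
    have h8 : x ^ 2 / (16 * (α + 1)) ≤ w ^ 2 * (1 / (4 * (α + 1))) := by
      have : (x / 2) ^ 2 ≤ w ^ 2 := pow_le_pow_left₀ (by linarith) hw.1 2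
      calc x ^ 2 / (16 * (α + 1)) = (x / 2) ^ 2 * (1 / (4 * (α + 1))) := by field_simp; ring
        _ ≤ _ := by gcongr
    have h9 : w ^ 2 * (1 / (2 * (α + 1))) = 2 * (w ^ 2 * (1 / (4 * (α + 1)))) := by
      field_simp; ring
    linarith
  have hkin : ∀ s ∈ Ico τ 0, 0 ≤ efV m α p β b u s ^ 2 * (1 - Real.exp s ^ 2) := fun s hs => by
    have h0 := exp_mem_Ioo hs.2
    have h1 := one_sub_sq_pos (σ := Real.exp s) ⟨by linarith [h0.1], h0.2⟩
    positivity
  have hpot : ∀ s, 0 ≤ |efW α b u s| ^ (p + 1) / (p + 1) := fun s => by positivity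
  have habs : ∀ s ∈ Ico τ 0, x / (8 * (α + 1)) ≤ |efW α b u s| := fun s hs => by
    have h1 := hneg s hs
    have h2 := hpot s
    have h3 := div_nonneg (hkin s hs) (by positivity : 0 ≤ 2 * β)
    have h4 : (x / (8 * (α + 1))) ^ 2 ≤ 2 * (x ^ 2 / (16 * (α + 1))) := by
      rw [div_pow, mul_div_assoc', div_le_div_iff₀ (by positivity) (by positivity)]
      nlinarith [mul_pos (sq_pos_of_pos hx) hα, mul_pos (mul_pos (sq_pos_of_pos hx) hα) hα,
        sq_pos_of_pos hx]
    apply abs_le_of_sq_le_sq' _ (abs_nonneg _) |>.2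
    rw [sq_abs]
    linarith
  have hη : 0 < x / (8 * (α + 1)) := by positivity
  have hpos : 0 < efW α b u t := by
    by_contra! hle
    have hc : ContinuousOn (efW α b u) (Icc τ t) := fun s hs =>
      (hu.hasDerivAt_efW h (hs.2.trans_lt ht.2)).continuousAt.continuousWithinAt
    obtain ⟨s, hs, hs0⟩ := intermediate_value_Icc' ht.1 hc ⟨hle, by linarith [hw.1]⟩
    have := habs s ⟨hs.1, hs.2.trans_lt ht.2⟩
    rw [hs0, abs_zero] at this
    linarith
  have h1 := habs t ht
  rw [abs_of_pos hpos] at h1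
  refine ⟨h1, fun hle => ?_⟩
  have h2 := hneg t ht
  have h3 := hpot t
  have h4 : 0 ≤ x ^ 2 / (16 * (α + 1)) := by positivity
  have h5 : efW α b u t ^ 2 ≤ 1 := pow_le_one₀ hpos.le hle
  have h6 : efV m α p β b u t ^ 2 * (1 - Real.exp t ^ 2) / (2 * β) ≤ 1 / 2 := by linarith
  rw [div_le_iff₀ (by positivity)] at h6
  linarith

end ProfileSol

lemma exp_sq_le_half {t : ℝ} (ht : t ≤ -1) : Real.exp t ^ 2 ≤ 1 / 2 := by
  have h1 : Real.exp t ≤ Real.exp (-1) := Real.exp_le_exp.2 ht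
  have h2 : Real.exp (-1) * Real.exp 1 = 1 := by rw [← Real.exp_add]; simp
  have h3 := Real.add_one_le_exp (1 : ℝ)
  have h4 := Real.exp_pos (-1)
  have h5 : Real.exp t ≤ 1 / 2 := by nlinarith
  nlinarith [Real.exp_pos t]

/-- For large data the Emden–Fowler variable enters the oscillation regime early. -/
lemma Params.exists_entrance {m : ℕ} {α p β b : ℝ} (h : Params m α p β b) :
    ∃ η > 0, ∃ τ : ℝ → ℝ, Tendsto τ atTop atBot ∧ ∀ᶠ A in atTop, ∀ u, ProfileSol m p β A u →
      (∀ ρ ∈ Ioc 0 (Real.exp (τ A)), 0 < u ρ) ∧ ∀ t ∈ Ico (τ A) 0, η ≤ efW α b u t ∧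
        (efW α b u t ≤ 1 → efV m α p β b u t ^ 2 * (1 - Real.exp t ^ 2) ≤ β) := by
  have hp := h.one_lt_p
  have hβ := h.β_pos
  have hα := h.α_pos
  have hb := h.b_pos
  have hp1 : p - 1 ≠ 0 := by linarith
  set κ : ℝ := 1 / (8 * (β + 1) * (α + 1)) with hκ
  have hκ0 : 0 < κ := by positivity
  have hκ1 : 8 * (β * κ) ≤ 1 := by
    rw [hκ, mul_one_div, mul_div_assoc', div_le_one (by positivity)]
    nlinarith [mul_pos hα hβ]
  have hκ2 : 4 * (α + 1) * κ ≤ 1 := by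
    rw [hκ, mul_one_div, div_le_one (by positivity)]
    nlinarith [mul_pos hα hβ]
  set x : ℝ := κ ^ (p - 1)⁻¹ with hx
  have hx0 : 0 < x := Real.rpow_pos_of_pos hκ0 _
  have hxp : x ^ (p - 1) = κ := Real.rpow_inv_rpow hκ0.le hp1
  let τ : ℝ → ℝ := fun A => (Real.log (b * x) - Real.log A) / α
  have hτ : Tendsto τ atTop atBot := by
    apply Tendsto.atBot_div_const hα
    exact tendsto_atBot_add_const_left _ _ (tendsto_neg_atTop_atBot.comp Real.tendsto_log_atTop)
  refine ⟨x / (8 * (α + 1)), by positivity, τ, hτ, ?_⟩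
  filter_upwards [eventually_ge_atTop (2 * b), hτ.eventually (eventually_le_atBot (-1))]
    with A hA hτA u hu
  have hA0 : 0 < A := by linarith
  set r := Real.exp (τ A) with hr
  have hr0 : 0 < r := Real.exp_pos _
  have hατ : Real.exp (α * τ A) = b * x / A := by
    rw [show α * τ A = Real.log (b * x) - Real.log A by simp only [τ]; field_simp,
      Real.exp_sub, Real.exp_log (by positivity), Real.exp_log hA0]
  have hr2 : r ^ 2 = (b * x / A) ^ (p - 1) := by
    rw [← hατ, ← Real.exp_mul, mul_right_comm, h.α_mul, hr, ← Real.exp_nat_mul]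
    norm_num
  have hAr : A ^ (p - 1) * r ^ 2 ≤ β * κ := by
    rw [hr2, Real.div_rpow (by positivity) hA0.le, Real.mul_rpow hb.le hx0.le, h.b_pow, hxp,
      mul_div_cancel₀ _ (Real.rpow_pos_of_pos hA0 _).ne']
  have hinit := fun ρ hρ => hu.initial_bounds h hA (exp_sq_le_half hτA) hAr hκ1 hκ2 (ρ := ρ) hρ
  refine ⟨fun ρ hρ => by linarith [(hinit ρ hρ).1], ?_⟩
  obtain ⟨h1, h2, h3⟩ := hinit r ⟨hr0, le_rfl⟩
  have hW : efW α b u (τ A) = x / A * u r := by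
    rw [efW, hατ, ← hr]
    field_simp
  have hub := (le_abs_self _).trans (hu.bound r ⟨hr0.le, by
    nlinarith [exp_sq_le_half hτA]⟩)
  have hxA : 0 < x / A := by positivity
  intro t ht
  refine hu.efW_lower h hx0 (by linarith) (hxp ▸ hκ2) ?_ ?_ ht
  · rw [hW]
    constructor
    · calc x / 2 = x / A * (A / 2) := by field_simp
        _ ≤ _ := by gcongr
    · calc x / A * u r ≤ x / A * A := by gcongr
        _ = x := by field_simp
  · have hV : efV m α p β b u (τ A) = x / A * (α * u r + r *
        (flux m (fun σ => nonlin p β (u σ)) r / r ^ (m + 1))) := by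
      rw [efV, hατ, ← hr]
      field_simp
    rw [hV, hW, abs_mul, abs_of_pos hxA, mul_left_comm]
    refine mul_le_mul_of_nonneg_left (abs_le.2 ⟨by linarith, ?_⟩) hxA.le
    linarith [mul_nonpos_of_nonneg_of_nonpos hr0.le h2]

lemma Params.eventually_pos {m : ℕ} {α p β b : ℝ} (h : Params m α p β b) :
    ∀ᶠ A in atTop, ∀ u, ProfileSol m p β A u → ∀ ρ ∈ Ioo (0 : ℝ) 1, 0 < u ρ := by
  obtain ⟨η, hη, τ, -, hev⟩ := h.exists_entrance
  filter_upwards [hev] with A hA u hu ρ hρ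
  obtain ⟨h1, h2⟩ := hA u hu
  rcases le_or_gt ρ (Real.exp (τ A)) with hle | hlt
  · exact h1 ρ ⟨hρ.1, hle⟩
  · have h3 := (h2 (Real.log ρ) ⟨((Real.lt_log_iff_exp_lt hρ.1).2 hlt).le,
      Real.log_neg hρ.1 hρ.2⟩).1
    rw [efW, Real.exp_log hρ.1] at h3
    by_contra! hle
    have h4 := div_nonpos_of_nonpos_of_nonneg
      (mul_nonpos_of_nonneg_of_nonpos (Real.exp_pos (α * Real.log ρ)).le hle) h.b_pos.le
    linarith

lemma Params.gap_eq_zero {m : ℕ} {α p β b : ℝ} (h : Params m α p β b) {u : ℝ → ℝ} {t : ℝ}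
    (ht : efW α b u t = 1) : gap α b u (Real.exp t) = 0 := by
  have hb := h.b_pos
  rw [efW, div_eq_one_iff_eq hb.ne'] at ht
  rw [gap, ← Real.exp_mul, ← ht, mul_comm t, neg_mul, Real.exp_neg]
  have := (Real.exp_pos (α * t)).ne'
  field_simp
  ring

lemma Params.exists_hasZeros {m : ℕ} {α p β b : ℝ} (h : Params m α p β b) (n : ℕ) (A₀ : ℝ) :
    ∃ A > A₀, ∀ u, ProfileSol m p β A u → HasZeros α b u n := by
  obtain ⟨η, hη, τ, hτ, hev⟩ := h.exists_entrance
  have hβ := h.β_pos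
  obtain ⟨L, hL, hwin⟩ := h.exists_window hη (by positivity : 0 < 2 * β + 1)
  obtain ⟨A, hA, hA₀, hτA⟩ := (hev.and ((eventually_gt_atTop A₀).and
    (hτ.eventually (eventually_le_atBot (-1 - n * (L + 1)))))).exists
  refine ⟨A, hA₀, fun u hu => ?_⟩
  obtain ⟨-, hlow⟩ := hA u hu
  have hroot : ∀ i : Fin n, ∃ t ∈ Icc (τ A + i * (L + 1)) (τ A + i * (L + 1) + L),
      efW α b u t = 1 := fun i => by
    have hi : ((i : ℕ) : ℝ) + 1 ≤ n := by exact_mod_cast i.2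
    have hi0 : (0 : ℝ) ≤ (i : ℕ) := Nat.cast_nonneg _
    have hmem : ∀ t ∈ Icc (τ A + i * (L + 1)) (τ A + i * (L + 1) + L), τ A ≤ t ∧ t ≤ -1 := by
      intro t ht
      constructor
      · have : 0 ≤ (i : ℝ) * (L + 1) := by positivity
        linarith [ht.1]
      · have := mul_le_mul_of_nonneg_right hi (by linarith : 0 ≤ L + 1)
        linarith [ht.2]
    apply hwin (efW α b u) (efV m α p β b u) (fun t => β / (1 - Real.exp t ^ 2))
    · exact fun t ht => hu.hasDerivAt_efW h (by linarith [(hmem t ht).2])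
    · exact fun t ht => hu.hasDerivAt_efV h (by linarith [(hmem t ht).2])
    · intro t ht
      have h1 := exp_sq_le_half (hmem t ht).2
      rw [le_div_iff₀ (by linarith)]
      nlinarith [mul_nonneg hβ.le (sq_nonneg (Real.exp t))]
    · exact fun t ht => (hlow t ⟨(hmem t ht).1, by linarith [(hmem t ht).2]⟩).1
    · intro t ht hw
      have h1 := (hlow t ⟨(hmem t ht).1, by linarith [(hmem t ht).2]⟩).2 hw.le
      have h2 := exp_sq_le_half (hmem t ht).2
      have h3 : efV m α p β b u t ^ 2 * (1 / 2) ≤ β :=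
        (mul_le_mul_of_nonneg_left (by linarith) (sq_nonneg _)).trans h1
      nlinarith [sq_nonneg (efV m α p β b u t + 1)]
  choose t ht ht1 using hroot
  have hstep : ∀ i j : Fin n, i < j → t i < t j := fun i j hij => by
    have h1 : ((i : ℕ) : ℝ) + 1 ≤ (j : ℕ) := by exact_mod_cast hij
    have h2 := mul_le_mul_of_nonneg_right h1 (by linarith : 0 ≤ L + 1)
    linarith [(ht i).2, (ht j).1]
  refine ⟨fun i => Real.exp (t i), fun i j hij => ?_,
    fun i => ⟨exp_mem_Ioo ?_, h.gap_eq_zero (ht1 i)⟩⟩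
  · have hij := Real.exp_injective hij
    by_contra hne
    rcases lt_or_gt_of_ne hne with hlt | hlt
    · exact (hstep i j hlt).ne hij
    · exact (hstep j i hlt).ne hij.symm
  · have hi : ((i : ℕ) : ℝ) + 1 ≤ n := by exact_mod_cast i.2
    have := mul_le_mul_of_nonneg_right hi (by linarith : 0 ≤ L + 1)
    linarith [(ht i).2]

/-- Holomorphic dependence of an integral over `[0,1]` on a parameter. -/
lemma differentiableAt_integral_of_analyticAt {F : ℂ × ℂ → ℂ} {s₀ : ℂ}
    (hF : ∀ τ ∈ Icc (0 : ℝ) 1, AnalyticAt ℂ F (s₀, (τ : ℂ))) :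
    DifferentiableAt ℂ (fun s => ∫ τ in (0 : ℝ)..1, F (s, (τ : ℂ))) s₀ := by
  let F' : ℂ → ℝ → ℂ := fun s τ => fderiv ℂ F (s, (τ : ℂ)) (1, 0)
  have hcoe : Continuous fun z : ℂ × ℝ => (z.1, (z.2 : ℂ)) := by fun_prop
  have hcont' : ∀ s : ℂ, ∀ τ : ℝ, AnalyticAt ℂ F (s, (τ : ℂ)) →
      ContinuousAt (fun z : ℂ × ℝ => F' z.1 z.2) (s, τ) := fun s τ h => by
    have h1 : ContinuousAt (fun q : ℂ × ℂ => fderiv ℂ F q (1, 0)) (s, (τ : ℂ)) :=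
      h.fderiv.continuousAt.clm_apply continuousAt_const
    exact ContinuousAt.comp (f := fun z : ℂ × ℝ => (z.1, (z.2 : ℂ))) (x := (s, τ)) h1
      hcoe.continuousAt
  have hc : ContinuousOn (F' s₀) (Icc 0 1) := fun τ hτ =>
    (ContinuousAt.comp (f := fun τ : ℝ => (s₀, τ)) (hcont' s₀ τ (hF τ hτ))
      (by fun_prop)).continuousWithinAt
  obtain ⟨C, hC⟩ := isCompact_Icc.exists_bound_of_continuousOn hc
  have hev : ∀ᶠ s in 𝓝 s₀, ∀ τ ∈ Icc (0 : ℝ) 1,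
      AnalyticAt ℂ F (s, (τ : ℂ)) ∧ ‖F' s τ‖ ≤ C + 1 := by
    refine isCompact_Icc.eventually_forall_of_forall_eventually fun τ hτ => ?_
    have h1 := (hcoe.continuousAt (x := (s₀, τ))).eventually (hF τ hτ).eventually_analyticAt
    have h2 := (hcont' s₀ τ (hF τ hτ)).norm.eventually (gt_mem_nhds
      ((hC τ hτ).trans_lt (lt_add_one C)))
    filter_upwards [h1, h2] with z hz hz'
    exact ⟨hz, hz'.le⟩
  obtain ⟨δ, hδ, hball⟩ := Metric.eventually_nhds_iff_ball.1 hev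
  have hF_cont : ∀ s ∈ Metric.ball s₀ δ, ContinuousOn (fun τ : ℝ => F (s, (τ : ℂ))) (Icc 0 1) :=
    fun s hs τ hτ => (ContinuousAt.comp (f := fun τ : ℝ => (s, (τ : ℂ)))
      (hball s hs τ hτ).1.continuousAt (by fun_prop)).continuousWithinAt
  have hsub : uIoc (0 : ℝ) 1 ⊆ Icc 0 1 := by
    rw [uIoc_of_le zero_le_one]; exact Ioc_subset_Icc_self
  have hmem : Metric.ball s₀ δ ∈ 𝓝 s₀ := Metric.ball_mem_nhds _ hδ
  refine (intervalIntegral.hasDerivAt_integral_of_dominated_loc_of_deriv_le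
    (F := fun s τ => F (s, (τ : ℂ))) (F' := F') (bound := fun _ => C + 1)
    hmem ?_ ?_ ?_ ?_ intervalIntegrable_const ?_).2.differentiableAt
  · filter_upwards [hmem] with s hs
    exact ((hF_cont s hs).mono hsub).aestronglyMeasurable measurableSet_uIoc
  · exact (hF_cont s₀ (Metric.mem_ball_self hδ)).intervalIntegrable_of_Icc zero_le_one
  · exact (hc.mono hsub).aestronglyMeasurable measurableSet_uIoc
  · exact Eventually.of_forall fun τ hτ s hs => (hball s hs τ (hsub hτ)).2
  · refine Eventually.of_forall fun τ hτ s hs => ?_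
    have h1 := (hball s hs τ (hsub hτ)).1.differentiableAt.hasFDerivAt
    exact h1.comp_hasDerivAt s ((hasDerivAt_id s).prodMk (hasDerivAt_const s (τ : ℂ)))

/-- A Volterra equation with holomorphic data has a holomorphic solution, and every continuous
solution along a short segment coincides with it. -/
lemma exists_analyticAt_of_volterra {φ : ℂ → ℂ} {κ G : ℂ × ℂ → ℂ} (hφ : AnalyticAt ℂ φ 0)
    (hκ : ∀ τ ∈ Icc (0 : ℝ) 1, AnalyticAt ℂ κ (0, (τ : ℂ)))
    (hκ0 : ∀ τ ∈ Icc (0 : ℝ) 1, κ (0, (τ : ℂ)) = 0) (hG : AnalyticAt ℂ G (0, φ 0)) :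
    ∃ y : ℂ → ℂ, AnalyticAt ℂ y 0 ∧ ∃ r > 0, ∃ R > 0, ∀ s : ℂ, ‖s‖ < R → ∀ v : ℝ → ℂ,
      ContinuousOn v (Icc 0 1) → (∀ τ ∈ Icc (0 : ℝ) 1, ‖v τ - φ 0‖ ≤ r) →
      (∀ τ ∈ Icc (0 : ℝ) 1, v τ = φ (τ * s)
        + ∫ t in (0 : ℝ)..1, κ (τ * s, (t : ℂ)) * G (t * (τ * s), v (t * τ))) →
      v 1 = y s := by
  obtain ⟨L, V, hV, hL⟩ := hG.hasStrictFDerivAt.exists_lipschitzOnWith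
  obtain ⟨r₀, hr₀, hball⟩ := Metric.eventually_nhds_iff_ball.1
    ((eventually_mem_set.2 hV).and (hG.eventually_analyticAt.and
      (hG.continuousAt.norm.eventually (gt_mem_nhds (lt_add_one ‖G (0, φ 0)‖)))))
  set M := ‖G (0, φ 0)‖ + 1 with hM
  have hM0 : 0 < M := by positivity
  set r := r₀ / 2 with hr
  have hr_pos : 0 < r := by positivity
  set ε := min (r / (2 * M)) (1 / (2 * (L + 1))) with hε
  have hε_pos : 0 < ε := by positivity
  have hεM : ε * M ≤ r / 2 := by
    have : ε ≤ r / (2 * M) := min_le_left _ _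
    calc ε * M ≤ r / (2 * M) * M := by gcongr
      _ = r / 2 := by field_simp
  have hεL : ε * L ≤ 1 / 2 := by
    have : ε ≤ 1 / (2 * (L + 1)) := min_le_right _ _
    calc ε * L ≤ 1 / (2 * (L + 1)) * (L + 1) := by gcongr; simp
      _ = 1 / 2 := by field_simp
  have hevκ : ∀ᶠ s in 𝓝 (0 : ℂ), ∀ τ ∈ Icc (0 : ℝ) 1,
      AnalyticAt ℂ κ (s, (τ : ℂ)) ∧ ‖κ (s, (τ : ℂ))‖ ≤ ε := by
    refine isCompact_Icc.eventually_forall_of_forall_eventually fun τ hτ => ?_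
    have hcoe : ContinuousAt (fun z : ℂ × ℝ => (z.1, (z.2 : ℂ))) (0, τ) := by fun_prop
    have h1 := hcoe.eventually (hκ τ hτ).eventually_analyticAt
    have h2 := hcoe.eventually ((hκ τ hτ).continuousAt.norm.eventually (gt_mem_nhds
      (show ‖κ (0, (τ : ℂ))‖ < ε by simpa [hκ0 τ hτ] using hε_pos)))
    filter_upwards [h1, h2] with z hz hz'
    exact ⟨hz, hz'.le⟩
  obtain ⟨R₁, hR₁, hB⟩ := Metric.eventually_nhds_iff_ball.1
    (hevκ.and (hφ.eventually_analyticAt.and (hφ.continuousAt.eventually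
      (Metric.closedBall_mem_nhds (φ 0) (half_pos hr_pos)))))
  set R := min R₁ r₀ with hR
  have hR_pos : 0 < R := lt_min hR₁ hr₀
  have hB' : ∀ s ∈ Metric.ball (0 : ℂ) R, s ∈ Metric.ball (0 : ℂ) R₁ := fun s hs =>
    Metric.ball_subset_ball (min_le_left _ _) hs
  have hscale : ∀ s ∈ Metric.ball (0 : ℂ) R, ∀ τ ∈ Icc (0 : ℝ) 1,
      (τ : ℂ) * s ∈ Metric.ball (0 : ℂ) R := fun s hs τ hτ => by
    rw [mem_ball_zero_iff] at hs ⊢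
    rw [norm_mul, Complex.norm_real, Real.norm_eq_abs, abs_of_nonneg hτ.1]
    nlinarith [hτ.2, norm_nonneg s]
  have hprod : ∀ s ∈ Metric.ball (0 : ℂ) R, ∀ z ∈ Metric.closedBall (φ 0) r,
      (s, z) ∈ Metric.ball ((0 : ℂ), φ 0) r₀ := fun s hs z hz => by
    rw [← ball_prod_same]
    exact ⟨Metric.ball_subset_ball (min_le_right _ _) hs,
      Metric.closedBall_subset_ball (half_lt_self hr₀) hz⟩
  -- continuity of the integrands
  have hintegrable : ∀ s ∈ Metric.ball (0 : ℂ) R, ∀ f : ℝ → ℂ, ContinuousOn f (Icc 0 1) →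
      (∀ t ∈ Icc (0 : ℝ) 1, f t ∈ Metric.closedBall (φ 0) r) →
      IntervalIntegrable (fun t : ℝ => κ (s, (t : ℂ)) * G (t * s, f t))
        MeasureTheory.volume 0 1 := fun s hs f hf hfr => by
    refine ContinuousOn.intervalIntegrable_of_Icc zero_le_one (ContinuousOn.mul ?_ ?_)
    · exact fun t ht => (ContinuousAt.comp (f := fun t : ℝ => (s, (t : ℂ)))
        ((hB s (hB' s hs)).1 t ht).1.continuousAt (by fun_prop)).continuousWithinAt
    · refine fun t ht => ContinuousAt.comp_continuousWithinAt (f := fun t : ℝ => ((t : ℂ) * s, f t))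
        (hball _ (hprod _ (hscale s hs t ht) _ (hfr t ht))).2.1.continuousAt ?_
      exact ContinuousWithinAt.prodMk (by fun_prop) (hf t ht)
  have hcontr : ∀ s ∈ Metric.ball (0 : ℂ) R, ∀ f g : ℝ → ℂ, ContinuousOn f (Icc 0 1) →
      ContinuousOn g (Icc 0 1) → (∀ t ∈ Icc (0 : ℝ) 1, f t ∈ Metric.closedBall (φ 0) r) →
      (∀ t ∈ Icc (0 : ℝ) 1, g t ∈ Metric.closedBall (φ 0) r) → ∀ d : ℝ,
      (∀ t ∈ Icc (0 : ℝ) 1, ‖f t - g t‖ ≤ d) →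
      ‖(∫ t in (0 : ℝ)..1, κ (s, (t : ℂ)) * G (t * s, f t))
        - ∫ t in (0 : ℝ)..1, κ (s, (t : ℂ)) * G (t * s, g t)‖ ≤ d / 2 := by
    intro s hs f g hf hg hfr hgr d hd
    rw [← intervalIntegral.integral_sub (hintegrable s hs f hf hfr) (hintegrable s hs g hg hgr)]
    refine (intervalIntegral.norm_integral_le_of_norm_le_const (C := d / 2) fun t ht => ?_).trans
      (by simp)
    rw [uIoc_of_le zero_le_one] at ht
    have ht' : t ∈ Icc (0 : ℝ) 1 := Ioc_subset_Icc_self ht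
    have h1 := hL.norm_sub_le (hball _ (hprod _ (hscale s hs t ht') _ (hfr t ht'))).1
      (hball _ (hprod _ (hscale s hs t ht') _ (hgr t ht'))).1
    rw [Prod.mk_sub_mk, sub_self, Prod.norm_mk, norm_zero, max_eq_right (norm_nonneg _)] at h1
    rw [← mul_sub, norm_mul]
    have h2 := ((hB s (hB' s hs)).1 t ht').2
    have h3 := hd t ht'
    have hd0 : 0 ≤ d := (norm_nonneg _).trans h3
    calc ‖κ (s, (t : ℂ))‖ * ‖G (t * s, f t) - G (t * s, g t)‖ ≤ ε * (L * d) := by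
          refine mul_le_mul h2 (h1.trans ?_) (norm_nonneg _) hε_pos.le
          gcongr
      _ = ε * L * d := by ring
      _ ≤ 1 / 2 * d := by gcongr
      _ = d / 2 := by ring
  -- the Picard iterates
  let T : (ℂ → ℂ) → ℂ → ℂ := fun y s =>
    φ s + ∫ t in (0 : ℝ)..1, κ (s, (t : ℂ)) * G (t * s, y (t * s))
  let Y : ℕ → ℂ → ℂ := fun n => T^[n] fun _ => φ 0
  have hYsucc : ∀ n s, Y (n + 1) s =
      φ s + ∫ t in (0 : ℝ)..1, κ (s, (t : ℂ)) * G (t * s, Y n (t * s)) := fun n s => by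
    simp only [Y, Function.iterate_succ_apply', T]
  have hY : ∀ n, (∀ s ∈ Metric.ball (0 : ℂ) R, DifferentiableAt ℂ (Y n) s) ∧
      ∀ s ∈ Metric.ball (0 : ℂ) R, Y n s ∈ Metric.closedBall (φ 0) r := by
    intro n
    induction n with
    | zero => exact ⟨fun s _ => differentiableAt_const _, fun s _ => by simp [Y, hr_pos.le]⟩
    | succ n ih =>
      have han : ∀ s ∈ Metric.ball (0 : ℂ) R, AnalyticAt ℂ (Y n) s := fun s hs =>
        DifferentiableOn.analyticAt (s := Metric.ball (0 : ℂ) R)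
          (fun z hz => (ih.1 z hz).differentiableWithinAt) (Metric.isOpen_ball.mem_nhds hs)
      refine ⟨fun s hs => ?_, fun s hs => ?_⟩
      · have h1 : Y (n + 1) = fun s => φ s +
          ∫ t in (0 : ℝ)..1, κ (s, (t : ℂ)) * G (t * s, Y n (t * s)) := funext (hYsucc n)
        rw [h1]
        refine (hB s (hB' s hs)).2.1.differentiableAt.add
          (differentiableAt_integral_of_analyticAt
            (F := fun q : ℂ × ℂ => κ q * G (q.2 * q.1, Y n (q.2 * q.1))) fun t ht => ?_)
        have hm := hscale s hs t ht
        refine ((hB s (hB' s hs)).1 t ht).1.mul ?_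
        have h2 : AnalyticAt ℂ (fun q : ℂ × ℂ => q.2 * q.1) (s, (t : ℂ)) :=
          analyticAt_snd.mul analyticAt_fst
        have h3 : AnalyticAt ℂ (fun q : ℂ × ℂ => Y n (q.2 * q.1)) (s, (t : ℂ)) :=
          AnalyticAt.fun_comp (g := Y n) (han _ hm) h2
        exact AnalyticAt.fun_comp (g := G) (hball _ (hprod _ hm _ (ih.2 _ hm))).2.1 (h2.prod h3)
      · rw [hYsucc, mem_closedBall_iff_norm]
        have h1 := (hB s (hB' s hs)).2.2
        rw [dist_eq_norm] at h1
        have h2 : ‖∫ t in (0 : ℝ)..1, κ (s, (t : ℂ)) * G (t * s, Y n (t * s))‖ ≤ ε * M := by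
          refine (intervalIntegral.norm_integral_le_of_norm_le_const (C := ε * M)
            fun t ht => ?_).trans (by simp)
          rw [uIoc_of_le zero_le_one] at ht
          have ht' : t ∈ Icc (0 : ℝ) 1 := Ioc_subset_Icc_self ht
          have hm := hscale s hs t ht'
          rw [norm_mul]
          exact mul_le_mul ((hB s (hB' s hs)).1 t ht').2 (hball _ (hprod _ hm _ (ih.2 _ hm))).2.2.le
            (norm_nonneg _) hε_pos.le
        calc _ = ‖(φ s - φ 0) + ∫ t in (0 : ℝ)..1, κ (s, (t : ℂ)) * G (t * s, Y n (t * s))‖ := by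
              congr 1; ring
          _ ≤ r / 2 + r / 2 := (norm_add_le _ _).trans (add_le_add h1 (h2.trans hεM))
          _ = r := by ring
  have hYcont : ∀ n, ∀ s ∈ Metric.ball (0 : ℂ) R,
      ContinuousOn (fun t : ℝ => Y n (t * s)) (Icc 0 1) := fun n s hs t ht =>
    (ContinuousAt.comp (f := fun t : ℝ => (t : ℂ) * s) ((hY n).1 _ (hscale s hs t ht)).continuousAt
      (by fun_prop)).continuousWithinAt
  have hYr : ∀ n, ∀ s ∈ Metric.ball (0 : ℂ) R, ∀ t ∈ Icc (0 : ℝ) 1,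
      Y n (t * s) ∈ Metric.closedBall (φ 0) r := fun n s hs t ht => (hY n).2 _ (hscale s hs t ht)
  have hcauchy : ∀ n, ∀ s ∈ Metric.ball (0 : ℂ) R,
      dist (Y n s) (Y (n + 1) s) ≤ 2 * r / 2 / 2 ^ n := by
    intro n
    induction n with
    | zero =>
      intro s hs
      have := (hY 1).2 s hs
      rw [Metric.mem_closedBall, dist_comm] at this
      have h0 : Y 0 s = φ 0 := rfl
      rw [h0]
      simpa using this
    | succ n ih =>
      intro s hs
      have := hcontr s hs _ _ (hYcont n s hs) (hYcont (n + 1) s hs) (hYr n s hs) (hYr (n + 1) s hs)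
        _ fun t ht => by simpa only [dist_eq_norm] using ih _ (hscale s hs t ht)
      rw [dist_eq_norm, hYsucc, hYsucc (n + 1), add_sub_add_left_eq_sub]
      refine this.trans (le_of_eq ?_)
      rw [pow_succ]
      field_simp
  have hlim : ∀ s ∈ Metric.ball (0 : ℂ) R, ∃ z, Tendsto (fun n => Y n s) atTop (𝓝 z) :=
    fun s hs => cauchySeq_tendsto_of_complete
      (cauchySeq_of_le_geometric_two fun n => hcauchy n s hs)
  choose! y hy using hlim
  have hunif : TendstoUniformlyOn Y y atTop (Metric.ball 0 R) := by
    rw [Metric.tendstoUniformlyOn_iff]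
    intro δ hδ
    have h1 : Tendsto (fun n : ℕ => 2 * r * (1 / 2) ^ n) atTop (𝓝 (2 * r * 0)) :=
      (tendsto_pow_atTop_nhds_zero_of_lt_one (by norm_num) (by norm_num)).const_mul _
    rw [mul_zero] at h1
    filter_upwards [h1.eventually (gt_mem_nhds hδ)] with n hn s hs
    have := dist_le_of_le_geometric_two_of_tendsto (fun n => hcauchy n s hs) (hy s hs) n
    rw [dist_comm]
    refine this.trans_lt (lt_of_le_of_lt (le_of_eq ?_) hn)
    rw [one_div, inv_pow, div_eq_mul_inv]
  have hyd : DifferentiableOn ℂ y (Metric.ball 0 R) :=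
    hunif.tendstoLocallyUniformlyOn.differentiableOn
      (Eventually.of_forall fun n s hs => ((hY n).1 s hs).differentiableWithinAt)
      Metric.isOpen_ball
  refine ⟨y, hyd.analyticAt (Metric.ball_mem_nhds _ hR_pos), r, hr_pos, R, hR_pos,
    fun s hs v hv hvr hve => ?_⟩
  have hs' : s ∈ Metric.ball (0 : ℂ) R := by rwa [mem_ball_zero_iff]
  have hvr' : ∀ τ ∈ Icc (0 : ℝ) 1, v τ ∈ Metric.closedBall (φ 0) r := fun τ hτ => by
    rw [mem_closedBall_iff_norm]; exact hvr τ hτ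
  have hcmp : ∀ n, ∀ τ ∈ Icc (0 : ℝ) 1, ‖v τ - Y n (τ * s)‖ ≤ r / 2 ^ n := by
    intro n
    induction n with
    | zero => intro τ hτ; simpa [Y] using hvr τ hτ
    | succ n ih =>
      intro τ hτ
      have hmul : ∀ t ∈ Icc (0 : ℝ) 1, t * τ ∈ Icc (0 : ℝ) 1 := fun t ht =>
        ⟨mul_nonneg ht.1 hτ.1, mul_le_one₀ ht.2 hτ.1 hτ.2⟩
      have hsτ := hscale s hs' τ hτ
      have := hcontr _ hsτ (fun t => v (t * τ)) _ (hv.comp (by fun_prop) hmul)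
        (hYcont n _ hsτ) (fun t ht => hvr' _ (hmul t ht)) (hYr n _ hsτ) (r / 2 ^ n)
        fun t ht => by
          have := ih _ (hmul t ht)
          push_cast at this
          rwa [mul_assoc] at this
      rw [hve τ hτ, hYsucc, add_sub_add_left_eq_sub]
      refine this.trans (le_of_eq ?_)
      rw [pow_succ]
      field_simp
  have h1 : Tendsto (fun n => ‖v 1 - Y n s‖) atTop (𝓝 ‖v 1 - y s‖) :=
    ((hy s hs').const_sub _).norm
  have h2 : Tendsto (fun n : ℕ => r * (1 / 2) ^ n) atTop (𝓝 (r * 0)) :=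
    (tendsto_pow_atTop_nhds_zero_of_lt_one (by norm_num) (by norm_num)).const_mul _
  rw [mul_zero] at h2
  have h3 : ‖v 1 - y s‖ ≤ 0 := le_of_tendsto_of_tendsto' h1 h2 fun n => by
    have := hcmp n 1 (by norm_num)
    rwa [Complex.ofReal_one, one_mul, div_eq_mul_inv, ← inv_pow, ← one_div] at this
  exact sub_eq_zero.1 (norm_le_zero_iff.1 h3)

/-- A real solution of a Volterra equation with holomorphic data is locally the restriction of a
holomorphic function. -/
lemma exists_analyticAt_eq_of_volterra {φ : ℂ → ℂ} {κ G : ℂ × ℂ → ℂ} {f : ℝ → ℝ} {I : Set ℝ} {a : ℝ}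
    (hI : Convex ℝ I) (ha : a ∈ I) (hf : ContinuousOn f I) (hφ : AnalyticAt ℂ φ 0)
    (hφ0 : φ 0 = f a)
    (hκ : ∀ τ ∈ Icc (0 : ℝ) 1, AnalyticAt ℂ κ (0, (τ : ℂ)))
    (hκ0 : ∀ τ ∈ Icc (0 : ℝ) 1, κ (0, (τ : ℂ)) = 0) (hG : AnalyticAt ℂ G (0, (f a : ℂ)))
    (heq : ∀ᶠ x in 𝓝[I] a, (f x : ℂ) = φ ((x - a : ℝ) : ℂ)
      + ∫ t in (0 : ℝ)..1, κ (((x - a : ℝ) : ℂ), (t : ℂ))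
        * G ((t : ℂ) * ((x - a : ℝ) : ℂ), (f (a + t * (x - a)) : ℂ))) :
    ∃ y : ℂ → ℂ, AnalyticAt ℂ y 0 ∧ ∀ᶠ x in 𝓝[I] a, (f x : ℂ) = y ((x - a : ℝ) : ℂ) := by
  obtain ⟨y, hy, r, hr, R, hR, huniq⟩ := exists_analyticAt_of_volterra hφ hκ hκ0 (by rwa [hφ0])
  refine ⟨y, hy, ?_⟩
  have hclose : ∀ᶠ x in 𝓝[I] a, ‖(f x : ℂ) - φ 0‖ ≤ r := by
    have h1 := (hf a ha).eventually (Metric.closedBall_mem_nhds (f a) hr)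
    filter_upwards [h1] with x hx
    rw [hφ0, ← Complex.ofReal_sub, Complex.norm_real]
    rwa [dist_eq_norm] at hx
  obtain ⟨δ, hδ, hball⟩ := Metric.mem_nhdsWithin_iff.1 (heq.and hclose)
  refine Metric.mem_nhdsWithin_iff.2 ⟨min δ R, lt_min hδ hR, fun x hx => ?_⟩
  obtain ⟨hx, hxI⟩ := hx
  rw [Metric.mem_ball, dist_eq_norm, lt_min_iff] at hx
  have hmem : ∀ τ ∈ Icc (0 : ℝ) 1, a + τ * (x - a) ∈ Metric.ball a δ ∩ I := fun τ hτ => by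
    refine ⟨?_, by simpa using hI.add_smul_sub_mem ha hxI hτ⟩
    rw [Metric.mem_ball, dist_eq_norm, add_sub_cancel_left, norm_mul, Real.norm_eq_abs τ,
      abs_of_nonneg hτ.1]
    nlinarith [hτ.2, norm_nonneg (x - a), hx.1]
  have key := huniq ((x - a : ℝ) : ℂ) (by rw [Complex.norm_real]; exact hx.2)
    (fun τ => (f (a + τ * (x - a)) : ℂ)) ?_ (fun τ hτ => (hball (hmem τ hτ)).2) fun τ hτ => ?_
  · simpa using key
  · refine Complex.continuous_ofReal.comp_continuousOn (hf.comp (by fun_prop) fun τ hτ => ?_)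
    exact (hmem τ hτ).2
  · rw [(hball (hmem τ hτ)).1]
    simp only [add_sub_cancel_left, Complex.ofReal_mul, mul_assoc]

lemma AnalyticAt.re_comp_ofReal {y : ℂ → ℂ} (hy : AnalyticAt ℂ y 0) (a : ℝ) :
    AnalyticAt ℝ (fun x : ℝ => (y ((x - a : ℝ) : ℂ)).re) a := by
  have h1 : AnalyticAt ℝ (fun x : ℝ => ((x - a : ℝ) : ℂ)) a :=
    (Complex.ofRealCLM.analyticAt _).comp (analyticAt_id.sub analyticAt_const)
  have h2 : AnalyticAt ℝ y ((a - a : ℝ) : ℂ) := by simpa using hy.restrictScalars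
  exact (Complex.reCLM.analyticAt _).comp
    (AnalyticAt.fun_comp (g := y) (f := fun x : ℝ => ((x - a : ℝ) : ℂ)) h2 h1)

lemma analyticWithinAt_of_eq {f : ℝ → ℝ} {I : Set ℝ} {a : ℝ} (ha : a ∈ I) {y : ℂ → ℂ}
    (hy : AnalyticAt ℂ y 0) (h : ∀ᶠ x in 𝓝[I] a, (f x : ℂ) = y ((x - a : ℝ) : ℂ)) :
    AnalyticWithinAt ℝ f I a := by
  have h1 : f =ᶠ[𝓝[I] a] fun x => (y ((x - a : ℝ) : ℂ)).re := by
    filter_upwards [h] with x hx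
    rw [← hx, Complex.ofReal_re]
  exact (hy.re_comp_ofReal a).analyticWithinAt.congr_of_eventuallyEq h1 (h1.self_of_nhdsWithin ha)

/-- Rescaling of an integral to the unit interval. -/
lemma integral_eq_integral_unit (f : ℝ → ℝ) (a x : ℝ) :
    ∫ σ in a..x, f σ = ∫ t in (0 : ℝ)..1, (x - a) * f (a + t * (x - a)) := by
  have h1 := intervalIntegral.mul_integral_comp_add_mul (a := 0) (b := 1) (f := f) (x - a) a
  rw [intervalIntegral.integral_const_mul]
  simp only [mul_comm _ (x - a), mul_zero, mul_one, add_zero, add_sub_cancel] at h1 ⊢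
  exact h1.symm

/-- Holomorphic extension of the reaction term to the right half-plane. -/
noncomputable def cNonlin (p β : ℝ) (z : ℂ) : ℂ := β * z - z ^ ((p - 1 : ℝ) : ℂ) * z

lemma cNonlin_ofReal (p β : ℝ) {x : ℝ} (hx : 0 < x) :
    cNonlin p β (x : ℂ) = (nonlin p β x : ℂ) := by
  rw [cNonlin, nonlin, abs_of_pos hx, ← Complex.ofReal_cpow hx.le]
  push_cast
  ring

lemma analyticAt_cNonlin (p β : ℝ) {x : ℝ} (hx : 0 < x) : AnalyticAt ℂ (cNonlin p β) (x : ℂ) := by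
  refine (analyticAt_const.mul analyticAt_id).sub (AnalyticAt.mul ?_ analyticAt_id)
  exact analyticAt_id.cpow analyticAt_const (Complex.ofReal_mem_slitPlane.2 hx)

/-- The kernel of the Volterra equation based at `a`, on the rescaled interval. -/
noncomputable def baseKer (m : ℕ) (a : ℝ) (q : ℂ × ℂ) : ℂ :=
  (a + q.2 * q.1) * (1 - ((a + q.2 * q.1) / (a + q.1)) ^ m) / m

lemma analyticAt_baseKer (m : ℕ) {a : ℝ} (ha : a ≠ 0) (τ : ℂ) :
    AnalyticAt ℂ (baseKer m a) (0, τ) := by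
  have h1 : AnalyticAt ℂ (fun q : ℂ × ℂ => (a : ℂ) + q.2 * q.1) (0, τ) :=
    analyticAt_const.add (analyticAt_snd.mul analyticAt_fst)
  have h2 : AnalyticAt ℂ (fun q : ℂ × ℂ => (a : ℂ) + q.1) (0, τ) :=
    analyticAt_const.add analyticAt_fst
  exact (h1.mul (analyticAt_const.sub ((h1.fun_div h2 (by simpa using ha)).pow m))).div_const

lemma baseKer_zero (m : ℕ) {a : ℝ} (ha : a ≠ 0) (τ : ℂ) : baseKer m a (0, τ) = 0 := by
  simp [baseKer, ha]

namespace ProfileSol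

variable {m : ℕ} {α p β b A : ℝ} {u : ℝ → ℝ}

lemma analyticWithinAt_zero (h : Params m α p β b) (hu : ProfileSol m p β A u)
    (hpos : ∀ ρ ∈ Icc (0 : ℝ) 1, 0 < u ρ) : AnalyticWithinAt ℝ u (Ico 0 1) 0 := by
  have hm : (m : ℝ) ≠ 0 := by have := h.two_le_m; positivity
  have h0 : (0 : ℝ) ∈ Ico (0 : ℝ) 1 := by simp
  obtain ⟨y, hy, hyu⟩ : ∃ y : ℂ → ℂ, AnalyticAt ℂ y 0 ∧
      ∀ᶠ x in 𝓝[Ico 0 1] (0 : ℝ), (u x : ℂ) = y ((x - 0 : ℝ) : ℂ) := by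
    refine exists_analyticAt_eq_of_volterra (φ := fun _ => (A : ℂ))
      (κ := fun q => q.1 ^ 2 * (q.2 * (1 - q.2 ^ m) / m))
      (G := fun q => cNonlin p β q.2 / (1 - q.1 ^ 2)) (f := u) (convex_Ico 0 1) h0
      hu.cont.continuousOn analyticAt_const (by rw [hu.zero]) (fun τ _ => ?_) (fun τ _ => by simp)
      ?_ ?_
    · exact (analyticAt_fst.pow 2).mul
        ((analyticAt_snd.mul (analyticAt_const.sub (analyticAt_snd.pow m))).div_const)
    · refine AnalyticAt.fun_div (AnalyticAt.fun_comp (g := cNonlin p β) (f := Prod.snd)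
        (analyticAt_cNonlin p β (hpos 0 (by simp))) analyticAt_snd)
        (analyticAt_const.sub (analyticAt_fst.pow 2)) (by simp)
    · filter_upwards [self_mem_nhdsWithin] with x hx
      rw [hu.volterra x ⟨hx.1, hx.2.le⟩, integral_volKer_eq hx.1 hx.2.le,
        integral_eq_integral_unit, Complex.ofReal_add, ← intervalIntegral.integral_ofReal]
      congr 1
      refine intervalIntegral.integral_congr fun t ht => ?_
      rw [uIcc_of_le zero_le_one] at ht
      have hmem : t * x ∈ Icc (0 : ℝ) x := ⟨mul_nonneg ht.1 hx.1, mul_le_of_le_one_left hx.1 ht.2⟩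
      simp only [sub_zero, zero_add]
      rw [cNonlin_ofReal p β (hpos _ ⟨hmem.1, hmem.2.trans hx.2.le⟩), volKer_of_ge hmem.2]
      rcases eq_or_ne x 0 with rfl | hx0
      · simp
      · rw [mul_div_cancel_right₀ _ hx0]
        push_cast
        have : (1 : ℂ) - (t * x) ^ 2 ≠ 0 := by
          have h1 := (one_sub_sq_pos (σ := t * x) ⟨by linarith [hmem.1], hmem.2.trans_lt hx.2⟩).ne'
          exact_mod_cast h1
        field_simp
  exact analyticWithinAt_of_eq h0 hy hyu

lemma analyticAt (h : Params m α p β b) (hu : ProfileSol m p β A u)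
    (hpos : ∀ ρ ∈ Icc (0 : ℝ) 1, 0 < u ρ) {a : ℝ} (ha : a ∈ Ioo (0 : ℝ) 1) :
    AnalyticAt ℝ u a := by
  have hm : 0 < m := by have := h.two_le_m; omega
  have hsq : (1 : ℂ) - a ^ 2 ≠ 0 := by
    exact_mod_cast (one_sub_sq_pos (σ := a) ⟨by linarith [ha.1], ha.2⟩).ne'
  set H := flux m fun σ => nonlin p β (u σ) with hH
  obtain ⟨y, hy, hyu⟩ : ∃ y : ℂ → ℂ, AnalyticAt ℂ y 0 ∧
      ∀ᶠ x in 𝓝[Ioo 0 1] a, (u x : ℂ) = y ((x - a : ℝ) : ℂ) := by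
    refine exists_analyticAt_eq_of_volterra
      (φ := fun s => (u a : ℂ) + H a * (((a : ℂ) ^ m)⁻¹ - ((a + s) ^ m)⁻¹) / m)
      (κ := fun q => q.1 * baseKer m a q)
      (G := fun q => cNonlin p β q.2 / (1 - (a + q.1) ^ 2)) (f := u) (convex_Ioo 0 1) ha
      hu.cont.continuousOn ?_ (by simp) (fun τ _ => analyticAt_fst.mul
        (analyticAt_baseKer m ha.1.ne' _)) (fun τ _ => by simp) ?_ ?_
    · refine analyticAt_const.add (AnalyticAt.div_const (analyticAt_const.mul
        (analyticAt_const.sub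
          (AnalyticAt.fun_inv ((analyticAt_const.add analyticAt_id).pow m) ?_))))
      simpa using fun h0 => absurd h0 ha.1.ne'
    · refine AnalyticAt.fun_div (AnalyticAt.fun_comp (g := cNonlin p β) (f := Prod.snd)
        (analyticAt_cNonlin p β (hpos a (Ioo_subset_Icc_self ha))) analyticAt_snd)
        (analyticAt_const.sub ((analyticAt_const.add analyticAt_fst).pow 2)) (by simpa using hsq)
    · filter_upwards [self_mem_nhdsWithin] with x hx
      have hsub : uIcc a x ⊆ Ioo 0 1 := ordConnected_Ioo.uIcc_subset ha hx
      have hsub' : Ioo (min a x) (max a x) ⊆ Ioo 0 1 := fun z hz => hsub ⟨hz.1.le, hz.2.le⟩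
      have hF : ContinuousOn (fun σ => nonlin p β (u σ) / (1 - σ ^ 2)) (uIcc a x) :=
        (continuousOn_div_one_sub_sq (hu.continuous_nonlin_comp h)).mono
          (hsub.trans (Ioo_subset_Ioo_left (by norm_num)))
      have key := variation_of_constants hm ha.1 hx.1 (D := u) (H := H)
        (F := fun σ => nonlin p β (u σ) / (1 - σ ^ 2)) hu.cont.continuousOn
        (fun z hz => (hu.hasDerivAt_flux h (hsub hz)).continuousAt.continuousWithinAt)
        (fun z hz => hu.hasDerivAt h (hsub' hz)) (fun z hz => hu.hasDerivAt_flux h (hsub' hz))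
        (ContinuousOn.intervalIntegrable (ContinuousOn.mul (by fun_prop) hF))
      rw [key, integral_eq_integral_unit, Complex.ofReal_add, ← intervalIntegral.integral_ofReal]
      congr 1
      · push_cast
        simp
      refine intervalIntegral.integral_congr fun t ht => ?_
      rw [uIcc_of_le zero_le_one] at ht
      have hmem : a + t * (x - a) ∈ Ioo (0 : ℝ) 1 := by
        simpa using (convex_Ioo (0 : ℝ) 1).add_smul_sub_mem ha hx ht
      rw [cNonlin_ofReal p β (hpos _ (Ioo_subset_Icc_self hmem)), baseKer]
      push_cast
      rw [add_sub_cancel]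
      ring
  rw [← analyticWithinAt_univ]
  have := analyticWithinAt_of_eq ha hy hyu
  exact this.mono_of_mem_nhdsWithin (mem_nhdsWithin_of_mem_nhds (Ioo_mem_nhds ha.1 ha.2))

end ProfileSol

lemma hasDerivAt_sqrt_one_sub {x : ℝ} (hx : x < 1) :
    HasDerivAt (fun x : ℝ => √(1 - x)) (-(√(1 - x))⁻¹ / 2) x := by
  have h1 := ((hasDerivAt_id x).const_sub 1).sqrt (sub_pos.2 hx).ne'
  convert! h1 using 1
  have := (Real.sqrt_pos.2 (sub_pos.2 hx)).ne'
  simp only [id]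
  field_simp

lemma intervalIntegrable_inv_sqrt_one_sub :
    IntervalIntegrable (fun x : ℝ => (√(1 - x))⁻¹) MeasureTheory.volume 0 1 := by
  have h1 := (intervalIntegral.intervalIntegrable_rpow' (a := 1) (b := 0)
    (r := -(1 / 2 : ℝ)) (by norm_num)).comp_sub_left 1
  simp only [sub_self, sub_zero] at h1
  refine h1.congr fun x hx => ?_
  rw [uIoc_of_le zero_le_one] at hx
  rw [Real.rpow_neg (by linarith [hx.2]), Real.sqrt_eq_rpow]

namespace ProfileSol

variable {m : ℕ} {α p β b A : ℝ} {u : ℝ → ℝ}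

lemma exists_abs_flux_le (h : Params m α p β b) (hu : ProfileSol m p β A u) :
    ∃ C, 0 ≤ C ∧ ∀ ρ ∈ Ico (0 : ℝ) 1,
      |flux m (fun σ => nonlin p β (u σ)) ρ| ≤ C * (√(1 - ρ))⁻¹ := by
  obtain ⟨C, hC⟩ := isCompact_Icc.exists_bound_of_continuousOn (s := Icc (0 : ℝ) 1)
    (hu.continuous_nonlin_comp h).continuousOn
  have hC0 : 0 ≤ C := (norm_nonneg _).trans (hC 0 (by simp))
  refine ⟨2 * C, by positivity, fun ρ hρ => ?_⟩
  have hB : ∀ x < 1, HasDerivAt (fun x : ℝ => 2 * C * (√(1 - x))⁻¹)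
      (C * ((√(1 - x))⁻¹ * (1 - x)⁻¹)) x := fun x hx => by
    have h1 := Real.sqrt_pos.2 (sub_pos.2 hx)
    have h2 := ((hasDerivAt_sqrt_one_sub hx).fun_inv h1.ne').const_mul (2 * C)
    convert! h2 using 1
    rw [Real.sq_sqrt (sub_pos.2 hx).le]
    ring
  have hH : ∀ x ∈ Icc 0 ρ, HasDerivAt (flux m fun σ => nonlin p β (u σ))
      (x ^ (m + 1) * (nonlin p β (u x) / (1 - x ^ 2))) x := fun x hx =>
    _root_.hasDerivAt_flux (hu.continuous_nonlin_comp h)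
      ⟨by linarith [hx.1], hx.2.trans_lt hρ.2⟩
  refine image_norm_le_of_norm_deriv_right_le_deriv_boundary' (a := 0) (b := ρ)
    (f := flux m fun σ => nonlin p β (u σ))
    (fun x hx => (hH x hx).continuousAt.continuousWithinAt)
    (fun x hx => (hH x (Ico_subset_Icc_self hx)).hasDerivWithinAt) ?_
    (fun x hx => (hB x (hx.2.trans_lt hρ.2)).continuousAt.continuousWithinAt)
    (fun x hx => (hB x (hx.2.trans hρ.2)).hasDerivWithinAt) (fun x hx => ?_) ⟨hρ.1, le_rfl⟩
  · simpa [flux] using hC0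
  · have hx1 : x < 1 := hx.2.trans hρ.2
    have h1 : 0 < 1 - x := sub_pos.2 hx1
    have h2 := hC x ⟨hx.1, hx1.le⟩
    have h3 : x ^ (m + 1) ≤ 1 := pow_le_one₀ hx.1 hx1.le
    have h4 : 1 - x ≤ 1 - x ^ 2 := by nlinarith [hx.1]
    have h5 : 1 ≤ (√(1 - x))⁻¹ :=
      (one_le_inv₀ (Real.sqrt_pos.2 h1)).2 (Real.sqrt_le_one.2 (by linarith [hx.1]))
    rw [norm_mul, norm_div, Real.norm_of_nonneg (pow_nonneg hx.1 _),
      Real.norm_of_nonneg (h1.trans_le h4).le]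
    calc x ^ (m + 1) * (‖nonlin p β (u x)‖ / (1 - x ^ 2)) ≤ 1 * (C / (1 - x)) := by
          have := h1.trans_le h4
          gcongr
      _ = C * (1 * (1 - x)⁻¹) := by ring
      _ ≤ _ := by gcongr

lemma exists_abs_sub_le_sqrt (h : Params m α p β b) (hu : ProfileSol m p β A u) (h1 : u 1 = b) :
    ∃ K, 0 ≤ K ∧ ∀ ρ ∈ Icc (0 : ℝ) 1, |u ρ - b| ≤ K * √(1 - ρ) := by
  obtain ⟨C, hC0, hC⟩ := hu.exists_abs_flux_le h
  have hA : 0 ≤ A := (abs_nonneg _).trans (hu.bound 0 (by simp))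
  have hb := h.b_pos
  set K₁ := 2 ^ (m + 1) * C with hK₁
  have hK₁0 : 0 ≤ K₁ := by positivity
  refine ⟨2 * K₁ + 2 * (A + b), by positivity, fun ρ hρ => ?_⟩
  have hs0 := Real.sqrt_nonneg (1 - ρ)
  rcases le_total ρ (1 / 2) with hρ2 | hρ2
  · have h2 : 1 / 2 ≤ √(1 - ρ) := Real.le_sqrt_of_sq_le (by linarith)
    have h3 : |u ρ - b| ≤ A + b :=
      (abs_sub _ _).trans (by rw [abs_of_pos hb]; gcongr; exact hu.bound ρ hρ)
    nlinarith
  · have hB : ∀ x < 1, HasDerivAt (fun x : ℝ => 2 * K₁ * (√(1 - ρ) - √(1 - x)))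
        (K₁ * (√(1 - x))⁻¹) x := fun x hx => by
      have h2 := ((hasDerivAt_sqrt_one_sub hx).const_sub (√(1 - ρ))).const_mul (2 * K₁)
      convert! h2 using 1
      ring
    have key := image_norm_le_of_norm_deriv_right_le_deriv_boundary' (a := ρ) (b := 1)
      (f := fun x => u x - u ρ) (B := fun x => 2 * K₁ * (√(1 - ρ) - √(1 - x)))
      (hu.cont.sub continuous_const).continuousOn
      (fun x hx => ((hu.hasDerivAt h ⟨by linarith [hx.1], hx.2⟩).sub_const _).hasDerivWithinAt)
      (by simp) (by fun_prop) (fun x hx => (hB x hx.2).hasDerivWithinAt) (fun x hx => ?_)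
      (right_mem_Icc.2 hρ.2)
    · simp only [h1, sub_self, Real.sqrt_zero, sub_zero, Real.norm_eq_abs] at key
      rw [abs_sub_comm]
      have : 0 ≤ 2 * (A + b) * √(1 - ρ) := by positivity
      linarith
    · have hx0 : 1 / 2 ≤ x := hρ2.trans hx.1
      have h3 : (1 / 2 : ℝ) ^ (m + 1) ≤ x ^ (m + 1) := by gcongr
      rw [norm_div, Real.norm_of_nonneg (pow_nonneg (by linarith : (0 : ℝ) ≤ x) (m + 1))]
      calc _ ≤ C * (√(1 - x))⁻¹ / (1 / 2) ^ (m + 1) := by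
            gcongr
            exact hC x ⟨by linarith, hx.2⟩
        _ = K₁ * (√(1 - x))⁻¹ := by rw [hK₁, one_div, inv_pow]; field_simp

lemma intervalIntegrable_source (h : Params m α p β b) (hu : ProfileSol m p β A u) (h1 : u 1 = b) :
    IntervalIntegrable (fun σ => nonlin p β (u σ) / (1 - σ ^ 2)) MeasureTheory.volume 0 1 := by
  obtain ⟨K, hK0, hK⟩ := hu.exists_abs_sub_le_sqrt h h1
  obtain ⟨L, hL0, hL⟩ := exists_lipschitz_nonlin (β := β) h.one_lt_p A
  have hgb : nonlin p β b = 0 := by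
    rw [nonlin, abs_of_pos h.b_pos, h.b_pow, sub_self]
  have hbA : |b| ≤ A := by simpa [h1] using hu.bound 1 (by simp)
  refine (intervalIntegrable_inv_sqrt_one_sub.const_mul (L * K)).mono_fun ?_ ?_
  · exact (((hu.continuous_nonlin_comp h).measurable.div
      (by fun_prop)).aestronglyMeasurable)
  · refine (MeasureTheory.ae_restrict_iff' measurableSet_uIoc).2
      (Eventually.of_forall fun x hx => ?_)
    rw [uIoc_of_le zero_le_one] at hx
    rcases hx.2.eq_or_lt with rfl | hx1
    · simp
    have h2 : 0 < 1 - x := sub_pos.2 hx1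
    have h3 : 1 - x ≤ 1 - x ^ 2 := by nlinarith [hx.1]
    have h4 := hL _ _ (hu.bound x (Ioc_subset_Icc_self hx)) hbA
    rw [hgb, sub_zero] at h4
    have h5 := hK x (Ioc_subset_Icc_self hx)
    have h6 := Real.sqrt_pos.2 h2
    beta_reduce
    rw [norm_div, Real.norm_of_nonneg (h2.trans_le h3).le]
    refine le_trans ?_ (le_abs_self _)
    calc |nonlin p β (u x)| / (1 - x ^ 2) ≤ L * (K * √(1 - x)) / (1 - x) := by
          gcongr
          exact h4.trans (by gcongr)
      _ = L * K * (√(1 - x))⁻¹ := by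
          nth_rewrite 2 [← Real.sq_sqrt h2.le]
          field_simp

lemma continuousOn_flux (h : Params m α p β b) (hu : ProfileSol m p β A u) (h1 : u 1 = b) :
    ContinuousOn (flux m fun σ => nonlin p β (u σ)) (Icc 0 1) := by
  have h2 := (hu.intervalIntegrable_source h h1).continuousOn_mul
    (continuous_pow (M := ℝ) (m + 1)).continuousOn
  have h3 := intervalIntegral.continuousOn_primitive_interval' h2 left_mem_uIcc
  rwa [uIcc_of_le zero_le_one] at h3

end ProfileSol

lemma AnalyticAt.dslope_self {f : ℂ → ℂ} {z : ℂ} (hf : AnalyticAt ℂ f z) :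
    AnalyticAt ℂ (dslope f z) z :=
  let ⟨_, hp⟩ := hf
  hp.has_fpower_series_dslope_fslope.analyticAt

namespace ProfileSol

variable {m : ℕ} {α p β b A : ℝ} {u : ℝ → ℝ}

lemma hasDerivWithinAt_one (h : Params m α p β b) (hu : ProfileSol m p β A u) (h1 : u 1 = b) :
    HasDerivWithinAt u (flux m (fun σ => nonlin p β (u σ)) 1) (Iic 1) 1 := by
  refine hasDerivWithinAt_Iic_of_tendsto_deriv (s := Ioo 0 1)
    (fun x hx => (hu.hasDerivAt h hx).differentiableAt.differentiableWithinAt)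
    hu.cont.continuousWithinAt (Ioo_mem_nhdsLT zero_lt_one) ?_
  have h2 : ContinuousWithinAt (fun x => flux m (fun σ => nonlin p β (u σ)) x / x ^ (m + 1))
      (Icc 0 1) 1 :=
    (hu.continuousOn_flux h h1 1 (by simp)).div (by fun_prop) (by simp)
  have h3 : Tendsto (fun x => flux m (fun σ => nonlin p β (u σ)) x / x ^ (m + 1)) (𝓝[Ioo 0 1] 1)
      (𝓝 (flux m (fun σ => nonlin p β (u σ)) 1)) := by
    simpa using (h2.mono Ioo_subset_Icc_self).tendsto
  rw [nhdsWithin_Ioo_eq_nhdsLT zero_lt_one] at h3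
  refine h3.congr' ?_
  filter_upwards [Ioo_mem_nhdsLT zero_lt_one] with x hx
  exact (hu.hasDerivAt h hx).deriv.symm

lemma eq_integral_one (h : Params m α p β b) (hu : ProfileSol m p β A u) (h1 : u 1 = b) {x : ℝ}
    (hx : x ∈ Ioo (0 : ℝ) 1) :
    u x = b + flux m (fun σ => nonlin p β (u σ)) 1 * (1 - (x ^ m)⁻¹) / m
      + ∫ σ in (1 : ℝ)..x, σ * (1 - (σ / x) ^ m) / m * (nonlin p β (u σ) / (1 - σ ^ 2)) := by
  have hm : 0 < m := by have := h.two_le_m; omega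
  have hsub : uIcc 1 x ⊆ Icc 0 1 := by
    rw [uIcc_of_ge hx.2.le]
    exact Icc_subset_Icc_left hx.1.le
  have hsub' : Ioo (min 1 x) (max 1 x) ⊆ Ioo 0 1 := by
    rw [min_eq_right hx.2.le, max_eq_left hx.2.le]
    exact Ioo_subset_Ioo_left hx.1.le
  have key := variation_of_constants hm one_pos hx.1 (D := u)
    (H := flux m fun σ => nonlin p β (u σ)) (F := fun σ => nonlin p β (u σ) / (1 - σ ^ 2))
    hu.cont.continuousOn ((hu.continuousOn_flux h h1).mono hsub)
    (fun z hz => hu.hasDerivAt h (hsub' hz)) (fun z hz => hu.hasDerivAt_flux h (hsub' hz)) ?_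
  · simpa [h1] using key
  · refine IntervalIntegrable.continuousOn_mul ?_ (by fun_prop)
    refine (hu.intervalIntegrable_source h h1).mono_set ?_
    rwa [uIcc_of_le zero_le_one]

lemma exists_analyticAt_one (h : Params m α p β b) (hu : ProfileSol m p β A u)
    (hpos : ∀ ρ ∈ Icc (0 : ℝ) 1, 0 < u ρ) (h1 : u 1 = b) :
    ∃ Y : ℝ → ℝ, AnalyticAt ℝ Y 1 ∧ ∀ᶠ x in 𝓝[≤] 1, u x = Y x := by
  have hm : m ≠ 0 := by have := h.two_le_m; omega
  have hmC : (m : ℂ) ≠ 0 := by exact_mod_cast hm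
  set H := flux m (fun σ => nonlin p β (u σ)) 1 with hH
  set f : ℝ → ℝ := Function.update (fun x => (u x - b) / (x - 1)) 1 H with hf
  have hf1 : f 1 = H := Function.update_self ..
  have hfne : ∀ x ≠ 1, f x = (u x - b) / (x - 1) := fun x hx => Function.update_of_ne hx ..
  have hfu : ∀ x, u x = b + (x - 1) * f x := fun x => by
    rcases eq_or_ne x 1 with rfl | hx
    · simp [h1]
    · have := sub_ne_zero.2 hx
      rw [hfne x hx]
      field_simp
      ring
  have hfc : ContinuousOn f (Ioc 0 1) := fun x hx => by
    rcases eq_or_ne x 1 with rfl | hx1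
    · rw [hf, continuousWithinAt_update_same]
      have h2 := hasDerivWithinAt_iff_tendsto_slope.1 (hu.hasDerivWithinAt_one h h1)
      have h3 := h2.mono_left
        (nhdsWithin_mono 1 (sdiff_subset_sdiff_left (Ioc_subset_Iic_self (a := (0 : ℝ)))))
      refine h3.congr fun z => ?_
      rw [slope_def_field, h1]
    · rw [hf, continuousWithinAt_update_of_ne hx1]
      have := hu.cont
      have := sub_ne_zero.2 hx1
      exact ContinuousWithinAt.div (by fun_prop) (by fun_prop) this
  set ψ : ℂ → ℂ := fun s => (1 - ((1 + s) ^ m)⁻¹) / m with hψ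
  have hψ0 : ψ 0 = 0 := by simp [hψ]
  have hψa : AnalyticAt ℂ ψ 0 := by
    refine AnalyticAt.div_const (analyticAt_const.sub
      (((analyticAt_const.add analyticAt_id).pow m).fun_inv (by simp)))
  have hψd : deriv ψ 0 = 1 := by
    have h2 : HasDerivAt ψ (-(-((m : ℂ) * (1 + 0) ^ (m - 1) * 1) / ((1 + 0) ^ m) ^ 2) / m) 0 :=
      (((((hasDerivAt_id (0 : ℂ)).const_add 1).fun_pow m).fun_inv (by simp)).const_sub
          1).div_const _
    rw [h2.deriv]
    simp [hmC]
  set g : ℂ → ℂ := fun z => cNonlin p β (b + z) with hg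
  have hga : AnalyticAt ℂ g 0 := by
    refine AnalyticAt.fun_comp (g := cNonlin p β) (f := fun z => (b : ℂ) + z) ?_
      (analyticAt_const.add analyticAt_id)
    rw [add_zero]
    exact analyticAt_cNonlin p β h.b_pos
  have hgb : nonlin p β b = 0 := by
    rw [nonlin, abs_of_pos h.b_pos, h.b_pow, sub_self]
  have hg0 : g 0 = 0 := by
    rw [hg]
    beta_reduce
    rw [add_zero, cNonlin_ofReal p β h.b_pos, hgb, Complex.ofReal_zero]
  have hmem : (1 : ℝ) ∈ Ioc (0 : ℝ) 1 := by simp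
  obtain ⟨y, hy, hyf⟩ : ∃ y : ℂ → ℂ, AnalyticAt ℂ y 0 ∧
      ∀ᶠ x in 𝓝[Ioc 0 1] (1 : ℝ), (f x : ℂ) = y ((x - 1 : ℝ) : ℂ) := by
    refine exists_analyticAt_eq_of_volterra (φ := fun s => H * dslope ψ 0 s) (κ := baseKer m 1)
      (G := fun q => -(q.2 * dslope g 0 (q.1 * q.2)) / (2 + q.1)) (convex_Ioc 0 1) hmem hfc
      (analyticAt_const.mul hψa.dslope_self) (by rw [dslope_same, hψd, hf1, mul_one])
      (fun τ _ => analyticAt_baseKer m one_ne_zero _) (fun τ _ => baseKer_zero m one_ne_zero _)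
      ?_ ?_
    · refine AnalyticAt.fun_div (AnalyticAt.neg (analyticAt_snd.mul ?_))
        (analyticAt_const.add analyticAt_fst) (by simp)
      refine AnalyticAt.fun_comp (g := dslope g 0) (f := fun q : ℂ × ℂ => q.1 * q.2) ?_
        (analyticAt_fst.mul analyticAt_snd)
      rw [zero_mul]
      exact hga.dslope_self
    · filter_upwards [self_mem_nhdsWithin] with x hx
      rcases hx.2.eq_or_lt with rfl | hx1
      · simp [baseKer_zero, hψd, hf1]
      have hs : x - 1 ≠ 0 := sub_ne_zero.2 hx1.ne
      have hsC : (x : ℂ) - 1 ≠ 0 := by exact_mod_cast hs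
      have key := hu.eq_integral_one h h1 ⟨hx.1, hx1⟩
      rw [integral_eq_integral_unit, intervalIntegral.integral_const_mul] at key
      have hfx : f x = H * ((1 - (x ^ m)⁻¹) / m / (x - 1)) + ∫ t in (0 : ℝ)..1,
          (1 + t * (x - 1)) * (1 - ((1 + t * (x - 1)) / x) ^ m) / m *
            (nonlin p β (u (1 + t * (x - 1))) / (1 - (1 + t * (x - 1)) ^ 2)) := by
        rw [hfne x hx1.ne, key, ← hH]
        field_simp
        ring
      rw [hfx, Complex.ofReal_add, ← intervalIntegral.integral_ofReal]
      congr 1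
      · rw [dslope_of_ne _ (by exact_mod_cast hs), slope_def_field, hψ0]
        simp [hψ]
      refine intervalIntegral.integral_congr_ae (Eventually.of_forall fun t ht => ?_)
      rw [uIoc_of_le zero_le_one] at ht
      set σ := 1 + t * (x - 1) with hσ
      have ht0 : (t : ℂ) ≠ 0 := by exact_mod_cast ht.1.ne'
      have hσmem : σ ∈ Icc (0 : ℝ) 1 := by
        constructor <;> nlinarith [ht.1, ht.2, hx.1]
      have hσ2 : (2 : ℂ) + t * (x - 1) ≠ 0 := by
        have : (2 : ℝ) + t * (x - 1) ≠ 0 := by have := hσmem.1; linarith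
        exact_mod_cast this
      have huσ : u σ = b + t * (x - 1) * f σ := by
        rw [hfu σ, hσ]; ring
      have hF : ((nonlin p β (u σ) / (1 - σ ^ 2) : ℝ) : ℂ)
          = -(f σ * dslope g 0 (t * ((x - 1 : ℝ) : ℂ) * f σ)) / (2 + t * ((x - 1 : ℝ) : ℂ)) := by
        rcases eq_or_ne (f σ) 0 with h0 | h0
        · rw [huσ, h0, mul_zero, add_zero, hgb]
          simp
        · have h0C : (f σ : ℂ) ≠ 0 := by exact_mod_cast h0
          have hne : (t : ℂ) * ((x - 1 : ℝ) : ℂ) * f σ ≠ 0 := by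
            push_cast
            exact mul_ne_zero (mul_ne_zero ht0 hsC) h0C
          have hgσ : g ((t : ℂ) * ((x - 1 : ℝ) : ℂ) * f σ) = (nonlin p β (u σ) : ℂ) := by
            rw [← cNonlin_ofReal p β (hpos σ hσmem), huσ, hg]
            push_cast
            rfl
          have hden : ((1 - σ ^ 2 : ℝ) : ℂ) = -(t * (x - 1) * (2 + t * (x - 1))) := by
            rw [hσ]; push_cast; ring
          rw [dslope_of_ne _ hne, slope_def_field, hg0, hgσ, Complex.ofReal_div, hden]
          push_cast
          field_simp
          ring
      rw [Complex.ofReal_mul, hF, baseKer]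
      congr 1
      rw [hσ]
      push_cast
      rw [add_sub_cancel]
  refine ⟨fun x => b + (x - 1) * (y ((x - 1 : ℝ) : ℂ)).re, analyticAt_const.add
    ((analyticAt_id.sub analyticAt_const).mul (hy.re_comp_ofReal 1)), ?_⟩
  rw [nhdsWithin_Ioc_eq_nhdsLE zero_lt_one] at hyf
  filter_upwards [hyf] with x hx
  rw [← hx, Complex.ofReal_re, ← hfu]

end ProfileSol

/-- The left-hand side of the profile equation. -/
noncomputable def profileOp (m : ℕ) (p β : ℝ) (u : ℝ → ℝ) (ρ : ℝ) : ℝ :=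
  (1 - ρ ^ 2) * (deriv (deriv u) ρ + (m + 1) / ρ * deriv u ρ) - nonlin p β (u ρ)

lemma profileOp_congr {m : ℕ} {p β : ℝ} {u v : ℝ → ℝ} {ρ : ℝ} (h : u =ᶠ[𝓝 ρ] v) :
    profileOp m p β u ρ = profileOp m p β v ρ := by
  rw [profileOp, profileOp, h.deriv.deriv_eq, h.deriv_eq, h.eq_of_nhds]

lemma analyticAt_profileOp {m : ℕ} {p β : ℝ} {u : ℝ → ℝ} {ρ : ℝ} (hρ : ρ ≠ 0)
    (hu : AnalyticAt ℝ u ρ) (hpos : 0 < u ρ) : AnalyticAt ℝ (profileOp m p β u) ρ := by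
  have hpow : AnalyticAt ℝ (fun x => |u x| ^ (p - 1)) ρ := by
    have h : AnalyticAt ℝ (fun x => Real.exp (Real.log (u x) * (p - 1))) ρ :=
      ((hu.log hpos).mul analyticAt_const).rexp'
    refine h.congr ?_
    filter_upwards [hu.continuousAt.eventually (lt_mem_nhds hpos)] with x hx
    rw [abs_of_pos hx, Real.rpow_def_of_pos hx]
  have hnonlin : AnalyticAt ℝ (fun x => nonlin p β (u x)) ρ :=
    (analyticAt_const.mul hu).sub (hpow.mul hu)
  exact ((analyticAt_const.sub (analyticAt_id.pow 2)).mul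
    (hu.deriv.deriv.add ((analyticAt_const.div analyticAt_id hρ).mul hu.deriv))).sub hnonlin

namespace ProfileSol

variable {m : ℕ} {α p β b A : ℝ} {u : ℝ → ℝ}

lemma profileOp_eq_zero (h : Params m α p β b) (hu : ProfileSol m p β A u) {ρ : ℝ}
    (hρ : ρ ∈ Ioo (0 : ℝ) 1) : profileOp m p β u ρ = 0 := by
  have hderiv : deriv u =ᶠ[𝓝 ρ]
      fun x => flux m (fun σ => nonlin p β (u σ)) x / x ^ (m + 1) := by
    filter_upwards [Ioo_mem_nhds hρ.1 hρ.2] with x hx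
    exact (hu.hasDerivAt h hx).deriv
  have hne : 1 - ρ ^ 2 ≠ 0 := (one_sub_sq_pos ⟨by linarith [hρ.1], hρ.2⟩).ne'
  rw [profileOp, hderiv.deriv_eq, hderiv.eq_of_nhds,
    (hasDerivAt_div_pow hρ.1.ne' (hu.hasDerivAt_flux h hρ)).deriv]
  field_simp
  ring

/-- A positive profile with `u(1) = b` extends analytically past `ρ = 1` as a positive solution. -/
lemma exists_extension (h : Params m α p β b) (hu : ProfileSol m p β A u)
    (hpos : ∀ ρ ∈ Icc (0 : ℝ) 1, 0 < u ρ) (h1 : u 1 = b) :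
    ∃ (ρ₀ : ℝ) (v : ℝ → ℝ), 1 < ρ₀ ∧ EqOn v u (Icc 0 1) ∧ AnalyticOn ℝ v (Ico 0 ρ₀) ∧
      (∀ x ∈ Ico 0 ρ₀, 0 < v x) ∧ ∀ x ∈ Ioo 0 ρ₀, profileOp m p β v x = 0 := by
  obtain ⟨Y, hY, huY⟩ := hu.exists_analyticAt_one h hpos h1
  have hY1 : Y 1 = b := by rw [← h1]; exact (huY.self_of_nhdsWithin self_mem_Iic).symm
  have hYpos : 0 < Y 1 := hY1 ▸ h.b_pos
  have hop : ∀ᶠ x in 𝓝 1, profileOp m p β Y x = 0 := by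
    refine (analyticAt_profileOp one_ne_zero hY hYpos).frequently_zero_iff_eventually_zero.1 ?_
    have hlt : ∀ᶠ x in 𝓝[<] (1 : ℝ), profileOp m p β Y x = 0 := by
      have huY' := eventually_eventually_nhdsWithin.2
        (huY.filter_mono (nhdsWithin_mono 1 Iio_subset_Iic_self))
      filter_upwards [huY', Ioo_mem_nhdsLT zero_lt_one] with x hx hx01
      rw [IsOpen.nhdsWithin_eq isOpen_Iio hx01.2] at hx
      rw [← profileOp_congr hx, hu.profileOp_eq_zero h hx01]
    exact hlt.frequently.filter_mono (nhdsWithin_mono 1 fun x hx => ne_of_lt hx)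
  set v : ℝ → ℝ := fun x => if x < 1 then u x else Y x with hv
  have hvY : ∀ᶠ x in 𝓝 1, v x = Y x := by
    rw [eventually_nhdsWithin_iff] at huY
    filter_upwards [huY] with x hx
    simp only [hv]
    split_ifs with hx1
    · exact hx hx1.le
    · rfl
  have hvu : ∀ x < 1, v x = u x := fun x hx => if_pos hx
  have hvuev : ∀ x < 1, v =ᶠ[𝓝 x] u := fun x hx => by
    filter_upwards [Iio_mem_nhds hx] with y hy using hvu y hy
  obtain ⟨l, ρ₀, hmem, hsub⟩ := mem_nhds_iff_exists_Ioo_subset.1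
    (hvY.eventually_nhds.and (hY.eventually_analyticAt.and
      ((hY.continuousAt.eventually (lt_mem_nhds hYpos)).and hop)))
  have hright : ∀ x ∈ Ico 1 ρ₀, v =ᶠ[𝓝 x] Y ∧ AnalyticAt ℝ Y x ∧ 0 < Y x ∧
      profileOp m p β Y x = 0 := fun x hx => hsub ⟨hmem.1.trans_le hx.1, hx.2⟩
  refine ⟨ρ₀, v, hmem.2, fun x hx => ?_, fun x hx => ?_, fun x hx => ?_, fun x hx => ?_⟩
  · rcases hx.2.lt_or_eq with hx1 | rfl
    · exact hvu x hx1
    · rw [hvY.self_of_nhds, hY1, h1]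
  · rcases lt_or_ge x 1 with hx1 | hx1
    · rcases hx.1.eq_or_lt with rfl | hx0
      · refine ((hu.analyticWithinAt_zero h hpos).mono_of_mem_nhdsWithin ?_).congr_of_eventuallyEq
          (nhdsWithin_le_nhds (hvuev 0 hx1)) (hvu 0 hx1)
        filter_upwards [self_mem_nhdsWithin, nhdsWithin_le_nhds (Iio_mem_nhds hx1)] with y hy hy1
        exact ⟨hy.1, hy1⟩
      · exact ((hu.analyticAt h hpos ⟨hx0, hx1⟩).congr (hvuev x hx1).symm).analyticWithinAt
    · obtain ⟨hxv, hxa, -, -⟩ := hright x ⟨hx1, hx.2⟩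
      exact (hxa.congr hxv.symm).analyticWithinAt
  · rcases lt_or_ge x 1 with hx1 | hx1
    · rw [hvu x hx1]
      exact hpos x ⟨hx.1, hx1.le⟩
    · obtain ⟨hxv, -, hxp, -⟩ := hright x ⟨hx1, hx.2⟩
      rwa [hxv.eq_of_nhds]
  · rcases lt_or_ge x 1 with hx1 | hx1
    · rw [profileOp_congr (hvuev x hx1), hu.profileOp_eq_zero h ⟨hx.1, hx1⟩]
    · obtain ⟨hxv, -, -, hxo⟩ := hright x ⟨hx1, hx.2⟩
      rw [profileOp_congr hxv, hxo]

/-- Positive analytic profiles with arbitrarily large central value and arbitrarily many crossings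
with the singular solution. -/
lemma exists_profile (h : Params m α p β b) (n : ℕ) (C : ℝ) :
    ∃ (ρ₀ : ℝ) (v : ℝ → ℝ), 1 < ρ₀ ∧ AnalyticOn ℝ v (Ico 0 ρ₀) ∧ (∀ x ∈ Ico 0 ρ₀, 0 < v x) ∧
      (∀ x ∈ Ioo 0 ρ₀, profileOp m p β v x = 0) ∧ C < v 0 ∧ v 1 = b ∧ HasZeros α b v n := by
  obtain ⟨A₀, hA₀⟩ := eventually_atTop.1 h.eventually_pos
  obtain ⟨A, hA, u, hu, hu1, hz⟩ := exists_profileSol_one_eq h h.exists_hasZeros n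
    (C := max b (max C A₀)) (le_max_left _ _)
  obtain ⟨hbA, hCA, hAA⟩ : b < A ∧ C < A ∧ A₀ < A := by simpa using hA
  have hpos : ∀ ρ ∈ Icc (0 : ℝ) 1, 0 < u ρ := by
    intro ρ hρ
    rcases hρ.1.eq_or_lt with rfl | h0
    · rw [hu.zero]; exact h.b_pos.trans hbA
    · rcases hρ.2.lt_or_eq with h1 | rfl
      · exact hA₀ A hAA.le u hu ρ ⟨h0, h1⟩
      · rw [hu1]; exact h.b_pos
  obtain ⟨ρ₀, v, hρ₀, hvu, hva, hvpos, hvop⟩ := hu.exists_extension h hpos hu1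
  refine ⟨ρ₀, v, hρ₀, hva, hvpos, hvop, ?_, ?_, ?_⟩
  · rwa [hvu ⟨le_rfl, zero_le_one⟩, hu.zero]
  · rw [hvu ⟨zero_le_one, le_rfl⟩, hu1]
  · obtain ⟨s, hs, hs0⟩ := hz
    refine ⟨s, hs, fun i => ⟨(hs0 i).1, ?_⟩⟩
    rw [gap, hvu (Ioo_subset_Icc_self (hs0 i).1)]
    exact (hs0 i).2

end ProfileSol

lemma HasZeros.le_encard {α b : ℝ} {u : ℝ → ℝ} {n : ℕ} (h : HasZeros α b u n) :
    (n : ℕ∞) ≤ {x ∈ Ioo (0 : ℝ) 1 | gap α b u x = 0}.encard := by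
  obtain ⟨s, hs, hs0⟩ := h
  calc (n : ℕ∞) = ENat.card (Fin n) := by simp
    _ ≤ (range s).encard := hs.encard_range
    _ ≤ _ := encard_le_encard (range_subset_iff.2 hs0)

theorem stmt1 (N : ℕ) (p : ℝ) (hN : 4 ≤ N) (hp : p = 1 + 4 / ((N : ℝ) - 3))
    (n₀ : ℕ) (C₀ : ℝ) (hC₀ : 0 < C₀) :
    ∃ (ρ₀ : ℝ) (u : ℝ → ℝ),
      1 < ρ₀ ∧
      AnalyticOn ℝ u (Ico 0 ρ₀) ∧
      (∀ x ∈ Ico (0 : ℝ) ρ₀, 0 < u x) ∧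
      IsSolOn N p u (Ioo 0 ρ₀) ∧
      C₀ < u 0 ∧
      u 1 = b0 p ∧
      (n₀ : ℕ∞) ≤ {x ∈ Ioo (0 : ℝ) 1 | u x - uInf N p x = 0}.encard := by
  have hN' : (4 : ℝ) ≤ N := by exact_mod_cast hN
  set α : ℝ := ((N : ℝ) - 3) / 2 with hα
  have hα0 : 0 < α := by rw [hα]; linarith
  have hNα : (N : ℝ) = 2 * α + 3 := by rw [hα]; ring
  have hpα : p = 1 + 2 / α := by
    rw [hp, hNα]
    field_simp
    ring
  have hαP : alphaP p = α := by
    rw [alphaP, hpα]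
    field_simp
    ring
  have hβ : 0 < α * (α + 1) := by positivity
  have hb0 : b0 p = (α * (α + 1)) ^ (α / 2) := by
    rw [b0, hpα]
    congr 1 <;> field_simp <;> ring
  have hbInf : bInf N p = (α * (α + 1)) ^ (α / 2) := by
    rw [bInf, hαP, hNα]
    ring_nf
  have h : Params (N - 2) α p (α * (α + 1)) ((α * (α + 1)) ^ (α / 2)) :=
    { α_pos := hα0
      m_eq := by rw [Nat.cast_sub (by lia), hNα]; push_cast; ring
      p_eq := hpα
      β_eq := rfl
      b_pos := Real.rpow_pos_of_pos hβ _
      b_pow := by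
        rw [← Real.rpow_mul hβ.le, hpα, show α / 2 * (1 + 2 / α - 1) = 1 by field_simp; ring,
          Real.rpow_one] }
  obtain ⟨ρ₀, u, hρ₀, hua, hupos, huop, hu0, hu1, hz⟩ := ProfileSol.exists_profile h n₀ C₀
  refine ⟨ρ₀, u, hρ₀, hua, hupos, fun ρ hρ => ?_, hu0, by rw [hu1, hb0], ?_⟩
  · have hρ0 : ρ ≠ 0 := hρ.1.ne'
    rw [← huop ρ hρ, profileOp, nonlin, hαP, h.m_eq, hNα]
    field_simp
    ring
  · simpa only [uInf, hbInf, hαP, gap] using hz.le_encard
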